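/- arXiv:2408.01237 — 4 statements merged into one kernel-verified Lean document; each statement's English description precedes it below -/
import Mathlib

section
/- Let X ~ IDD(μ, 0, ν) with ∫_ℝ u² ν(du) < ∞, so that Var(X) = ∫_ℝ u² ν(du), and let Y₁ be a random variable, independent of X, with probability density f₁(y) = η₁(y) / ∫_ℝ u² ν(du) on ℝ. Then for every absolutely continuous function g : ℝ → ℝ with E[|g′(X+Y₁)|] < ∞ and E[|X g(X)|] < ∞, one has Cov(X, g(X)) = Var(X) · E[g′(X+Y₁)]. -/
open MeasureTheory ProbabilityTheory Complex Set

/-- Kernel `|x| 1{s strictly between 0 and x}`. -/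
noncomputable def steinK (p : ℝ × ℝ) : ℝ :=
  ({q : ℝ × ℝ | (0 < q.1 ∧ q.1 < q.2) ∨ (q.2 < q.1 ∧ q.1 < 0)}).indicator (fun q => |q.2|) p

lemma steinK_meas : Measurable steinK := by
  unfold steinK
  refine Measurable.indicator (by fun_prop) ?_
  refine MeasurableSet.union ?_ ?_
  · exact (measurableSet_lt measurable_const measurable_fst).inter
      (measurableSet_lt measurable_fst measurable_snd)
  · exact (measurableSet_lt measurable_snd measurable_fst).inter
      (measurableSet_lt measurable_fst measurable_const)

lemma steinK_nonneg (p : ℝ × ℝ) : 0 ≤ steinK p :=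
  Set.indicator_nonneg (fun _ _ => abs_nonneg _) p

noncomputable def steinM (κ : Measure ℝ) : Measure ℝ :=
  (((volume : Measure ℝ).prod κ).withDensity (fun p => ENNReal.ofReal (steinK p))).map Prod.fst

lemma steinK_slice {E : Type*} [NormedAddCommGroup E] [NormedSpace ℝ E] (h : ℝ → E) (x : ℝ) :
    ∫ s, steinK (s, x) • h s = x • ∫ s in (0:ℝ)..x, h s := by
  rcases le_or_gt 0 x with hx | hx
  · have : (fun s => steinK (s, x) • h s) = (Ioo 0 x).indicator (fun s => x • h s) := by
      ext s
      by_cases hs : 0 < s ∧ s < x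
      · have : s ∈ Ioo 0 x := hs
        simp [steinK, hs, this, abs_of_nonneg hx]
      · have h1 : s ∉ Ioo 0 x := hs
        have h2 : ¬ (x < s ∧ s < 0) := fun h => by linarith [h.1, h.2]
        simp only [steinK, Set.indicator, mem_ofPred_eq, hs, h2, h1]
        simp
    rw [this, integral_indicator measurableSet_Ioo, integral_smul,
      intervalIntegral.integral_of_le hx, integral_Ioc_eq_integral_Ioo]
  · have : (fun s => steinK (s, x) • h s) = (Ioo x 0).indicator (fun s => (-x) • h s) := by
      ext s
      by_cases hs : x < s ∧ s < 0
      · have : s ∈ Ioo x 0 := hs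
        simp [steinK, hs, this, abs_of_neg hx]
      · have h1 : s ∉ Ioo x 0 := hs
        have h2 : ¬ (0 < s ∧ s < x) := fun h => by linarith [h.1, h.2]
        simp only [steinK, Set.indicator, mem_ofPred_eq, hs, h2, h1]
        simp
    rw [this, integral_indicator measurableSet_Ioo, integral_smul,
      intervalIntegral.integral_of_ge hx.le, integral_Ioc_eq_integral_Ioo]
    simp

lemma steinM_integral {E : Type*} [NormedAddCommGroup E] [NormedSpace ℝ E]
    (κ : Measure ℝ) [SFinite κ] (h : ℝ → E) (hh : Integrable h (steinM κ)) :
    ∫ s, h s ∂(steinM κ) = ∫ x, x • (∫ s in (0:ℝ)..x, h s) ∂κ := by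
  have hm : Measurable (fun p => ENNReal.ofReal (steinK p)) := steinK_meas.ennreal_ofReal
  have h1 := hh
  unfold steinM at h1 ⊢
  rw [integral_map measurable_fst.aemeasurable h1.1,
    integral_withDensity_eq_integral_toReal_smul hm (by simp)]
  have h2 := (integrable_withDensity_iff_integrable_smul' hm (by simp)).1
    ((integrable_map_measure h1.1 measurable_fst.aemeasurable).1 h1)
  simp only [Function.comp] at h2
  rw [integral_prod_symm _ h2]
  congr 1
  ext x
  rw [← steinK_slice]
  congr 1
  ext s
  rw [ENNReal.toReal_ofReal (steinK_nonneg _)]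

lemma steinM_eq (κ : Measure ℝ) [SFinite κ] :
    steinM κ = volume.withDensity (fun s => ∫⁻ x, ENNReal.ofReal (steinK (s, x)) ∂κ) := by
  have hm : Measurable (fun p => ENNReal.ofReal (steinK p)) := steinK_meas.ennreal_ofReal
  ext A hA
  unfold steinM
  rw [Measure.map_apply measurable_fst hA, withDensity_apply _ (measurable_fst hA),
    withDensity_apply _ hA]
  have : Prod.fst ⁻¹' A = A ×ˢ (univ : Set ℝ) := by ext; simp
  rw [this, ← Measure.prod_restrict, lintegral_prod _ hm.aemeasurable]
  simp

lemma steinM_finite (κ : Measure ℝ) [SFinite κ] (h : Integrable (fun u : ℝ => u ^ 2) κ) :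
    IsFiniteMeasure (steinM κ) := by
  have hm : Measurable (fun p => ENNReal.ofReal (steinK p)) := steinK_meas.ennreal_ofReal
  constructor
  unfold steinM
  rw [Measure.map_apply measurable_fst MeasurableSet.univ, preimage_univ,
    withDensity_apply _ MeasurableSet.univ, Measure.restrict_univ,
    lintegral_prod_symm _ hm.aemeasurable]
  refine lt_of_le_of_lt ?_ h.lintegral_lt_top
  refine lintegral_mono fun x => ?_
  dsimp only
  have : ∀ s, ENNReal.ofReal (steinK (s, x)) ≤
      (uIoc 0 x).indicator (fun _ => ENNReal.ofReal |x|) s := by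
    intro s
    by_cases hs : (0 < s ∧ s < x) ∨ (x < s ∧ s < 0)
    · have : s ∈ uIoc 0 x := by
        rw [mem_uIoc]; rcases hs with h | h
        · exact Or.inl ⟨h.1, h.2.le⟩
        · exact Or.inr ⟨h.1, h.2.le⟩
      rw [indicator_of_mem this]
      simp [steinK, hs]
    · simp [steinK, hs]
  refine (lintegral_mono this).trans ?_
  rw [lintegral_indicator measurableSet_uIoc, setLIntegral_const, uIoc, Real.volume_Ioc,
    max_sub_min_eq_abs, ← ENNReal.ofReal_mul (abs_nonneg _)]
  apply ENNReal.ofReal_le_ofReal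
  rw [sub_zero, abs_mul_abs_self, sq]

lemma sfinite_of_sq (ν : Measure ℝ) (hν0 : ν {0} = 0)
    (hν2 : Integrable (fun u : ℝ => u ^ 2) ν) : SFinite ν := by
  have hf : IsFiniteMeasure (ν.withDensity (fun u => ENNReal.ofReal (u ^ 2))) :=
    isFiniteMeasure_withDensity_ofReal hν2.2
  have h := withDensity_inv_same (μ := ν) (f := fun u => ENNReal.ofReal (u ^ 2))
    (by fun_prop) (by
      have : ∀ᵐ u ∂ν, u ≠ 0 := by
        rw [ae_iff]; simpa using hν0
      filter_upwards [this] with u hu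
      have : 0 < u ^ 2 := by positivity
      simpa using hu) (by simp)
  rw [← h]
  infer_instance

lemma charFun_steinM (κ : Measure ℝ) [SFinite κ] (h : Integrable (fun u : ℝ => u ^ 2) κ) (t : ℝ) :
    (t * I) * charFun (steinM κ) t = ∫ x, (x : ℂ) * (exp (t * x * I) - 1) ∂κ := by
  have := steinM_finite κ h
  rw [charFun_apply_real, steinM_integral, ← integral_const_mul]
  · congr 1
    ext x
    rcases eq_or_ne t 0 with rfl | ht
    · simp
    have hc : ((t:ℂ) * I) ≠ 0 := by simp [ht]
    have : ∀ s : ℝ, exp (t * s * I) = exp ((t * I) * s) := fun s => by ring_nf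
    simp_rw [this]
    rw [integral_exp_mul_complex hc]
    simp only [real_smul, ofReal_zero, mul_zero, Complex.exp_zero]
    have ht' : (t:ℂ) ≠ 0 := by exact_mod_cast ht
    field_simp
  · refine (integrable_const (1:ℝ)).mono' (by fun_prop) ?_
    refine Filter.Eventually.of_forall fun s => ?_
    rw [← ofReal_mul, norm_exp_ofReal_mul_I]

lemma exp_bound (x : ℝ) : ‖exp (x * I) - 1 - x * I‖ ≤ 2 * x ^ 2 := by
  by_cases hx : |x| ≤ 1
  · have := norm_exp_sub_one_sub_id_le (x := x * I) (by simpa using hx)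
    simp at this
    nlinarith [sq_nonneg x]
  · push Not at hx
    have h1 : ‖exp (x * I) - 1‖ ≤ |x| := by
      have := Real.norm_exp_I_mul_ofReal_sub_one_le (x := x)
      rwa [mul_comm I] at this
    have h2 := norm_sub_le (exp (x * I) - 1) (x * I)
    have h3 : ‖(x:ℂ) * I‖ = |x| := by simp
    nlinarith [sq_abs x]

lemma exp_bound1 (x : ℝ) : ‖exp (x * I) - 1‖ ≤ |x| := by
  have := Real.norm_exp_I_mul_ofReal_sub_one_le (x := x)
  rwa [mul_comm I] at this

lemma psi_hasDeriv (ν : Measure ℝ) (hν2 : Integrable (fun u : ℝ => u ^ 2) ν) (t : ℝ) :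
    HasDerivAt (fun t : ℝ => ∫ u : ℝ, (exp (t * u * I) - 1 - t * u * I) ∂ν)
      (∫ u : ℝ, I * (u * (exp (t * u * I) - 1)) ∂ν) t := by
  refine (hasDerivAt_integral_of_dominated_loc_of_deriv_le (𝕜 := ℝ) (μ := ν)
    (F := fun (t u : ℝ) => (exp (t * u * I) - 1 - t * u * I))
    (F' := fun (t u : ℝ) => I * (u * (exp (t * u * I) - 1)))
    (bound := fun u => (|t| + 1) * u ^ 2)
    (Metric.ball_mem_nhds t one_pos) (Filter.Eventually.of_forall fun s => by fun_prop) ?_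
    (by fun_prop) ?_ (hν2.const_mul _) ?_).2
  · refine (hν2.const_mul (2 * t ^ 2)).mono' (by fun_prop) (Filter.Eventually.of_forall fun u => ?_)
    have := exp_bound (t * u)
    push_cast at this
    refine this.trans (le_of_eq (by ring))
  · refine Filter.Eventually.of_forall fun u s hs => ?_
    have h1 := exp_bound1 (s * u)
    push_cast at h1
    rw [Metric.mem_ball, Real.dist_eq] at hs
    have hs' : |s| ≤ |t| + 1 := by
      have := abs_sub_abs_le_abs_sub s t
      linarith
    rw [norm_mul, norm_mul, norm_I, one_mul, norm_real, Real.norm_eq_abs]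
    calc |u| * _ ≤ |u| * |s * u| := by gcongr
      _ = |s| * u ^ 2 := by rw [abs_mul, ← sq_abs u]; ring
      _ ≤ _ := by gcongr
  · refine Filter.Eventually.of_forall fun u s hs => ?_
    have h0 : HasDerivAt (fun s : ℝ => (s : ℂ) * u * I) (1 * u * I) s :=
      ((hasDerivAt_id s).ofReal_comp.mul_const _).mul_const _
    have := (h0.cexp.sub_const 1).sub h0
    refine this.congr_deriv ?_
    ring

lemma sq_integrable (ρ ν : Measure ℝ) [IsProbabilityMeasure ρ]
    (hν2 : Integrable (fun u : ℝ => u ^ 2) ν)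
    (hcf : ∀ t : ℝ, charFun ρ t = exp (∫ u : ℝ, (exp (t * u * I) - 1 - t * u * I) ∂ν)) :
    Integrable (fun x : ℝ => x ^ 2) ρ := by
  set S : ℝ := ∫ u, u ^ 2 ∂ν with hS
  have hS0 : 0 ≤ S := integral_nonneg fun u => sq_nonneg u
  have hψ : ∀ t : ℝ, ‖∫ u : ℝ, (exp (t * u * I) - 1 - t * u * I) ∂ν‖ ≤ 2 * t ^ 2 * S := by
    intro t
    rw [hS, ← integral_const_mul]
    refine norm_integral_le_of_norm_le (hν2.const_mul _) (Filter.Eventually.of_forall fun u => ?_)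
    have := exp_bound (t * u)
    push_cast at this
    refine this.trans (le_of_eq (by ring))
  have hbd : ∀ᶠ n : ℕ in Filter.atTop, 1 ≤ (n:ℝ) ∧ 2 * S ≤ (n:ℝ) :=
    (Filter.tendsto_atTop.1 tendsto_natCast_atTop_atTop 1).and
      (Filter.tendsto_atTop.1 tendsto_natCast_atTop_atTop (2 * S))
  have hcov : AECover ρ Filter.atTop (fun n : ℕ => Icc (-(n:ℝ)) n) :=
    aecover_Icc (Filter.tendsto_neg_atTop_atBot.comp tendsto_natCast_atTop_atTop)
      tendsto_natCast_atTop_atTop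
  refine hcov.integrable_of_integral_norm_bounded (Real.pi ^ 2 / 2 * (4 * S))
    (fun n => (by fun_prop : Continuous fun x : ℝ => x ^ 2).continuousOn.integrableOn_Icc) ?_
  filter_upwards [hbd] with n hn
  obtain ⟨hn1, hn2⟩ := hn
  have hn0 : (0:ℝ) < n := by linarith
  set t : ℝ := (n:ℝ)⁻¹ with ht
  have ht0 : 0 < t := by positivity
  have htn : t * n = 1 := by rw [ht]; field_simp
  have hexpint : Integrable (fun x : ℝ => exp (t * x * I)) ρ := by
    refine (integrable_const (1:ℝ)).mono' (by fun_prop) ?_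
    refine Filter.Eventually.of_forall fun s => ?_
    rw [← ofReal_mul, norm_exp_ofReal_mul_I]
  have hre : ∀ x : ℝ, (exp (t * x * I)).re = Real.cos (t * x) := by
    intro x
    rw [← ofReal_mul, exp_ofReal_mul_I_re]
  have hcosint : Integrable (fun x : ℝ => Real.cos (t * x)) ρ := by
    have := hexpint.re
    refine this.congr (Filter.Eventually.of_forall fun x => ?_)
    exact hre x
  have hI : ∫ x, (1 - Real.cos (t * x)) ∂ρ ≤ 4 * t ^ 2 * S := by
    have h1 : ∫ x, (1 - Real.cos (t * x)) ∂ρ = (1 - charFun ρ t).re := by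
      rw [integral_sub (integrable_const _) hcosint, charFun_apply_real, sub_re]
      have := integral_re hexpint
      simp only [RCLike.re_eq_complex_re, hre] at this
      rw [this]
      simp
    rw [h1]
    have h2 := hψ t
    have h3 : 2 * t ^ 2 * S ≤ 1 := by
      have : 2 * S * t ≤ 1 := by rw [← htn, mul_comm t]; gcongr
      have : t ≤ 1 := by rw [← htn]; nlinarith
      nlinarith
    have h4 := norm_exp_sub_one_le (h2.trans h3)
    rw [← hcf] at h4
    have h5 := Complex.re_le_norm (1 - charFun ρ t)
    rw [norm_sub_rev] at h5
    linarith
  calc ∫ x in Icc (-(n:ℝ)) n, ‖x ^ 2‖ ∂ρ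
      ≤ ∫ x in Icc (-(n:ℝ)) n, n ^ 2 * (Real.pi ^ 2 / 2) * (1 - Real.cos (t * x)) ∂ρ := by
        refine setIntegral_mono_on ?_ ?_ measurableSet_Icc ?_
        · exact (by fun_prop : Continuous fun x : ℝ => ‖x ^ 2‖).continuousOn.integrableOn_Icc
        · exact (((integrable_const (1:ℝ)).sub hcosint).const_mul _).integrableOn
        · intro x hx
          have habs : |t * x| ≤ Real.pi := by
            rw [abs_mul, abs_of_pos ht0]
            have : |x| ≤ n := abs_le.2 hx
            have : t * |x| ≤ t * n := by gcongr
            linarith [Real.pi_gt_three]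
          have h := Real.cos_le_one_sub_mul_cos_sq habs
          have hp := Real.pi_pos
          rw [Real.norm_eq_abs, abs_of_nonneg (sq_nonneg x)]
          have h' : 2 / Real.pi ^ 2 * (t * x) ^ 2 ≤ 1 - Real.cos (t * x) := by linarith
          calc x ^ 2 = n ^ 2 * (Real.pi ^ 2 / 2) * (2 / Real.pi ^ 2 * (t * x) ^ 2) := by
                rw [ht]; field_simp
            _ ≤ _ := by gcongr
    _ ≤ ∫ x, n ^ 2 * (Real.pi ^ 2 / 2) * (1 - Real.cos (t * x)) ∂ρ := by
        refine setIntegral_le_integral (((integrable_const (1:ℝ)).sub hcosint).const_mul _)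
          (Filter.Eventually.of_forall fun x => ?_)
        have := Real.cos_le_one (t * x)
        have : 0 ≤ 1 - Real.cos (t * x) := by linarith
        simp only [Pi.zero_apply]
        positivity
    _ = n ^ 2 * (Real.pi ^ 2 / 2) * ∫ x, (1 - Real.cos (t * x)) ∂ρ := integral_const_mul _ _
    _ ≤ n ^ 2 * (Real.pi ^ 2 / 2) * (4 * t ^ 2 * S) := by gcongr
    _ = _ := by rw [ht]; field_simp

lemma id_integrable (ρ : Measure ℝ) [IsProbabilityMeasure ρ]
    (h : Integrable (fun x : ℝ => x ^ 2) ρ) : Integrable (fun x : ℝ => x) ρ := by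
  refine ((integrable_const (1:ℝ)).add h).mono' (by fun_prop)
    (Filter.Eventually.of_forall fun x => ?_)
  simp only [Pi.add_apply, Real.norm_eq_abs]
  nlinarith [sq_abs x, sq_nonneg (|x| - 1), abs_nonneg x]

lemma stein_charFun (ρ ν : Measure ℝ) [IsProbabilityMeasure ρ]
    (hν2 : Integrable (fun u : ℝ => u ^ 2) ν)
    (hcf : ∀ t : ℝ, charFun ρ t = exp (∫ u : ℝ, (exp (t * u * I) - 1 - t * u * I) ∂ν)) (t : ℝ) :
    ∫ x : ℝ, (x : ℂ) * exp (t * x * I) ∂ρ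
      = charFun ρ t * ∫ u : ℝ, (u * (exp (t * u * I) - 1) : ℂ) ∂ν := by
  have hid := id_integrable ρ (sq_integrable ρ ν hν2 hcf)
  have h1 : HasDerivAt (fun t : ℝ => ∫ x : ℝ, exp (t * x * I) ∂ρ)
      (∫ x : ℝ, I * (x * exp (t * x * I)) ∂ρ) t := by
    refine (hasDerivAt_integral_of_dominated_loc_of_deriv_le (𝕜 := ℝ) (μ := ρ)
      (F := fun (t u : ℝ) => exp (t * u * I))
      (F' := fun (t u : ℝ) => I * (u * exp (t * u * I)))
      (bound := fun u => |u|)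
      (Metric.ball_mem_nhds t one_pos) (Filter.Eventually.of_forall fun s => by fun_prop) ?_
      (by fun_prop) ?_ hid.abs ?_).2
    · refine (integrable_const (1:ℝ)).mono' (by fun_prop) ?_
      refine Filter.Eventually.of_forall fun s => ?_
      rw [← ofReal_mul, norm_exp_ofReal_mul_I]
    · refine Filter.Eventually.of_forall fun u s hs => ?_
      rw [norm_mul, norm_mul, norm_I, one_mul, norm_real, Real.norm_eq_abs, ← ofReal_mul,
        norm_exp_ofReal_mul_I, mul_one]
    · refine Filter.Eventually.of_forall fun u s hs => ?_
      have h0 : HasDerivAt (fun s : ℝ => (s : ℂ) * u * I) (1 * u * I) s :=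
        ((hasDerivAt_id s).ofReal_comp.mul_const _).mul_const _
      refine h0.cexp.congr_deriv ?_
      ring
  have h2 := (psi_hasDeriv ν hν2 t).cexp
  have h3 : (fun t : ℝ => ∫ x : ℝ, exp (t * x * I) ∂ρ) =
      fun t : ℝ => exp (∫ u : ℝ, (exp (t * u * I) - 1 - t * u * I) ∂ν) := by
    ext s
    rw [← hcf, charFun_apply_real]
  rw [h3] at h1
  have h4 := h1.unique h2
  rw [← hcf, integral_const_mul, integral_const_mul] at h4
  have h5 : I * (∫ x : ℝ, (x : ℂ) * exp (t * x * I) ∂ρ) =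
    I * (charFun ρ t * ∫ u : ℝ, (u * (exp (t * u * I) - 1) : ℂ) ∂ν) := by rw [h4]; ring
  exact mul_left_cancel₀ I_ne_zero h5

lemma stein_mean (ρ ν : Measure ℝ) [IsProbabilityMeasure ρ]
    (hν2 : Integrable (fun u : ℝ => u ^ 2) ν)
    (hcf : ∀ t : ℝ, charFun ρ t = exp (∫ u : ℝ, (exp (t * u * I) - 1 - t * u * I) ∂ν)) :
    ∫ x : ℝ, x ∂ρ = 0 := by
  have := stein_charFun ρ ν hν2 hcf 0
  simp at this
  have h2 := integral_ofReal (𝕜 := ℂ) (μ := ρ) (f := fun x : ℝ => x)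
  simp at h2
  rw [h2] at this
  exact_mod_cast this

/-- the law of `Z + Y` is the Stein-kernel measure of `Z`, up to scaling. -/
lemma stein_key (ρ ν τ θ : Measure ℝ) [IsProbabilityMeasure ρ] [IsProbabilityMeasure τ]
    [IsProbabilityMeasure θ] [SFinite ν]
    (hν2 : Integrable (fun u : ℝ => u ^ 2) ν)
    (hcf : ∀ t : ℝ, charFun ρ t = exp (∫ u : ℝ, (exp (t * u * I) - 1 - t * u * I) ∂ν))
    (c : ℝ) (hc : 0 ≤ c)
    (hτ : steinM ν = ENNReal.ofReal c • τ) (hθ : charFun θ = charFun ρ * charFun τ) :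
    steinM ρ = ENNReal.ofReal c • θ := by
  have hsq := sq_integrable ρ ν hν2 hcf
  have hid := id_integrable ρ hsq
  have := steinM_finite ρ hsq
  have : IsFiniteMeasure (ENNReal.ofReal c • θ) := Measure.smul_finite _ ENNReal.ofReal_ne_top
  have hsm : ∀ (m : Measure ℝ) (t : ℝ), charFun (ENNReal.ofReal c • m) t = c * charFun m t := by
    intro m t
    rw [charFun_apply_real, integral_smul_measure, charFun_apply_real, ENNReal.toReal_ofReal hc,
      real_smul]
  apply Measure.ext_of_charFun
  refine Continuous.ext_on (s := ({0}ᶜ : Set ℝ)) (dense_compl_singleton 0) continuous_charFun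
    continuous_charFun ?_
  intro t ht
  have ht : t ≠ 0 := ht
  have htI : ((t:ℂ) * I) ≠ 0 := by simp [ht]
  apply mul_left_cancel₀ htI
  have h1 := charFun_steinM ν hν2 t
  rw [hτ, hsm] at h1
  have hint : Integrable (fun x : ℝ => (x : ℂ) * exp (t * x * I)) ρ := by
    refine hid.abs.mono' (by fun_prop) (Filter.Eventually.of_forall fun x => ?_)
    rw [norm_mul, norm_real, Real.norm_eq_abs, ← ofReal_mul, norm_exp_ofReal_mul_I, mul_one]
  rw [charFun_steinM ρ hsq, hsm, hθ]
  simp only [mul_sub, mul_one]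
  rw [integral_sub (f := fun x : ℝ => (x : ℂ) * exp (t * x * I)) (g := fun x : ℝ => (x : ℂ))
    hint hid.ofReal, stein_charFun ρ ν hν2 hcf, ← h1]
  have h2 := integral_ofReal (𝕜 := ℂ) (μ := ρ) (f := fun x : ℝ => x)
  rw [stein_mean ρ ν hν2 hcf] at h2
  simp only [coe_algebraMap] at h2
  rw [show (∫ a : ℝ, (a : ℂ) ∂ρ) = 0 by simpa using h2]
  simp only [Pi.mul_apply]
  ring

lemma steinM_density (ν : Measure ℝ) [SFinite ν]
    (hν2 : Integrable (fun u : ℝ => u ^ 2) ν)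
    (η₁ : ℝ → ℝ)
    (hη₁ : ∀ v : ℝ,
      (0 < v → η₁ v = ∫ y in Ioi v, y ∂ν) ∧
      (v < 0 → η₁ v = - ∫ y in Iio v, y ∂ν)) :
    steinM ν = volume.withDensity (fun y => ENNReal.ofReal (η₁ y)) := by
  rw [steinM_eq]
  apply withDensity_congr_ae
  have h0 : ∀ᵐ v : ℝ, v ≠ 0 := by
    rw [ae_iff]; simp
  filter_upwards [h0] with v hv
  rcases lt_or_gt_of_ne hv with hv | hv
  · have h1 : ∀ x, ENNReal.ofReal (steinK (v, x)) =
        (Iio v).indicator (fun x => ENNReal.ofReal (-x)) x := by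
      intro x
      by_cases hx : x < v
      · have : x ∈ Iio v := hx
        simp [steinK, hx, hv, abs_of_neg (hx.trans hv)]
      · simp [steinK, hx, hv.le]
    simp_rw [h1]
    rw [lintegral_indicator measurableSet_Iio, (hη₁ v).2 hv, ← integral_neg,
      ofReal_integral_eq_lintegral_ofReal]
    · have : IntegrableOn (fun u : ℝ => (-v)⁻¹ * u ^ 2) (Iio v) ν := (hν2.const_mul _).integrableOn
      refine this.mono' (by fun_prop) ?_
      filter_upwards [ae_restrict_mem measurableSet_Iio] with x hx
      have hx : x < v := hx
      rw [norm_neg, Real.norm_eq_abs, abs_of_neg (hx.trans hv), inv_mul_eq_div,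
        le_div_iff₀ (by linarith)]
      nlinarith
    · filter_upwards [ae_restrict_mem measurableSet_Iio] with x hx
      have hx : x < v := hx
      simp only [Pi.zero_apply]; linarith
  · have h1 : ∀ x, ENNReal.ofReal (steinK (v, x)) =
        (Ioi v).indicator (fun x => ENNReal.ofReal x) x := by
      intro x
      by_cases hx : v < x
      · have : x ∈ Ioi v := hx
        simp [steinK, hx, hv, abs_of_pos (hv.trans hx)]
      · have h2 : ¬ v < 0 := not_lt.2 hv.le
        simp [steinK, hx, h2, Set.indicator]
    simp_rw [h1]
    rw [lintegral_indicator measurableSet_Ioi, (hη₁ v).1 hv,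
      ofReal_integral_eq_lintegral_ofReal]
    · have : IntegrableOn (fun u : ℝ => v⁻¹ * u ^ 2) (Ioi v) ν := (hν2.const_mul _).integrableOn
      refine this.mono' (by fun_prop) ?_
      filter_upwards [ae_restrict_mem measurableSet_Ioi] with x hx
      have hx : v < x := hx
      rw [Real.norm_eq_abs, abs_of_pos (hv.trans hx), inv_mul_eq_div,
        le_div_iff₀ (by linarith)]
      nlinarith
    · filter_upwards [ae_restrict_mem measurableSet_Ioi] with x hx
      have hx : v < x := hx
      simp only [Pi.zero_apply]; linarith

/-- **Stein-type covariance identity for IDD with non-zero bias.**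
If `X ~ IDD(μ, 0, ν)` has finite second moment and `Y₁`, independent of `X`, has density
`f₁(y) = η₁(y) / ∫ u² ν(du)`, then `Cov(X, g(X)) = Var(X) · E[g'(X + Y₁)]`,
where `Var(X) = ∫ u² ν(du)`. -/
theorem covariance_identity_IDD
    {Ω : Type*} [MeasureSpace Ω] [IsProbabilityMeasure (ℙ : Measure Ω)]
    (X Y₁ : Ω → ℝ) (hX : Measurable X) (hY₁ : Measurable Y₁)
    (μ : ℝ) (ν : Measure ℝ)
    (hν0 : ν {0} = 0)
    (hνfin : ∫⁻ u : ℝ, ENNReal.ofReal (min 1 (u ^ 2)) ∂ν < ⊤)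
    -- X ~ IDD(μ, 0, ν)
    (hcf : ∀ t : ℝ,
      ∫ ω, Complex.exp (Complex.I * t * X ω) ∂ℙ
        = Complex.exp (Complex.I * t * μ
            + ∫ u : ℝ, (Complex.exp (Complex.I * t * u) - 1 - Complex.I * t * u) ∂ν))
    -- finite second moment of ν : ∫ u² ν(du) < ∞
    (hν2 : Integrable (fun u : ℝ => u ^ 2) ν)
    -- the function η₁
    (η₁ : ℝ → ℝ)
    (hη₁ : ∀ v : ℝ,
      (0 < v → η₁ v = ∫ y in Ioi v, y ∂ν) ∧
      (v < 0 → η₁ v = - ∫ y in Iio v, y ∂ν))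
    -- Y₁ is independent of X and has density f₁(y) = η₁(y) / ∫ u² ν(du)
    (hindep : IndepFun X Y₁ ℙ)
    (hY₁law : Measure.map Y₁ ℙ
      = volume.withDensity (fun y => ENNReal.ofReal (η₁ y / ∫ u : ℝ, u ^ 2 ∂ν)))
    -- g is absolutely continuous with derivative g'
    (g g' : ℝ → ℝ)
    (hg'loc : LocallyIntegrable g' volume)
    (hg : ∀ x : ℝ, g x = g 0 + ∫ t in (0:ℝ)..x, g' t)
    -- integrability assumptions
    (hint1 : Integrable (fun ω => g' (X ω + Y₁ ω)) ℙ)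
    (hint2 : Integrable (fun ω => X ω * g (X ω)) ℙ) :
    (∫ ω, X ω * g (X ω) ∂ℙ) - (∫ ω, X ω ∂ℙ) * (∫ ω, g (X ω) ∂ℙ)
      = (∫ u : ℝ, u ^ 2 ∂ν) * ∫ ω, g' (X ω + Y₁ ω) ∂ℙ := by
  set c : ℝ := ∫ u : ℝ, u ^ 2 ∂ν with hcdef
  have hc0 : 0 ≤ c := integral_nonneg fun u => sq_nonneg u
  have hc : 0 < c := by
    rcases hc0.eq_or_lt with h | h
    · exfalso
      have h1 : IsProbabilityMeasure (Measure.map Y₁ ℙ) :=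
        Measure.isProbabilityMeasure_map hY₁.aemeasurable
      have h2 : (Measure.map Y₁ ℙ) = 0 := by
        rw [hY₁law, ← h]; simp
      exact h1.ne_zero _ h2
    · exact h
  have : SFinite ν := sfinite_of_sq ν hν0 hν2
  have hZ : Measurable (fun ω => X ω - μ) := hX.sub_const μ
  have hW : Measurable (fun ω => (X ω - μ) + Y₁ ω) := hZ.add hY₁
  set ρ : Measure ℝ := Measure.map (fun ω => X ω - μ) ℙ with hρ
  set θ : Measure ℝ := Measure.map (fun ω => (X ω - μ) + Y₁ ω) ℙ with hθdef
  have : IsProbabilityMeasure ρ := Measure.isProbabilityMeasure_map hZ.aemeasurable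
  have : IsProbabilityMeasure θ := Measure.isProbabilityMeasure_map hW.aemeasurable
  have : IsProbabilityMeasure (Measure.map Y₁ ℙ) :=
    Measure.isProbabilityMeasure_map hY₁.aemeasurable
  have hcf' : ∀ t : ℝ, charFun ρ t =
      exp (∫ u : ℝ, (exp (t * u * I) - 1 - t * u * I) ∂ν) := by
    intro t
    rw [charFun_apply_real, hρ, integral_map hZ.aemeasurable (by fun_prop)]
    have e1 : ∀ ω, exp (t * ((X ω - μ : ℝ) : ℂ) * I) = exp (I * t * X ω) * exp (-(I * t * μ)) := by
      intro ω
      rw [← Complex.exp_add]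
      congr 1
      push_cast
      ring
    simp_rw [e1]
    rw [integral_mul_const, hcf, ← Complex.exp_add]
    congr 1
    rw [add_neg_cancel_comm]
    congr 1
    ext u
    rw [show I * (t:ℂ) * u = t * u * I by ring]
  have hτ : steinM ν = ENNReal.ofReal c • Measure.map Y₁ ℙ := by
    rw [steinM_density ν hν2 η₁ hη₁, hY₁law, ← withDensity_smul' _ _ ENNReal.ofReal_ne_top]
    congr 1
    ext y
    simp only [Pi.smul_apply, smul_eq_mul]
    rw [← ENNReal.ofReal_mul hc0, mul_div_cancel₀ _ hc.ne']
  have hθ : charFun θ = charFun ρ * charFun (Measure.map Y₁ ℙ) := by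
    have hi : IndepFun (fun ω => X ω - μ) Y₁ ℙ :=
      hindep.comp (φ := fun x => x - μ) (ψ := id) (by fun_prop) measurable_id
    exact hi.charFun_map_fun_add_eq_mul hZ.aemeasurable hY₁.aemeasurable
  have key := stein_key ρ ν (Measure.map Y₁ ℙ) θ hν2 hcf' c hc0 hτ hθ
  have hsq := sq_integrable ρ ν hν2 hcf'
  have hid := id_integrable ρ hsq
  have hmean := stein_mean ρ ν hν2 hcf'
  have hcE : ENNReal.ofReal c ≠ 0 := by simpa using hc
  have hac : θ ≪ volume := by
    have h1 : steinM ρ ≪ volume := by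
      rw [steinM_eq]; exact withDensity_absolutelyContinuous _ _
    rw [key] at h1
    exact (Measure.absolutelyContinuous_smul hcE).trans h1
  have hmp : MeasurePreserving (fun s : ℝ => s + μ) volume volume :=
    measurePreserving_add_right volume μ
  have hg'm : AEStronglyMeasurable (fun s => g' (s + μ)) volume :=
    hg'loc.aestronglyMeasurable.comp_measurePreserving hmp
  have hg'θ : AEStronglyMeasurable (fun s => g' (s + μ)) θ := hg'm.mono_ac hac
  have hshift : ∀ ω, g' (((X ω - μ) + Y₁ ω) + μ) = g' (X ω + Y₁ ω) := fun ω => by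
    congr 1; ring
  have hhθ : Integrable (fun s => g' (s + μ)) θ := by
    rw [hθdef, integrable_map_measure hg'θ hW.aemeasurable]
    simpa only [Function.comp_def, hshift] using hint1
  have hhM : Integrable (fun s => g' (s + μ)) (steinM ρ) := by
    rw [key]; exact hhθ.smul_measure ENNReal.ofReal_ne_top
  have hfin := steinM_integral ρ _ hhM
  rw [key, integral_smul_measure, ENNReal.toReal_ofReal hc0, hθdef,
    integral_map hW.aemeasurable hg'θ] at hfin
  simp only [hshift, smul_eq_mul] at hfin
  have hii : ∀ a b : ℝ, IntervalIntegrable g' volume a b := fun a b =>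
    (hg'loc.integrableOn_isCompact isCompact_uIcc).intervalIntegrable
  have hsub : ∀ x : ℝ, (∫ s in (0:ℝ)..x, g' (s + μ)) = g (x + μ) - g μ := by
    intro x
    rw [intervalIntegral.integral_comp_add_right, hg (x + μ), hg μ, zero_add,
      ← intervalIntegral.integral_add_adjacent_intervals (hii 0 μ) (hii μ (x + μ))]
    ring
  simp only [hsub] at hfin
  have hgc : Continuous g := by
    have : g = fun x => g 0 + ∫ t in (0:ℝ)..x, g' t := funext hg
    rw [this]
    exact continuous_const.add (intervalIntegral.continuous_primitive hii 0)
  rw [hfin, hρ, integral_map hZ.aemeasurable (by fun_prop)]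
  simp only [sub_add_cancel]
  have hZi : Integrable (fun ω => X ω - μ) ℙ := by
    rw [hρ, integrable_map_measure (by fun_prop) hZ.aemeasurable] at hid
    exact hid
  have hXi : Integrable X ℙ := by
    have := hZi.add (integrable_const μ)
    refine this.congr (Filter.Eventually.of_forall fun ω => ?_)
    simp
  have hmean' : ∫ ω, X ω ∂ℙ = μ := by
    rw [hρ, integral_map hZ.aemeasurable (by fun_prop), integral_sub hXi (integrable_const _)] at hmean
    simp at hmean
    linarith
  have hgi : Integrable (fun ω => g (X ω)) ℙ := by
    obtain ⟨C, hC⟩ := isCompact_Icc.exists_bound_of_continuousOn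
      (s := Icc (-1:ℝ) 1) hgc.continuousOn
    refine ((integrable_const |C|).add hint2.norm).mono'
      (hgc.measurable.comp hX).aestronglyMeasurable (Filter.Eventually.of_forall fun ω => ?_)
    simp only [Pi.add_apply]
    by_cases h : |X ω| ≤ 1
    · have := hC (X ω) (abs_le.1 h)
      have := le_abs_self C
      have := norm_nonneg (X ω * g (X ω))
      linarith
    · push Not at h
      rw [norm_mul, Real.norm_eq_abs (X ω)]
      have := norm_nonneg (g (X ω))
      have := abs_nonneg C
      nlinarith
  have e : (fun ω => (X ω - μ) * (g (X ω) - g μ)) =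
      fun ω => (X ω * g (X ω) - μ * g (X ω)) - (X ω - μ) * g μ := by
    ext ω; ring
  rw [e, integral_sub (f := fun ω => X ω * g (X ω) - μ * g (X ω))
    (hint2.sub (hgi.const_mul μ)) (hZi.mul_const _),
    integral_sub hint2 (hgi.const_mul μ), integral_const_mul, integral_mul_const,
    integral_sub hXi (integrable_const _), hmean']
  simp
end

section
/- Let X ~ IDD(μ, 0, ν) be nonnegative (so ν is supported on (0,∞)) with E[X^n] < ∞ for a fixed integer n ≥ 1, let C_k(X) = ∫_{(0,∞)} u^k ν(du) denote its k-th cumulant for k ≥ 2, and for k ≥ 1 let Y_k be a random variable with density f_k(y) = η_k(y)/C_{k+1}(X) on (0,∞), independent of everything else. For each s ∈ [0,1] let (X_s, Y_s) be a random vector with joint characteristic function E[exp(i(tX_s + zY_s))] = exp((1−s)ψ(t) + (1−s)ψ(z) + sψ(t+z)) for all t, z ∈ ℝ. Then for every absolutely continuous g : ℝ → ℝ with E[|Y_s^k g′(X_s + Y_{n−k})|] < ∞ for 0 ≤ k ≤ n−1, one has Cov(X^n, g(X)) = Σ_{k=0}^{n−1} (n choose k) C_{n−k+1}(X) ∫_0^1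 E[Y_s^k g′(X_s + Y_{n−k})] ds. -/
open MeasureTheory ProbabilityTheory Complex Set

lemma aux_iter_chain (N : ℕ) (F : ℕ → ℝ → ℂ)
    (h : ∀ j < N, ∀ x, HasDerivAt (F j) (F (j+1) x) x) :
    ∀ j ≤ N, iteratedDeriv j (F 0) = F j := by
  intro j
  induction j with
  | zero => intro _; simp
  | succ j ih =>
    intro hj
    rw [iteratedDeriv_succ, ih (by omega)]
    funext x
    exact (h j (by omega) x).deriv

lemma aux_chain_smooth (F : ℕ → ℝ → ℂ)
    (h : ∀ j, ∀ x, HasDerivAt (F j) (F (j+1) x) x) (m : ℕ) :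
    ContDiff ℝ m (F 0) := by
  apply contDiff_of_differentiable_iteratedDeriv (n := m)
  intro j _ x
  rw [aux_iter_chain j F (fun i _ => h i) j le_rfl]
  exact (h j x).differentiableAt

lemma aux_norm_exp (z y : ℝ) : ‖Complex.exp (I * z * y)‖ = 1 := by
  rw [show I * (z:ℂ) * y = ((z * y : ℝ) : ℂ) * I by push_cast; ring]
  exact Complex.norm_exp_ofReal_mul_I _

lemma aux_hasDeriv_exp (y x : ℝ) :
    HasDerivAt (fun z : ℝ => Complex.exp (I * z * y)) (I * y * Complex.exp (I * x * y)) x := by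
  have h1 : HasDerivAt (fun z : ℝ => I * (z:ℂ) * y) (I * 1 * y) x :=
    ((Complex.ofRealCLM.hasDerivAt (x := x)).const_mul I).mul_const (y:ℂ)
  convert h1.cexp using 1
  ring

lemma aux_step {Ω : Type*} [MeasurableSpace Ω] (P : Measure Ω) (Y : Ω → ℝ) (hY : Measurable Y)
    (w : Ω → ℂ) (hw : Measurable w) (hw1 : ∀ ω, ‖w ω‖ ≤ 1) (j : ℕ)
    (h1 : Integrable (fun ω => Y ω ^ j) P) (h2 : Integrable (fun ω => Y ω ^ (j+1)) P) (x : ℝ) :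
    HasDerivAt (fun z : ℝ => ∫ ω, w ω * (I * Y ω) ^ j * Complex.exp (I * z * Y ω) ∂P)
      (∫ ω, w ω * (I * Y ω) ^ (j+1) * Complex.exp (I * x * Y ω) ∂P) x := by
  have hm : ∀ (i : ℕ) (z : ℝ),
      Measurable (fun ω => w ω * (I * Y ω) ^ i * Complex.exp (I * z * Y ω)) := by
    intro i z; fun_prop
  have hb : ∀ (i : ℕ) (z : ℝ) ω,
      ‖w ω * (I * Y ω) ^ i * Complex.exp (I * z * Y ω)‖ ≤ ‖Y ω ^ i‖ := by
    intro i z ω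
    rw [norm_mul, norm_mul, aux_norm_exp, mul_one, norm_pow, norm_mul, norm_I, one_mul,
      norm_pow, Complex.norm_real]
    exact mul_le_of_le_one_left (by positivity) (hw1 ω)
  refine (hasDerivAt_integral_of_dominated_loc_of_deriv_le (s := univ) (bound := fun ω => ‖Y ω ^ (j+1)‖)
    (F := fun (z : ℝ) ω => w ω * (I * Y ω) ^ j * Complex.exp (I * z * Y ω))
    (F' := fun (z : ℝ) ω => w ω * (I * Y ω) ^ (j+1) * Complex.exp (I * z * Y ω))
    Filter.univ_mem ?_ ?_ ?_ ?_ h2.norm ?_).2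
  · exact Filter.Eventually.of_forall fun z => (hm j z).aestronglyMeasurable
  · exact h1.mono (hm j x).aestronglyMeasurable (Filter.Eventually.of_forall (hb j x))
  · exact (hm (j+1) x).aestronglyMeasurable
  · exact Filter.Eventually.of_forall fun ω z _ => hb (j+1) z ω
  · refine Filter.Eventually.of_forall fun ω z _ => ?_
    exact ((aux_hasDeriv_exp (Y ω) z).const_mul (w ω * (I * Y ω) ^ j)).congr_deriv (by ring)

/-- iterated derivatives of a weighted characteristic function -/
lemma aux_moment_iter {Ω : Type*} [MeasurableSpace Ω] (P : Measure Ω) (Y : Ω → ℝ) (hY : Measurable Y)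
    (w : Ω → ℂ) (hw : Measurable w) (hw1 : ∀ ω, ‖w ω‖ ≤ 1) (N : ℕ)
    (h1 : ∀ j ≤ N, Integrable (fun ω => Y ω ^ j) P) (j : ℕ) (hj : j ≤ N) (x : ℝ) :
    iteratedDeriv j (fun z : ℝ => ∫ ω, w ω * Complex.exp (I * z * Y ω) ∂P) x
     = ∫ ω, w ω * (I * Y ω) ^ j * Complex.exp (I * x * Y ω) ∂P := by
  have := aux_iter_chain N (fun j (z : ℝ) => ∫ ω, w ω * (I * Y ω) ^ j * Complex.exp (I * z * Y ω) ∂P)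
    (fun i hi x => aux_step P Y hY w hw hw1 i (h1 i (by omega)) (h1 (i+1) (by omega)) x) j hj
  rw [← congrFun this x]
  simp

lemma aux_exp1 (z y : ℝ) : ‖Complex.exp (I * z * y) - 1‖ ≤ |z * y| := by
  have := Real.norm_exp_I_mul_ofReal_sub_one_le (x := z * y)
  push_cast at this
  rw [← mul_assoc] at this
  simpa [abs_mul] using this

lemma aux_exp2 (z y : ℝ) : ‖Complex.exp (I * z * y) - 1 - I * z * y‖ ≤ 3 * (z * y) ^ 2 := by
  have hn : ‖I * z * y‖ = |z * y| := by simp [abs_mul]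
  rcases le_total (|z * y|) 1 with h | h
  · have := Complex.norm_exp_sub_one_sub_id_le (x := I * z * y) (by rw [hn]; exact h)
    rw [hn, sq_abs] at this
    nlinarith [sq_nonneg (z * y)]
  · calc _ ≤ ‖Complex.exp (I * z * y) - 1‖ + ‖I * z * y‖ := norm_sub_le _ _
      _ ≤ |z * y| + |z * y| := add_le_add (aux_exp1 z y) hn.le
      _ ≤ 3 * |z*y|^2 := by nlinarith
      _ = _ := by rw [sq_abs]

noncomputable def auxPsi (μ : ℝ) (ν : Measure ℝ) : ℕ → ℝ → ℂ
  | 0, t => I * t * μ + ∫ u : ℝ, (Complex.exp (I * t * u) - 1 - I * t * u) ∂ν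
  | 1, t => I * μ + ∫ u : ℝ, (I * u * (Complex.exp (I * t * u) - 1)) ∂ν
  | (j+2), t => ∫ u : ℝ, (1:ℂ) * (I * u) ^ (j+2) * Complex.exp (I * t * u) ∂ν

lemma aux_int1 (ν : Measure ℝ) (h : Integrable (fun u : ℝ => u ^ 2) ν) (t : ℝ) :
    Integrable (fun u : ℝ => I * u * (Complex.exp (I * t * u) - 1)) ν := by
  refine (h.const_mul |t|).mono' (by fun_prop) (Filter.Eventually.of_forall fun u => ?_)
  rw [norm_mul, norm_mul, norm_I, one_mul, Complex.norm_real, Real.norm_eq_abs]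
  have := aux_exp1 t u
  rw [abs_mul] at this
  calc _ ≤ |u| * (|t| * |u|) := by gcongr
    _ = |t| * |u|^2 := by ring
    _ = _ := by rw [sq_abs]

lemma aux_psi_chain (μ : ℝ) (ν : Measure ℝ)
    (h : ∀ j : ℕ, 2 ≤ j → Integrable (fun u : ℝ => u ^ j) ν) (j : ℕ) (x : ℝ) :
    HasDerivAt (auxPsi μ ν j) (auxPsi μ ν (j+1) x) x := by
  match j with
  | 0 =>
    have hd : HasDerivAt (fun t : ℝ => I * (t:ℂ) * μ) (I * μ) x := by
      have := ((Complex.ofRealCLM.hasDerivAt (x := x)).const_mul I).mul_const (μ:ℂ)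
      simpa using this
    refine hd.add ?_
    refine (hasDerivAt_integral_of_dominated_loc_of_deriv_le (s := Metric.ball x 1)
      (bound := fun u => (|x| + 1) * u ^ 2)
      (F := fun (t : ℝ) u => Complex.exp (I * t * u) - 1 - I * t * u)
      (F' := fun (t : ℝ) u => I * u * (Complex.exp (I * t * u) - 1))
      (Metric.ball_mem_nhds x one_pos) ?_ ?_ ?_ ?_ ((h 2 le_rfl).const_mul _) ?_).2
    · exact Filter.Eventually.of_forall fun z => by fun_prop
    · refine ((h 2 le_rfl).const_mul (3 * x^2)).mono' (by fun_prop)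
        (Filter.Eventually.of_forall fun u => ?_)
      refine (aux_exp2 x u).trans (le_of_eq (by ring))
    · fun_prop
    · refine Filter.Eventually.of_forall fun u z hz => ?_
      rw [norm_mul, norm_mul, norm_I, one_mul, Complex.norm_real, Real.norm_eq_abs]
      have := aux_exp1 z u
      rw [abs_mul] at this
      have hz' : |z| ≤ |x| + 1 := by
        have : |z - x| < 1 := by simpa [Real.dist_eq] using hz
        have := abs_add_le (z - x) x
        simp at this; linarith
      calc _ ≤ |u| * (|z| * |u|) := by gcongr
        _ = |z| * |u|^2 := by ring
        _ ≤ (|x| + 1) * |u|^2 := by gcongr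
        _ = _ := by rw [sq_abs]
    · refine Filter.Eventually.of_forall fun u z _ => ?_
      have h1 : HasDerivAt (fun z : ℝ => I * (z:ℂ) * u) (I * 1 * u) z :=
        ((Complex.ofRealCLM.hasDerivAt (x := z)).const_mul I).mul_const (u:ℂ)
      exact (((aux_hasDeriv_exp u z).sub_const 1).sub h1).congr_deriv (by ring)
  | 1 =>
    have := (hasDerivAt_integral_of_dominated_loc_of_deriv_le (s := univ)
      (bound := fun u => u ^ 2) (μ := ν)
      (F := fun (t : ℝ) u => I * u * (Complex.exp (I * t * u) - 1))
      (F' := fun (t : ℝ) u => (1:ℂ) * (I * u) ^ (0+2) * Complex.exp (I * t * u)) (x₀ := x)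
      Filter.univ_mem ?_ (aux_int1 ν (h 2 le_rfl) x) ?_ ?_ (h 2 le_rfl) ?_).2
    · exact this.const_add _
    · exact Filter.Eventually.of_forall fun z => by fun_prop
    · fun_prop
    · refine Filter.Eventually.of_forall fun u z hz => ?_
      rw [norm_mul, aux_norm_exp]; simp
    · refine Filter.Eventually.of_forall fun u z _ => ?_
      exact (((aux_hasDeriv_exp u z).sub_const 1).const_mul (I * u)).congr_deriv (by ring)
  | (j+2) =>
    exact aux_step ν (fun u => u) measurable_id (fun _ => 1) measurable_const (by simp) (j+2)
      (h _ (by omega)) (h _ (by omega)) x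

lemma aux_psi_diff (μ : ℝ) (ν : Measure ℝ)
    (h : ∀ j : ℕ, 2 ≤ j → Integrable (fun u : ℝ => u ^ j) ν) (j : ℕ) (hj : 1 ≤ j) (t : ℝ) :
    iteratedDeriv j (auxPsi μ ν 0) t - iteratedDeriv j (auxPsi μ ν 0) 0
      = I ^ j * ∫ u : ℝ, (u:ℂ) ^ j * (Complex.exp (I * t * u) - 1) ∂ν := by
  rw [aux_iter_chain j _ (fun i _ => aux_psi_chain μ ν h i) j le_rfl]
  match j, hj with
  | 1, _ =>
    simp only [auxPsi]
    simp [mul_assoc, integral_const_mul]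
  | (j+2), _ =>
    simp only [auxPsi]
    have hi : ∀ s : ℝ, Integrable (fun u : ℝ => (1:ℂ) * (I * u) ^ (j+2) * Complex.exp (I * s * u)) ν := by
      intro s
      refine (h (j+2) (by omega)).norm.mono' (by fun_prop) (Filter.Eventually.of_forall fun u => ?_)
      rw [norm_mul, aux_norm_exp]; simp
    rw [← integral_sub (hi t) (hi 0), ← integral_const_mul]
    congr 1; funext u
    simp [mul_pow]; ring

section
open scoped ContDiff

/-- derivative of `γ e^{α+sβ}` -/
lemma auxB_deriv (α β γ : ℝ → ℂ) (hα : ContDiff ℝ ∞ α) (hβ : ContDiff ℝ ∞ β)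
    (hγ : ContDiff ℝ ∞ γ) (s : ℝ) :
    deriv (fun z => γ z * Complex.exp (α z + s * β z)) =
     fun z => (deriv γ z + γ z * deriv α z) * Complex.exp (α z + s * β z)
       + s * ((γ z * deriv β z) * Complex.exp (α z + s * β z)) := by
  funext z
  have h1 := (hα.differentiable (by simp) z).hasDerivAt
  have h2 := (hβ.differentiable (by simp) z).hasDerivAt
  have h3 := (hγ.differentiable (by simp) z).hasDerivAt
  have := (h3.mul (h1.add (h2.const_mul (s:ℂ))).cexp).deriv
  refine (Eq.trans ?_ this).trans ?_
  · rfl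
  · simp only [Pi.add_apply]; ring

lemma auxB_derivC (γ : ℝ → ℂ) (hγ : ContDiff ℝ ∞ γ) : ContDiff ℝ ∞ (deriv γ) :=
  ((contDiff_infty_iff_deriv).1 hγ).2

lemma auxB_succ (α β γ : ℝ → ℂ) (hα : ContDiff ℝ ∞ α) (hβ : ContDiff ℝ ∞ β)
    (hγ : ContDiff ℝ ∞ γ) (s : ℝ) (k : ℕ) (z : ℝ) :
    iteratedDeriv (k+1) (fun z => γ z * Complex.exp (α z + s * β z)) z =
      iteratedDeriv k (fun z => (deriv γ z + γ z * deriv α z) * Complex.exp (α z + s * β z)) z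
       + s * iteratedDeriv k (fun z => (γ z * deriv β z) * Complex.exp (α z + s * β z)) z := by
  have h1 := auxB_derivC α hα
  have h2 := auxB_derivC β hβ
  have h3 := auxB_derivC γ hγ
  rw [iteratedDeriv_succ', auxB_deriv α β γ hα hβ hγ s, iteratedDeriv_fun_add,
    iteratedDeriv_const_mul_field]
  · apply ContDiff.contDiffAt
    exact (ContDiff.of_le (n := ∞) (by fun_prop) (by exact_mod_cast le_top))
  · apply ContDiff.contDiffAt
    exact (ContDiff.of_le (n := ∞) (by fun_prop) (by exact_mod_cast le_top))

lemma auxB_hasDeriv (α β : ℝ → ℂ) (hα : ContDiff ℝ ∞ α) (hβ : ContDiff ℝ ∞ β) (k : ℕ) :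
    ∀ (γ : ℝ → ℂ) (_ : ContDiff ℝ ∞ γ) (z s : ℝ),
    HasDerivAt (fun s : ℝ => iteratedDeriv k (fun z => γ z * Complex.exp (α z + s * β z)) z)
      (iteratedDeriv k (fun z => (γ z * β z) * Complex.exp (α z + s * β z)) z) s := by
  induction k with
  | zero =>
    intro γ hγ z s
    simp only [iteratedDeriv_zero]
    have h : HasDerivAt (fun s : ℝ => α z + (s:ℂ) * β z) (1 * β z) s :=
      ((Complex.ofRealCLM.hasDerivAt (x := s)).mul_const (β z)).const_add _
    exact (h.cexp.const_mul (γ z)).congr_deriv (by ring)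
  | succ k ih =>
    intro γ hγ z s
    have h1 := auxB_derivC α hα
    have h2 := auxB_derivC β hβ
    have h3 := auxB_derivC γ hγ
    simp_rw [auxB_succ α β γ hα hβ hγ]
    have hs : HasDerivAt (fun s : ℝ => (s:ℂ)) 1 s := Complex.ofRealCLM.hasDerivAt (x := s)
    refine ((ih _ (by fun_prop) z s).add (hs.mul (ih _ (by fun_prop) z s))).congr_deriv ?_
    rw [auxB_succ α β (fun z => γ z * β z) hα hβ (by fun_prop)]
    have hd : ∀ z, deriv (fun z => γ z * β z) z = deriv γ z * β z + γ z * deriv β z := fun z =>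
      ((hγ.differentiable (by simp) z).hasDerivAt.mul
        (hβ.differentiable (by simp) z).hasDerivAt).deriv
    simp_rw [hd]
    have e : (fun z => (deriv γ z * β z + γ z * deriv β z + γ z * β z * deriv α z)
        * Complex.exp (α z + s * β z)) = fun z => ((deriv γ z + γ z * deriv α z) * β z
        * Complex.exp (α z + s * β z)) + (γ z * deriv β z) * Complex.exp (α z + s * β z) := by
      funext z; ring
    rw [e, iteratedDeriv_fun_add]
    · have e2 : (fun z => γ z * β z * deriv β z * Complex.exp (α z + s * β z))
        = fun z => γ z * deriv β z * β z * Complex.exp (α z + s * β z) := by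
        funext z; ring
      rw [e2]; ring
    · apply ContDiff.contDiffAt
      exact (ContDiff.of_le (n := ∞) (by fun_prop) (by exact_mod_cast le_top))
    · apply ContDiff.contDiffAt
      exact (ContDiff.of_le (n := ∞) (by fun_prop) (by exact_mod_cast le_top))

lemma auxB_poly (α β : ℝ → ℂ) (hα : ContDiff ℝ ∞ α) (hβ : ContDiff ℝ ∞ β) (h0 : β 0 = 0) (k : ℕ) :
    ∀ (γ : ℝ → ℂ) (_ : ContDiff ℝ ∞ γ), ∃ p : Polynomial ℂ, p.natDegree ≤ k ∧
      ∀ s : ℝ, iteratedDeriv k (fun z => γ z * Complex.exp (α z + s * β z)) 0 = p.eval (s:ℂ) := by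
  induction k with
  | zero =>
    intro γ hγ
    refine ⟨Polynomial.C (γ 0 * Complex.exp (α 0)), (Polynomial.natDegree_C _).le, fun s => ?_⟩
    simp [h0]
  | succ k ih =>
    intro γ hγ
    have h1 := auxB_derivC α hα
    have h2 := auxB_derivC β hβ
    have h3 := auxB_derivC γ hγ
    obtain ⟨p, hp, hp'⟩ := ih (fun z => deriv γ z + γ z * deriv α z) (by fun_prop)
    obtain ⟨q, hq, hq'⟩ := ih (fun z => γ z * deriv β z) (by fun_prop)
    refine ⟨p + Polynomial.X * q, ?_, fun s => ?_⟩
    · refine (Polynomial.natDegree_add_le _ _).trans (max_le (by omega) ?_)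
      exact (Polynomial.natDegree_mul_le).trans (by simp; omega)
    · rw [auxB_succ α β γ hα hβ hγ, hp', hq']
      simp

noncomputable def auxNode (i : ℕ) : ℝ := 1 / ((i:ℝ) + 1)

lemma auxNode_mem (i : ℕ) : auxNode i ∈ Icc (0:ℝ) 1 := by
  unfold auxNode
  constructor
  · positivity
  · rw [div_le_one (by positivity)]; simp

lemma auxNode_inj : Function.Injective auxNode := by
  intro i j h
  unfold auxNode at h
  rw [one_div, one_div, inv_inj] at h
  have : (i:ℝ) = j := by linarith
  exact_mod_cast this

noncomputable def auxLag (n i : ℕ) (s : ℝ) : ℝ :=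
  (Lagrange.basis (Finset.range (n+1)) auxNode i).eval s

lemma auxLag_cont (n i : ℕ) : Continuous (auxLag n i) := Polynomial.continuous _

lemma auxLag_pow (n l : ℕ) (hl : l ≤ n) (s : ℝ) :
    s ^ l = ∑ i ∈ Finset.range (n+1), auxLag n i s * auxNode i ^ l := by
  have h := Lagrange.eq_interpolate (s := Finset.range (n+1)) (v := auxNode)
    (f := (Polynomial.X : Polynomial ℝ) ^ l) (auxNode_inj.injOn) (by
      rw [Polynomial.degree_X_pow, Finset.card_range]; exact_mod_cast Nat.lt_succ_of_le hl)
  have h2 := congrArg (Polynomial.eval s) h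
  rw [Lagrange.interpolate_apply, Polynomial.eval_finsetSum] at h2
  simpa [auxLag, mul_comm] using h2

lemma auxLag_poly (n : ℕ) (p : Polynomial ℂ) (hp : p.natDegree ≤ n) (s : ℝ) :
    p.eval (s:ℂ) = ∑ i ∈ Finset.range (n+1), (auxLag n i s : ℂ) * p.eval (auxNode i : ℂ) := by
  simp_rw [Polynomial.eval_eq_sum_range' (Nat.lt_succ_of_le hp)]
  simp_rw [Finset.mul_sum]
  rw [Finset.sum_comm]
  refine Finset.sum_congr rfl fun l hl => ?_
  have := auxLag_pow n l (by simpa [Nat.lt_succ_iff] using hl) s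
  have h2 : (s:ℂ) ^ l = ∑ i ∈ Finset.range (n+1), (auxLag n i s : ℂ) * (auxNode i : ℂ) ^ l := by
    exact_mod_cast congrArg (fun x : ℝ => (x:ℂ)) this
  rw [h2, Finset.mul_sum]
  exact Finset.sum_congr rfl fun i _ => by ring

/-- The key algebraic identity, for `A k s = ∂_z^k e^{α+sβ} (0)`. -/
lemma auxB_lag (α β : ℝ → ℂ) (hα : ContDiff ℝ ∞ α) (hβ : ContDiff ℝ ∞ β) (h0 : β 0 = 0) (n k : ℕ)
    (hk : k ≤ n) (s : ℝ) :
    iteratedDeriv k (fun z => Complex.exp (α z + s * β z)) 0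
    = ∑ i ∈ Finset.range (n+1), (auxLag n i s : ℂ) *
        iteratedDeriv k (fun z => Complex.exp (α z + auxNode i * β z)) 0 := by
  obtain ⟨p, hp, hp'⟩ := auxB_poly α β hα hβ h0 k (fun _ => 1) contDiff_const
  simp only [one_mul] at hp'
  simp_rw [hp']
  exact auxLag_poly n p (hp.trans hk) s

lemma auxB_main (α β : ℝ → ℂ) (hα : ContDiff ℝ ∞ α) (hβ : ContDiff ℝ ∞ β) (h0 : β 0 = 0) (n : ℕ) :
    iteratedDeriv n (fun z => Complex.exp (α z + β z)) 0
      - iteratedDeriv n (fun z => Complex.exp (α z)) 0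
    = ∑ k ∈ Finset.range n, (n.choose k : ℂ) * iteratedDeriv (n-k) β 0 *
       ∑ i ∈ Finset.range (n+1), ((∫ s in (0:ℝ)..1, auxLag n i s : ℝ) : ℂ) *
        iteratedDeriv k (fun z => Complex.exp (α z + auxNode i * β z)) 0 := by
  have hder : ∀ s : ℝ, HasDerivAt
      (fun s : ℝ => iteratedDeriv n (fun z => Complex.exp (α z + s * β z)) 0)
      (∑ k ∈ Finset.range n, (n.choose k : ℂ) * iteratedDeriv (n-k) β 0 *
        ∑ i ∈ Finset.range (n+1), (auxLag n i s : ℂ) *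
        iteratedDeriv k (fun z => Complex.exp (α z + auxNode i * β z)) 0) s := by
    intro s
    have := auxB_hasDeriv α β hα hβ n (fun _ => 1) contDiff_const 0 s
    simp only [one_mul] at this
    refine this.congr_deriv ?_
    have e : (fun z => β z * Complex.exp (α z + s * β z))
       = (fun z => Complex.exp (α z + s * β z)) * β := by funext z; simp [mul_comm]
    rw [e, iteratedDeriv_mul, Finset.sum_range_succ]
    · simp only [Nat.sub_self, iteratedDeriv_zero, h0, mul_zero, add_zero]
      refine Finset.sum_congr rfl fun k hk => ?_
      rw [auxB_lag α β hα hβ h0 n k (Finset.mem_range.1 hk).le s]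
      ring
    · apply ContDiff.contDiffAt
      exact (ContDiff.of_le (n := ∞) (by fun_prop) (by exact_mod_cast le_top))
    · apply ContDiff.contDiffAt
      exact (ContDiff.of_le (n := ∞) (by fun_prop) (by exact_mod_cast le_top))
  have hc : ∀ i, Continuous (fun s => (auxLag n i s : ℂ)) := fun i =>
    Complex.continuous_ofReal.comp (auxLag_cont n i)
  have := intervalIntegral.integral_eq_sub_of_hasDerivAt (a := 0) (b := 1) (fun s _ => hder s)
    (Continuous.intervalIntegrable (by fun_prop) _ _)
  simp only [ofReal_one, one_mul, ofReal_zero, zero_mul, add_zero] at this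
  rw [← this, intervalIntegral.integral_finsetSum]
  · refine Finset.sum_congr rfl fun k hk => ?_
    rw [intervalIntegral.integral_const_mul, intervalIntegral.integral_finsetSum]
    · congr 1
      refine Finset.sum_congr rfl fun i hi => ?_
      rw [intervalIntegral.integral_mul_const, intervalIntegral.integral_ofReal]
    · intro i _; exact Continuous.intervalIntegrable (by fun_prop) _ _
  · intro i _; exact Continuous.intervalIntegrable (by fun_prop) _ _

end


noncomputable def auxSum {ι : Type*} (J : Finset ι) (c : ι → ℝ) (ρ : ι → Measure ℝ) : Measure ℝ :=
  ∑ i ∈ J, ENNReal.ofReal (c i) • ρ i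

lemma auxSum_finite {ι : Type*} (J : Finset ι) (c : ι → ℝ) (ρ : ι → Measure ℝ)
    (hρ : ∀ i, IsFiniteMeasure (ρ i)) : IsFiniteMeasure (auxSum J c ρ) := by
  constructor
  unfold auxSum
  simp only [Measure.coe_finsetSum, Finset.sum_apply, Measure.smul_apply, smul_eq_mul]
  refine ENNReal.sum_lt_top.2 fun i _ => ?_
  exact ENNReal.mul_lt_top ENNReal.ofReal_lt_top (measure_lt_top _ _)

lemma auxSum_integrable {E : Type*} [NormedAddCommGroup E] [NormedSpace ℝ E]
    {ι : Type*} (J : Finset ι) (c : ι → ℝ) (ρ : ι → Measure ℝ)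
    (f : ℝ → E) (hf : ∀ i ∈ J, Integrable f (ρ i)) : Integrable f (auxSum J c ρ) := by
  unfold auxSum
  rw [integrable_finsetSum_measure]
  intro i hi
  exact (hf i hi).smul_measure (by simp)

lemma auxSum_integral {E : Type*} [NormedAddCommGroup E] [NormedSpace ℝ E] [CompleteSpace E]
    {ι : Type*} (J : Finset ι) (c : ι → ℝ) (ρ : ι → Measure ℝ)
    (f : ℝ → E) (hf : ∀ i ∈ J, Integrable f (ρ i)) :
    ∫ x, f x ∂(auxSum J c ρ) = ∑ i ∈ J, (max (c i) 0) • ∫ x, f x ∂(ρ i) := by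
  unfold auxSum
  rw [integral_finsetSum_measure]
  · refine Finset.sum_congr rfl fun i hi => ?_
    rw [integral_smul_measure]; simp [ENNReal.toReal_ofReal']
  · intro i hi
    exact (hf i hi).smul_measure (by simp)

lemma aux_charFun_int (ρ : Measure ℝ) [IsFiniteMeasure ρ] (t : ℝ) :
    Integrable (fun x : ℝ => Complex.exp (t * x * I)) ρ := by
  refine (integrable_const (1:ℝ)).mono' (by fun_prop) (Filter.Eventually.of_forall fun x => ?_)
  rw [show (t:ℂ) * x * I = ((t * x : ℝ) : ℂ) * I by push_cast; ring, Complex.norm_exp_ofReal_mul_I]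

lemma aux_signed {ι : Type*} (J : Finset ι) (c : ι → ℝ) (ρ : ι → Measure ℝ) (σ : Measure ℝ)
    (hρ : ∀ i, IsFiniteMeasure (ρ i)) [IsFiniteMeasure σ]
    (h : ∀ t : ℝ, t ≠ 0 → charFun σ t = ∑ i ∈ J, (c i : ℂ) * charFun (ρ i) t) :
    σ + auxSum J (fun i => - c i) ρ = auxSum J c ρ := by
  have f1 := auxSum_finite J c ρ hρ
  have f2 := auxSum_finite J (fun i => - c i) ρ hρ
  have h' : ∀ t : ℝ, charFun σ t = ∑ i ∈ J, (c i : ℂ) * charFun (ρ i) t := by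
    have : charFun σ = fun t => ∑ i ∈ J, (c i : ℂ) * charFun (ρ i) t := by
      refine Continuous.ext_on (dense_compl_singleton (0:ℝ)) continuous_charFun ?_ ?_
      · refine continuous_finsetSum _ fun i _ => continuous_const.mul ?_
        exact continuous_charFun
      · intro t ht; exact h t ht
    exact fun t => congrFun this t
  refine Measure.ext_of_charFun (funext fun t => ?_)
  have e := h' t
  simp_rw [charFun_apply_real] at e ⊢
  rw [integral_add_measure (aux_charFun_int _ t) (aux_charFun_int _ t), e,
    auxSum_integral _ _ _ _ (fun i _ => aux_charFun_int (ρ i) t),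
    auxSum_integral _ _ _ _ (fun i _ => aux_charFun_int (ρ i) t), ← Finset.sum_add_distrib]
  refine Finset.sum_congr rfl fun i _ => ?_
  rw [Complex.real_smul, Complex.real_smul, ← add_mul]
  congr 1
  norm_cast
  rcases le_total (c i) 0 with hc | hc
  · rw [max_eq_left (by linarith), max_eq_right hc]; ring
  · rw [max_eq_right (by linarith), max_eq_left hc]; ring

lemma aux_signed_integral {ι : Type*} (J : Finset ι) (c : ι → ℝ) (ρ : ι → Measure ℝ) (σ : Measure ℝ)
    (hρ : ∀ i, IsFiniteMeasure (ρ i)) [IsFiniteMeasure σ]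
    (h : ∀ t : ℝ, t ≠ 0 → charFun σ t = ∑ i ∈ J, (c i : ℂ) * charFun (ρ i) t)
    (f : ℝ → ℝ) (hf : ∀ i ∈ J, Integrable f (ρ i)) (hσ : Integrable f σ) :
    ∫ x, f x ∂σ = ∑ i ∈ J, c i * ∫ x, f x ∂(ρ i) := by
  have e := aux_signed J c ρ σ hρ h
  have e2 := congrArg (fun m => ∫ x, f x ∂m) e
  rw [integral_add_measure hσ (auxSum_integrable _ _ _ _ hf), auxSum_integral _ _ _ _ hf,
    auxSum_integral _ _ _ _ hf] at e2
  rw [eq_sub_of_add_eq e2, ← Finset.sum_sub_distrib]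
  refine Finset.sum_congr rfl fun i _ => ?_
  rw [smul_eq_mul, smul_eq_mul, ← sub_mul]
  congr 1
  rcases le_total (c i) 0 with hc | hc
  · rw [max_eq_left (by linarith : (0:ℝ) ≤ - c i), max_eq_right hc]; ring
  · rw [max_eq_right (by linarith : - c i ≤ 0), max_eq_left hc]; ring

/-- integrals with respect to real-weighted measures -/
lemma aux_wd {Ω E : Type*} [MeasurableSpace Ω] [NormedAddCommGroup E] [NormedSpace ℝ E]
    (P : Measure Ω) (w : Ω → ℝ) (hw : Measurable w)
    (hw0 : ∀ᵐ ω ∂P, 0 ≤ w ω) (f : Ω → E) :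
    (Integrable f (P.withDensity fun ω => ENNReal.ofReal (w ω)) ↔
      Integrable (fun ω => w ω • f ω) P) ∧
    ∫ ω, f ω ∂(P.withDensity fun ω => ENNReal.ofReal (w ω)) = ∫ ω, w ω • f ω ∂P := by
  constructor
  · rw [integrable_withDensity_iff_integrable_smul' (by fun_prop) (by simp)]
    refine integrable_congr ?_
    filter_upwards [hw0] with ω h
    rw [ENNReal.toReal_ofReal h]
  · rw [integral_withDensity_eq_integral_toReal_smul (by fun_prop) (by simp)]
    refine integral_congr_ae ?_
    filter_upwards [hw0] with ω h
    rw [ENNReal.toReal_ofReal h]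

noncomputable def auxT (l : Measure ℝ) : Measure ℝ :=
  ((l.prod volume).restrict {p : ℝ × ℝ | 0 < p.2 ∧ p.2 < p.1}).map Prod.snd

lemma auxT_ms : MeasurableSet {p : ℝ × ℝ | 0 < p.2 ∧ p.2 < p.1} :=
  (measurableSet_lt measurable_const measurable_snd).inter
    (measurableSet_lt measurable_snd measurable_fst)

lemma auxT_density (l : Measure ℝ) [SFinite l] :
    auxT l = volume.withDensity (fun v => if 0 < v then l (Ioi v) else 0) := by
  ext A hA
  unfold auxT
  rw [Measure.map_apply measurable_snd hA, Measure.restrict_apply (measurable_snd hA),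
    Measure.prod_apply_symm ((measurable_snd hA).inter auxT_ms), withDensity_apply _ hA,
    ← lintegral_indicator hA]
  congr 1; funext v
  by_cases hv : v ∈ A
  · rw [indicator_of_mem hv]
    by_cases h0 : 0 < v
    · rw [if_pos h0]; congr 1; ext u; simp [hv, h0]
    · rw [if_neg h0]; convert measure_empty (μ := l); ext u; simp [h0]
  · rw [indicator_of_notMem hv]; convert measure_empty (μ := l); ext u; simp [hv]

lemma auxT_integral {E : Type*} [NormedAddCommGroup E] [NormedSpace ℝ E]
    (l : Measure ℝ) [SFinite l] (h : ℝ → E) (hm : Integrable h (auxT l)) :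
    Integrable (fun u => ∫ v in Ioo 0 u, h v) l ∧
    ∫ v, h v ∂(auxT l) = ∫ u, (∫ v in Ioo 0 u, h v) ∂l := by
  have hm2 : Integrable (fun p : ℝ × ℝ => h p.2)
      ((l.prod volume).restrict {p : ℝ × ℝ | 0 < p.2 ∧ p.2 < p.1}) := by
    exact (integrable_map_measure hm.1 measurable_snd.aemeasurable).1 hm
  have hm3 := (integrable_indicator_iff auxT_ms).2 hm2
  have e : ∀ u : ℝ, ∫ v, ({p : ℝ × ℝ | 0 < p.2 ∧ p.2 < p.1}.indicator (fun p : ℝ × ℝ => h p.2)) (u, v)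
      = ∫ v in Ioo 0 u, h v := by
    intro u
    rw [← integral_indicator measurableSet_Ioo]
    rfl
  constructor
  · have := hm3.integral_prod_left
    simpa only [e] using this
  · unfold auxT
    rw [integral_map measurable_snd.aemeasurable hm.1, ← integral_indicator auxT_ms,
      integral_prod _ hm3]
    simp only [e]

lemma auxT_finite (l : Measure ℝ) [SFinite l] (h : ∫⁻ u, ENNReal.ofReal u ∂l < ⊤) :
    IsFiniteMeasure (auxT l) := by
  constructor
  unfold auxT
  rw [Measure.map_apply measurable_snd MeasurableSet.univ, Measure.restrict_apply (by simp),
    preimage_univ, univ_inter, Measure.prod_apply auxT_ms]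
  refine lt_of_le_of_lt (le_of_eq ?_) h
  congr 1; funext u
  have : (Prod.mk u ⁻¹' {p : ℝ × ℝ | 0 < p.2 ∧ p.2 < p.1}) = Ioo 0 u := rfl
  rw [this, Real.volume_Ioo, sub_zero]

lemma auxT_charFun (l : Measure ℝ) [SFinite l] [IsFiniteMeasure (auxT l)]
    (h0 : ∀ᵐ u ∂l, 0 ≤ u) (t : ℝ) (ht : t ≠ 0) :
    I * t * charFun (auxT l) t = ∫ u : ℝ, (Complex.exp (I * t * u) - 1) ∂l := by
  rw [charFun_apply_real, (auxT_integral l _ (aux_charFun_int (auxT l) t)).2, ← integral_const_mul]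
  refine integral_congr_ae ?_
  filter_upwards [h0] with u hu
  rw [← integral_Ioc_eq_integral_Ioo (μ := volume), ← intervalIntegral.integral_of_le hu]
  have ht' : I * (t:ℂ) ≠ 0 := mul_ne_zero I_ne_zero (by exact_mod_cast ht)
  have := integral_exp_mul_complex (a := 0) (b := u) ht'
  rw [show (fun v : ℝ => Complex.exp (t * v * I)) = fun v : ℝ => Complex.exp (I * t * v) by
    funext v; congr 1; ring, this]
  rw [mul_div_assoc', mul_div_cancel_left₀ _ ht']
  simp


lemma auxD_quad (D : ℝ → ℝ) (hD : ContDiff ℝ 2 D) (h0 : D 0 = 0) (hn : ∀ x, 0 ≤ D x) :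
    ∃ K, ∀ x ∈ Icc (0:ℝ) 1, D x ≤ K * x ^ 2 := by
  obtain ⟨K, hK⟩ := exists_taylor_mean_remainder_bound (f := D) (a := 0) (b := 1) (n := 1)
    zero_le_one (by exact_mod_cast hD.contDiffOn)
  refine ⟨K, fun x hx => ?_⟩
  have h := hK x hx
  have hd : deriv D 0 = 0 := by
    apply IsLocalMin.deriv_eq_zero
    exact Filter.Eventually.of_forall fun x => by simpa [h0] using hn x
  have hdw : derivWithin D (Icc 0 1) 0 = 0 := by
    rw [(hD.differentiable (by simp) 0).derivWithin
      (uniqueDiffOn_Icc zero_lt_one 0 (by simp)), hd]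
  rw [taylorWithinEval_succ, taylor_within_zero_eval] at h
  simp only [zero_add, iteratedDerivWithin_one, hdw, h0, smul_zero, sub_zero] at h
  exact (le_abs_self _).trans (by simpa using h)

lemma auxD_moment {Ω : Type*} [MeasurableSpace Ω] (P : Measure Ω) [IsProbabilityMeasure P]
    (X : Ω → ℝ) (hX : Measurable X) (hX0 : ∀ ω, 0 ≤ X ω) (n : ℕ)
    (hm : Integrable (fun ω => X ω ^ n) P)
    (hF : ContDiff ℝ 2 (fun t : ℝ => ∫ ω, (X ω : ℂ) ^ n * Complex.exp (I * t * X ω) ∂P)) :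
    Integrable (fun ω => X ω ^ (n+2)) P := by
  have hb : ∀ t : ℝ, Integrable (fun ω => X ω ^ n * (1 - Real.cos (t * X ω))) P := by
    intro t
    refine (hm.const_mul 2).mono' (by fun_prop) (Filter.Eventually.of_forall fun ω => ?_)
    have h1 := Real.cos_le_one (t * X ω)
    have h2 := Real.neg_one_le_cos (t * X ω)
    have h3 : 0 ≤ X ω ^ n := pow_nonneg (hX0 ω) n
    rw [Real.norm_eq_abs, abs_of_nonneg (mul_nonneg h3 (by linarith))]
    nlinarith
  have hi : ∀ t : ℝ, Integrable (fun ω => (X ω : ℂ) ^ n * Complex.exp (I * t * X ω)) P := by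
    intro t
    refine hm.norm.mono' (by fun_prop) (Filter.Eventually.of_forall fun ω => ?_)
    rw [norm_mul, aux_norm_exp]; simp
  have hre : ∀ t : ℝ, ∫ ω, X ω ^ n * (1 - Real.cos (t * X ω)) ∂P =
      (∫ ω, X ω ^ n ∂P) - (∫ ω, (X ω : ℂ) ^ n * Complex.exp (I * t * X ω) ∂P).re := by
    intro t
    have h1 : ∫ ω, ((X ω : ℂ) ^ n * Complex.exp (I * t * X ω)).re ∂P
      = (∫ ω, (X ω : ℂ) ^ n * Complex.exp (I * t * X ω) ∂P).re := integral_re (hi t)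
    have h1' : Integrable (fun ω => ((X ω : ℂ) ^ n * Complex.exp (I * t * X ω)).re) P := (hi t).re
    have h2 : ∀ ω, ((X ω : ℂ) ^ n * Complex.exp (I * t * X ω)).re = X ω ^ n * Real.cos (t * X ω) := by
      intro ω
      rw [show I * (t:ℂ) * X ω = ((t * X ω : ℝ) : ℂ) * I by push_cast; ring,
        ← Complex.ofReal_pow, Complex.re_ofReal_mul, Complex.exp_ofReal_mul_I_re]
    rw [← h1, ← integral_sub hm h1']
    congr 1; funext ω
    rw [h2]; ring
  obtain ⟨K, hK⟩ := auxD_quad (fun t => ∫ ω, X ω ^ n * (1 - Real.cos (t * X ω)) ∂P)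
    (by
      simp_rw [hre]
      exact contDiff_const.sub (Complex.reCLM.contDiff.comp hF)) (by simp) (fun t => by
      refine integral_nonneg fun ω => mul_nonneg (pow_nonneg (hX0 ω) n) ?_
      linarith [Real.cos_le_one (t * X ω)])
  have hcov : AECover P Filter.atTop (fun k : ℕ => {ω | X ω ≤ k}) := by
    refine ⟨Filter.Eventually.of_forall fun ω => ?_, fun k => measurableSet_le hX measurable_const⟩
    obtain ⟨N, hN⟩ := exists_nat_ge (X ω)
    filter_upwards [Filter.eventually_ge_atTop N] with k hk
    exact hN.trans (by exact_mod_cast hk)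
  have hfi : ∀ k : ℕ, IntegrableOn (fun ω => X ω ^ (n+2)) {ω | X ω ≤ k} P := by
    intro k
    refine Integrable.mono' (hm.const_mul ((k:ℝ)^2)).integrableOn (by fun_prop) ?_
    refine (ae_restrict_iff' (measurableSet_le hX measurable_const)).2
      (Filter.Eventually.of_forall fun ω hω => ?_)
    have h0 := hX0 ω
    have h1 : X ω ≤ k := hω
    rw [Real.norm_eq_abs, abs_of_nonneg (by positivity), pow_add, mul_comm]
    gcongr
  refine hcov.integrable_of_integral_norm_bounded (Real.pi ^ 2 / 2 * K) hfi ?_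
  filter_upwards [Filter.eventually_ge_atTop 1] with k hk
  have hk' : (1:ℝ) ≤ k := by exact_mod_cast hk
  have hkK := hK (1 / (k:ℝ)) ⟨by positivity, by rw [div_le_one (by linarith)]; exact hk'⟩
  have hpi := Real.pi_pos
  calc ∫ ω in {ω | X ω ≤ k}, ‖X ω ^ (n+2)‖ ∂P
      ≤ ∫ ω in {ω | X ω ≤ k}, (Real.pi ^ 2 / 2 * k ^ 2) *
          (X ω ^ n * (1 - Real.cos ((1 / (k:ℝ)) * X ω))) ∂P := by
        refine setIntegral_mono_on (hfi k).norm ((hb _).const_mul _).integrableOn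
          (measurableSet_le hX measurable_const) fun ω hω => ?_
        have h0 := hX0 ω
        have h1 : X ω ≤ k := hω
        have hy : |1 / (k:ℝ) * X ω| ≤ Real.pi := by
          rw [abs_of_nonneg (by positivity)]
          have : 1 / (k:ℝ) * X ω ≤ 1 := by
            rw [one_div, inv_mul_le_iff₀ (by linarith)]; linarith
          linarith [Real.pi_gt_three]
        have hc := Real.cos_le_one_sub_mul_cos_sq hy
        rw [Real.norm_eq_abs, abs_of_nonneg (by positivity)]
        have hc' : 2 / Real.pi ^ 2 * (1 / (k:ℝ) * X ω) ^ 2 ≤ 1 - Real.cos (1 / (k:ℝ) * X ω) := by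
          linarith
        calc X ω ^ (n+2) = (Real.pi ^ 2 / 2 * k ^ 2) * (X ω ^ n *
              (2 / Real.pi ^ 2 * (1 / (k:ℝ) * X ω) ^ 2)) := by
              have : (k:ℝ) ≠ 0 := by linarith
              field_simp
              ring
          _ ≤ _ := by gcongr
    _ ≤ ∫ ω, (Real.pi ^ 2 / 2 * k ^ 2) * (X ω ^ n * (1 - Real.cos ((1 / (k:ℝ)) * X ω))) ∂P := by
        refine setIntegral_le_integral ((hb _).const_mul _) (Filter.Eventually.of_forall fun ω => ?_)
        have h3 : 0 ≤ X ω ^ n := pow_nonneg (hX0 ω) n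
        have h4 := Real.cos_le_one ((1 / (k:ℝ)) * X ω)
        have : 0 ≤ 1 - Real.cos ((1 / (k:ℝ)) * X ω) := by linarith
        simp only [Pi.zero_apply]
        positivity
    _ = (Real.pi ^ 2 / 2 * k ^ 2) * ∫ ω, (X ω ^ n * (1 - Real.cos ((1 / (k:ℝ)) * X ω))) ∂P :=
        integral_const_mul _ _
    _ ≤ (Real.pi ^ 2 / 2 * k ^ 2) * (K * (1 / (k:ℝ)) ^ 2) := by gcongr
    _ = _ := by
        have : (k:ℝ) ≠ 0 := by linarith
        field_simp

lemma auxD_sfinite (ν : Measure ℝ) (hν0 : ν {0} = 0)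
    (hνfin : ∫⁻ u : ℝ, ENNReal.ofReal (min 1 (u ^ 2)) ∂ν < ⊤) : SFinite ν := by
  have hf : Measurable (fun u : ℝ => ENNReal.ofReal (min 1 (u ^ 2))) := by fun_prop
  have h1 : IsFiniteMeasure (ν.withDensity (fun u : ℝ => ENNReal.ofReal (min 1 (u ^ 2)))) :=
    isFiniteMeasure_withDensity hνfin.ne
  have h2 := withDensity_inv_same (μ := ν) hf (by
    have : ∀ᵐ u ∂ν, u ≠ 0 := by
      rw [ae_iff]; simpa using hν0
    filter_upwards [this] with u hu
    simp only [ne_eq, ENNReal.ofReal_eq_zero, not_le]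
    positivity) (by simp)
  rw [← h2]
  infer_instance

lemma auxD_lam (ν : Measure ℝ) [SFinite ν] (hν : ∀ᵐ u ∂ν, 0 < u) (j : ℕ)
    (hj : Integrable (fun u : ℝ => u ^ (j+1)) ν) :
    IsFiniteMeasure (auxT (ν.withDensity fun u => ENNReal.ofReal (u ^ j))) ∧
    (∀ t : ℝ, t ≠ 0 → I * t * charFun (auxT (ν.withDensity fun u => ENNReal.ofReal (u ^ j))) t
      = ∫ u : ℝ, (u:ℂ) ^ j * (Complex.exp (I * t * u) - 1) ∂ν) ∧
    (∀ v : ℝ, 0 < v → (ν.withDensity fun u => ENNReal.ofReal (u ^ j)) (Ioi v)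
      = ENNReal.ofReal (∫ u in Ioi v, u ^ j ∂ν)) := by
  have hpos : ∀ᵐ u ∂ν, 0 ≤ u ^ j := by
    filter_upwards [hν] with u hu; positivity
  have hfin : IsFiniteMeasure (auxT (ν.withDensity fun u => ENNReal.ofReal (u ^ j))) := by
    apply auxT_finite
    rw [lintegral_withDensity_eq_lintegral_mul _ (by fun_prop) (by fun_prop)]
    have e : ∫⁻ u, ((fun u : ℝ => ENNReal.ofReal (u ^ j)) * fun u => ENNReal.ofReal u) u ∂ν
      = ∫⁻ u, ENNReal.ofReal (u ^ (j+1)) ∂ν := by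
      refine lintegral_congr_ae ?_
      filter_upwards [hpos] with u hu
      simp only [Pi.mul_apply]
      rw [← ENNReal.ofReal_mul hu, pow_succ]
    rw [e]
    refine lt_of_le_of_lt (lintegral_mono fun u => ?_) hj.2
    exact Real.ofReal_le_enorm _
  refine ⟨hfin, fun t ht => ?_, fun v hv => ?_⟩
  · rw [auxT_charFun _ _ t ht]
    · rw [(aux_wd ν (fun u => u ^ j) (by fun_prop) hpos _).2]
      congr 1; funext u; rw [Complex.real_smul]; push_cast; ring
    · refine (withDensity_absolutelyContinuous ν _).ae_le ?_
      filter_upwards [hν] with u hu using hu.le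
  · rw [withDensity_apply _ measurableSet_Ioi, ofReal_integral_eq_lintegral_ofReal]
    · refine Integrable.mono' (hj.const_mul (1/v)).integrableOn (by fun_prop) ?_
      refine (ae_restrict_iff' measurableSet_Ioi).2 (Filter.Eventually.of_forall fun u hu => ?_)
      have hu' : v < u := hu
      have h0 : 0 < u := hv.trans hu'
      rw [Real.norm_eq_abs, abs_of_pos (by positivity), pow_succ, one_div, ← div_eq_inv_mul,
        le_div_iff₀ hv]
      gcongr
    · exact ae_restrict_of_ae hpos

lemma auxE_smooth (μ : ℝ) (ν : Measure ℝ)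
    (h : ∀ j : ℕ, 2 ≤ j → Integrable (fun u : ℝ => u ^ j) ν) :
    ContDiff ℝ ((⊤ : ℕ∞) : WithTop ℕ∞) (auxPsi μ ν 0) := by
  rw [contDiff_infty]
  intro m
  exact aux_chain_smooth _ (fun j x => aux_psi_chain μ ν h j x) m

lemma auxE_C {Ω : Type*} [MeasurableSpace Ω] (P : Measure Ω) [IsProbabilityMeasure P]
    (ν : Measure ℝ) (hνsupp : ν (Iic 0) = 0) (Z : Ω → ℝ) (hZ : Measurable Z) (k : ℕ)
    (C : ℝ) (hC : C = ∫ u in Ioi (0:ℝ), u ^ (k+1) ∂ν) (η : ℝ → ℝ)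
    (hlaw : Measure.map Z P = volume.withDensity
          (fun y => ENNReal.ofReal (if 0 < y then η y / C else 0))) :
    0 < C ∧ Integrable (fun u : ℝ => u ^ (k+1)) ν := by
  have hC0 : C ≠ 0 := by
    intro h0
    have h1 : (Measure.map Z P) univ = 0 := by
      rw [hlaw, h0]; simp
    rw [Measure.map_apply hZ MeasurableSet.univ] at h1
    simp at h1
  have hpos : 0 ≤ C := by
    rw [hC]
    exact setIntegral_nonneg measurableSet_Ioi (fun u hu => pow_nonneg (le_of_lt hu) _)
  refine ⟨lt_of_le_of_ne hpos hC0.symm, ?_⟩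
  have hi : IntegrableOn (fun u : ℝ => u ^ (k+1)) (Ioi 0) ν := by
    by_contra hne
    exact hC0 (hC.trans (integral_undef hne))
  have : ν.restrict (Ioi 0) = ν := by
    rw [Measure.restrict_eq_self_of_ae_mem]
    rw [ae_iff]
    convert hνsupp using 2
    ext x; simp
  rwa [IntegrableOn, this] at hi

lemma auxE_law {Ω : Type*} [MeasurableSpace Ω] (P : Measure Ω) [IsProbabilityMeasure P]
    (ν : Measure ℝ) [SFinite ν] (hν : ∀ᵐ u ∂ν, 0 < u) (Z : Ω → ℝ) (j : ℕ)
    (hj : Integrable (fun u : ℝ => u ^ (j+1)) ν)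
    (C : ℝ) (hC : 0 < C) (η : ℝ → ℝ) (hη : ∀ v : ℝ, 0 < v → η v = ∫ y in Ioi v, y ^ j ∂ν)
    (hlaw : Measure.map Z P = volume.withDensity
          (fun y => ENNReal.ofReal (if 0 < y then η y / C else 0))) (t : ℝ) (ht : t ≠ 0) :
    I * t * (C * charFun (Measure.map Z P) t)
      = ∫ u : ℝ, (u:ℂ) ^ j * (Complex.exp (I * t * u) - 1) ∂ν := by
  obtain ⟨h1, h2, h3⟩ := auxD_lam ν hν j hj
  rw [← h2 t ht]
  congr 1
  have h4 : auxT (ν.withDensity fun u => ENNReal.ofReal (u ^ j))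
      = ENNReal.ofReal C • Measure.map Z P := by
    rw [auxT_density, hlaw, ← withDensity_smul' _ _ ENNReal.ofReal_ne_top]
    congr 1
    funext v
    simp only [Pi.smul_apply, smul_eq_mul]
    split_ifs with hv
    · rw [h3 v hv, ← ENNReal.ofReal_mul hC.le, hη v hv]
      congr 1
      field_simp
    · simp
  rw [h4, charFun_apply_real, charFun_apply_real, integral_smul_measure]
  simp [ENNReal.toReal_ofReal hC.le]

noncomputable def auxRho {Ω : Type*} [MeasurableSpace Ω] (P : Measure Ω) (A B Z : Ω → ℝ) (k : ℕ) :
    Measure ℝ :=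
  (P.withDensity fun ω => ENNReal.ofReal (B ω ^ k)).map (fun ω => A ω + Z ω)

lemma auxE_rho {Ω : Type*} [MeasurableSpace Ω] (P : Measure Ω) [IsProbabilityMeasure P]
    (A B Z : Ω → ℝ) (hA : Measurable A) (hB : Measurable B) (hZ : Measurable Z) (k : ℕ)
    (hB0 : ∀ᵐ ω ∂P, 0 ≤ B ω) (hBk : Integrable (fun ω => B ω ^ k) P)
    (hind : IndepFun (fun ω => (A ω, B ω)) Z P) :
    IsFiniteMeasure (auxRho P A B Z k) ∧
    (∀ t : ℝ, charFun (auxRho P A B Z k) t =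
      (∫ ω, Complex.exp (I * t * A ω) * (B ω : ℂ) ^ k ∂P) * charFun (Measure.map Z P) t) ∧
    (∀ f : ℝ → ℝ, StronglyMeasurable f →
      (Integrable f (auxRho P A B Z k) ↔ Integrable (fun ω => B ω ^ k * f (A ω + Z ω)) P) ∧
      ∫ x, f x ∂(auxRho P A B Z k) = ∫ ω, B ω ^ k * f (A ω + Z ω) ∂P) := by
  have hp : ∀ᵐ ω ∂P, 0 ≤ B ω ^ k := by
    filter_upwards [hB0] with ω h using pow_nonneg h k
  have hBm : Measurable (fun ω => B ω ^ k) := hB.pow_const k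
  have hAZ : Measurable (fun ω => A ω + Z ω) := hA.add hZ
  have hfin : IsFiniteMeasure (P.withDensity fun ω => ENNReal.ofReal (B ω ^ k)) :=
    isFiniteMeasure_withDensity_ofReal hBk.2
  refine ⟨by unfold auxRho; infer_instance, ?_, ?_⟩
  · intro t
    rw [charFun_apply_real, charFun_apply_real, auxRho,
      integral_map hAZ.aemeasurable (by fun_prop), integral_map hZ.aemeasurable (by fun_prop),
      (aux_wd P _ hBm hp _).2]
    have hi2 : IndepFun (fun ω => Complex.exp (I * t * A ω) * (B ω : ℂ) ^ k)
        (fun ω => Complex.exp (t * Z ω * I)) P := by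
      exact hind.comp (φ := fun p : ℝ × ℝ => Complex.exp (I * t * p.1) * (p.2 : ℂ) ^ k)
        (ψ := fun z : ℝ => Complex.exp (t * z * I)) (by fun_prop) (by fun_prop)
    rw [← hi2.integral_fun_mul_eq_mul_integral (by fun_prop) (by fun_prop)]
    congr 1; funext ω
    rw [Complex.real_smul]
    push_cast
    rw [show (t:ℂ) * (A ω + Z ω) * I = I * t * A ω + t * Z ω * I by ring, Complex.exp_add]
    ring
  · intro f hf
    refine ⟨?_, ?_⟩
    · rw [auxRho, integrable_map_measure hf.aestronglyMeasurable hAZ.aemeasurable,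
        (aux_wd P _ hBm hp _).1]
      rfl
    · rw [auxRho, integral_map hAZ.aemeasurable hf.aestronglyMeasurable,
        (aux_wd P _ hBm hp _).2]
      rfl

lemma auxE_mom {Ω : Type*} [MeasurableSpace Ω] (P : Measure Ω) [IsProbabilityMeasure P]
    (X : Ω → ℝ) (hX : Measurable X) (hX0 : ∀ᵐ ω ∂P, 0 ≤ X ω) (n : ℕ)
    (hm : Integrable (fun ω => X ω ^ n) P) (j : ℕ) (hj : j ≤ n) :
    Integrable (fun ω => X ω ^ j) P := by
  refine ((integrable_const (1:ℝ)).add hm).mono' (by fun_prop) ?_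
  filter_upwards [hX0] with ω h
  rw [Real.norm_eq_abs, abs_of_nonneg (pow_nonneg h j)]
  simp only [Pi.add_apply]
  rcases le_total (X ω) 1 with h1 | h1
  · have := pow_le_one₀ (n := j) h h1
    have := pow_nonneg h n
    linarith
  · have := pow_le_pow_right₀ h1 hj
    linarith

lemma auxE_Xn {Ω : Type*} [MeasurableSpace Ω] (P : Measure Ω) [IsProbabilityMeasure P]
    (X : Ω → ℝ) (hX : Measurable X) (hX0 : ∀ ω, 0 ≤ X ω) (n : ℕ)
    (hm : Integrable (fun ω => X ω ^ n) P) (ψ : ℝ → ℂ)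
    (hcf : ∀ t : ℝ, ∫ ω, Complex.exp (I * t * X ω) ∂P = Complex.exp (ψ t)) (t : ℝ) :
    I ^ n * ∫ ω, (X ω : ℂ) ^ n * Complex.exp (I * t * X ω) ∂P
      = iteratedDeriv n (fun z => Complex.exp (ψ z)) t := by
  have h := aux_moment_iter P X hX (fun _ => 1) measurable_const (by simp) n
    (auxE_mom P X hX (Filter.Eventually.of_forall hX0) n hm) n le_rfl t
  simp only [one_mul, hcf] at h
  rw [h, ← integral_const_mul]
  congr 1; funext ω; ring

lemma auxE_mom2 {Ω : Type*} [MeasurableSpace Ω] (P : Measure Ω) [IsProbabilityMeasure P]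
    (X : Ω → ℝ) (hX : Measurable X) (hX0 : ∀ ω, 0 ≤ X ω) (n : ℕ)
    (hm : Integrable (fun ω => X ω ^ n) P) (ψ : ℝ → ℂ)
    (hs : ContDiff ℝ ((⊤ : ℕ∞) : WithTop ℕ∞) ψ)
    (hcf : ∀ t : ℝ, ∫ ω, Complex.exp (I * t * X ω) ∂P = Complex.exp (ψ t)) :
    Integrable (fun ω => X ω ^ (n+2)) P := by
  apply auxD_moment P X hX hX0 n hm
  have : (fun t : ℝ => ∫ ω, (X ω : ℂ) ^ n * Complex.exp (I * t * X ω) ∂P)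
      = fun t => (-I) ^ n * iteratedDeriv n (fun z => Complex.exp (ψ z)) t := by
    funext t
    rw [← auxE_Xn P X hX hX0 n hm ψ hcf t, ← mul_assoc, ← mul_pow]
    simp
  rw [this]
  have h1 : ContDiff ℝ ((⊤ : ℕ∞) : WithTop ℕ∞) (fun z => Complex.exp (ψ z)) := hs.cexp
  have h2 : ContDiff ℝ 2 (iteratedDeriv n (fun z => Complex.exp (ψ z))) := by
    rw [iteratedDeriv_eq_iterate]
    exact (ContDiff.iterate_deriv n h1).of_le
      (WithTop.coe_le_coe.2 (le_top : (2 : ℕ∞) ≤ ⊤))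
  exact contDiff_const.mul h2

lemma auxE_pair {Ω : Type*} [MeasurableSpace Ω] (P : Measure Ω) [IsProbabilityMeasure P]
    (A B : Ω → ℝ) (hA : Measurable A) (hB : Measurable B) (n : ℕ)
    (hmom : ∀ j ≤ n, Integrable (fun ω => B ω ^ j) P) (ψ : ℝ → ℂ) (s : ℝ)
    (hj : ∀ t z : ℝ, ∫ ω, Complex.exp (I * (t * A ω + z * B ω)) ∂P
        = Complex.exp ((1 - (s:ℂ)) * ψ t + (1 - (s:ℂ)) * ψ z + (s:ℂ) * ψ (t + z)))
    (k : ℕ) (hk : k ≤ n) (t : ℝ) :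
    I ^ k * ∫ ω, Complex.exp (I * t * A ω) * (B ω : ℂ) ^ k ∂P
      = iteratedDeriv k (fun z : ℝ => Complex.exp ((ψ t + ψ z) +
          s * (ψ (t + z) - ψ t - ψ z))) 0 := by
  have h := aux_moment_iter P B hB (fun ω => Complex.exp (I * t * A ω)) (by fun_prop)
    (fun ω => (aux_norm_exp _ _).le) n hmom k hk 0
  have h2 : (fun z : ℝ => ∫ ω, Complex.exp (I * t * A ω) * Complex.exp (I * z * B ω) ∂P)
      = (fun z : ℝ => Complex.exp ((ψ t + ψ z) + s * (ψ (t + z) - ψ t - ψ z))) := by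
    funext z
    rw [show (ψ t + ψ z) + s * (ψ (t + z) - ψ t - ψ z)
      = (1 - (s:ℂ)) * ψ t + (1 - (s:ℂ)) * ψ z + (s:ℂ) * ψ (t + z) by ring, ← hj]
    congr 1; funext ω
    rw [← Complex.exp_add]; congr 1; ring
  rw [h2] at h
  rw [h, ← integral_const_mul]
  congr 1; funext ω
  simp; ring

lemma auxE_samelaw {Ω : Type*} [MeasurableSpace Ω] (P : Measure Ω) [IsProbabilityMeasure P]
    (X A B : Ω → ℝ) (hX : Measurable X) (hB : Measurable B) (hX0 : ∀ ω, 0 ≤ X ω)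
    (n : ℕ) (hm : Integrable (fun ω => X ω ^ n) P) (ψ : ℝ → ℂ) (s : ℝ) (h0 : ψ 0 = 0)
    (hcf : ∀ t : ℝ, ∫ ω, Complex.exp (I * t * X ω) ∂P = Complex.exp (ψ t))
    (hj : ∀ t z : ℝ, ∫ ω, Complex.exp (I * (t * A ω + z * B ω)) ∂P
        = Complex.exp ((1 - (s:ℂ)) * ψ t + (1 - (s:ℂ)) * ψ z + (s:ℂ) * ψ (t + z))) :
    (∀ᵐ ω ∂P, 0 ≤ B ω) ∧ ∀ j ≤ n, Integrable (fun ω => B ω ^ j) P := by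
  have hP1 : IsProbabilityMeasure (P.map B) := Measure.isProbabilityMeasure_map hB.aemeasurable
  have hP2 : IsProbabilityMeasure (P.map X) := Measure.isProbabilityMeasure_map hX.aemeasurable
  have hl : P.map B = P.map X := by
    apply Measure.ext_of_charFun
    funext t
    rw [charFun_apply_real, charFun_apply_real, integral_map hB.aemeasurable (by fun_prop),
      integral_map hX.aemeasurable (by fun_prop)]
    have h1 := hj 0 t
    have h2 := hcf t
    have e : (1 - (s:ℂ)) * ψ 0 + (1 - (s:ℂ)) * ψ t + (s:ℂ) * ψ (0 + t) = ψ t := by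
      rw [h0, zero_add]; ring
    rw [e, ← h2] at h1
    convert h1 using 3 with ω ω
    · congr 1; push_cast; ring
    · congr 1; ring
  have hid : IdentDistrib B X P P := ⟨hB.aemeasurable, hX.aemeasurable, hl⟩
  have hB0 : ∀ᵐ ω ∂P, 0 ≤ B ω := by
    have := hid.symm.ae_mem_snd (t := Ici 0) measurableSet_Ici (Filter.Eventually.of_forall hX0)
    simpa using this
  refine ⟨hB0, fun j hj => ?_⟩
  apply auxE_mom P B hB hB0 n _ j hj
  exact ((hid.comp (u := fun x : ℝ => x ^ n) (by fun_prop)).integrable_iff).2 hm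

lemma auxF_integ (l0 : Measure ℝ) [IsProbabilityMeasure l0] (n : ℕ) (hn : 1 ≤ n)
    (l1 : Measure ℝ) [IsFiniteMeasure l1]
    (hl1 : l1 = l0.withDensity (fun u => ENNReal.ofReal (u ^ n)))
    [IsFiniteMeasure (auxT l1)] (m : ℝ) (P : Measure ℝ)
    (hle : auxT l1 ≤ ENNReal.ofReal m • auxT l0 + P)
    (f : ℝ → ℝ) (hf : LocallyIntegrable f volume) (hP : Integrable f P) :
    Integrable f (auxT l1) ∧ Integrable f (auxT l0) := by
  set V : ℝ := max 1 (2 * m) with hV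
  have hV1 : 1 ≤ V := le_max_left _ _
  have hV2 : 2 * m ≤ V := le_max_right _ _
  -- comparison on the tail
  have hcmp : ENNReal.ofReal V • (auxT l0).restrict (Ioi V) ≤ (auxT l1).restrict (Ioi V) := by
    rw [auxT_density, auxT_density, restrict_withDensity measurableSet_Ioi,
      restrict_withDensity measurableSet_Ioi, ← withDensity_smul' _ _ ENNReal.ofReal_ne_top]
    apply withDensity_mono
    filter_upwards [ae_restrict_mem measurableSet_Ioi] with v hv
    have hv' : V < v := hv
    have hv0 : 0 < v := by linarith
    simp only [Pi.smul_apply, smul_eq_mul, hv0, if_true]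
    rw [hl1, withDensity_apply _ measurableSet_Ioi, ← setLIntegral_const]
    refine setLIntegral_mono' measurableSet_Ioi (fun u hu => ENNReal.ofReal_le_ofReal ?_)
    have hu' : v < u := hu
    have h1 : u ^ 1 ≤ u ^ n := pow_le_pow_right₀ (by linarith) hn
    rw [pow_one] at h1
    linarith
  have htail : (auxT l1).restrict (Ioi V) ≤ (2 : ENNReal) • P := by
    refine Measure.le_iff.2 fun A hA => ?_
    rw [Measure.restrict_apply hA, Measure.smul_apply, smul_eq_mul]
    have h1 := Measure.le_iff.1 hle (A ∩ Ioi V) (hA.inter measurableSet_Ioi)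
    have h2 := Measure.le_iff.1 hcmp A hA
    rw [Measure.smul_apply, Measure.restrict_apply hA, Measure.restrict_apply hA] at h2
    simp only [Measure.add_apply, Measure.smul_apply, smul_eq_mul] at h1 h2
    set x := (auxT l1) (A ∩ Ioi V)
    set y := (auxT l0) (A ∩ Ioi V)
    have hx : x ≠ ⊤ := measure_ne_top _ _
    have h3 : 2 * (ENNReal.ofReal m * y) ≤ x := by
      refine le_trans ?_ h2
      rw [← mul_assoc]
      gcongr
      rw [show (2 : ENNReal) = ENNReal.ofReal 2 by simp, ← ENNReal.ofReal_mul (by norm_num)]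
      exact ENNReal.ofReal_le_ofReal hV2
    have h4 : P (A ∩ Ioi V) ≤ P A := measure_mono inter_subset_left
    have h5 : x + x ≤ x + 2 * P A := by
      calc x + x = 2 * x := by ring
        _ ≤ 2 * (ENNReal.ofReal m * y + P (A ∩ Ioi V)) := by gcongr
        _ = 2 * (ENNReal.ofReal m * y) + 2 * P (A ∩ Ioi V) := by ring
        _ ≤ x + 2 * P A := by gcongr
    exact (ENNReal.add_le_add_iff_left hx).1 h5
  have htail1 : IntegrableOn f (Ioi V) (auxT l1) :=
    (hP.smul_measure (by simp)).mono_measure htail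
  have htail0 : IntegrableOn f (Ioi V) (auxT l0) := by
    refine Integrable.mono_measure htail1 (le_trans ?_ hcmp)
    refine Measure.le_iff.2 fun A hA => ?_
    rw [Measure.smul_apply, smul_eq_mul]
    refine le_mul_of_one_le_left (by simp) ?_
    rw [← ENNReal.ofReal_one]
    exact ENNReal.ofReal_le_ofReal hV1
  have hhead : ∀ (l : Measure ℝ) [IsFiniteMeasure l], IntegrableOn f (Iic V) (auxT l) := by
    intro l _
    have h1 : IntegrableOn f (Ioc 0 V) volume :=
      (hf.integrableOn_isCompact isCompact_Icc).mono_set Ioc_subset_Icc_self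
    refine Integrable.mono_measure (h1.smul_measure (measure_ne_top l univ)) ?_
    rw [auxT_density, restrict_withDensity measurableSet_Iic]
    refine Measure.le_iff.2 fun A hA => ?_
    rw [withDensity_apply _ hA, Measure.restrict_restrict hA, Measure.smul_apply,
      Measure.restrict_apply hA, smul_eq_mul, ← setLIntegral_const,
      ← lintegral_indicator (hA.inter measurableSet_Iic),
      ← lintegral_indicator (hA.inter measurableSet_Ioc)]
    refine lintegral_mono fun v => ?_
    by_cases hmem : v ∈ A ∩ Iic V
    · rw [indicator_of_mem hmem]
      by_cases hv : 0 < v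
      · rw [indicator_of_mem (show v ∈ A ∩ Ioc 0 V from ⟨hmem.1, hv, hmem.2⟩), if_pos hv]
        exact measure_mono (subset_univ _)
      · rw [if_neg hv]; exact zero_le
    · rw [indicator_of_notMem hmem]; exact zero_le
  have key : ∀ (l : Measure ℝ) [IsFiniteMeasure l], IntegrableOn f (Ioi V) (auxT l) →
      Integrable f (auxT l) := by
    intro l _ h
    rw [← integrableOn_univ, ← Iic_union_Ioi (a := V)]
    exact (hhead l).union h
  exact ⟨key l1 htail1, key l0 htail0⟩

lemma auxF_cov {Ω : Type*} [MeasurableSpace Ω] (P : Measure Ω) [IsProbabilityMeasure P]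
    (X : Ω → ℝ) (hX : Measurable X) (hX0 : ∀ ω, 0 ≤ X ω) (n : ℕ)
    (hm : Integrable (fun ω => X ω ^ n) P) (l1 : Measure ℝ) [IsFiniteMeasure l1]
    (hl1 : l1 = (P.map X).withDensity (fun u => ENNReal.ofReal (u ^ n)))
    (g f : ℝ → ℝ) (hg : ∀ x : ℝ, g x = g 0 + ∫ t in (0:ℝ)..x, f t)
    (h1 : Integrable f (auxT l1)) (h0 : Integrable f (auxT (P.map X))) :
    (∫ ω, (X ω) ^ n * g (X ω) ∂P) - (∫ ω, (X ω) ^ n ∂P) * (∫ ω, g (X ω) ∂P)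
    = (∫ x, f x ∂(auxT l1)) - (∫ ω, (X ω) ^ n ∂P) * ∫ x, f x ∂(auxT (P.map X)) := by
  have hP2 : IsProbabilityMeasure (P.map X) := Measure.isProbabilityMeasure_map hX.aemeasurable
  obtain ⟨a1, b1⟩ := auxT_integral l1 f h1
  obtain ⟨a0, b0⟩ := auxT_integral (P.map X) f h0
  have hnn : ∀ᵐ u ∂(P.map X), 0 ≤ u ^ n := by
    rw [ae_map_iff hX.aemeasurable (measurableSet_le measurable_const (by fun_prop))]
    exact Filter.Eventually.of_forall fun ω => pow_nonneg (hX0 ω) n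
  have hw := aux_wd (P.map X) (fun u => u ^ n) (by fun_prop) hnn (fun u => ∫ v in Ioo 0 u, f v)
  have b1' := b1
  rw [hl1] at a1
  have a1' := hw.1.1 a1
  rw [b1', b0]
  conv_rhs => rw [hl1]
  rw [hw.2]
  have hgX : ∀ ω, g (X ω) = g 0 + ∫ v in Ioo 0 (X ω), f v := by
    intro ω
    rw [hg, intervalIntegral.integral_of_le (hX0 ω), integral_Ioc_eq_integral_Ioo]
  rw [integral_map hX.aemeasurable a1'.1, integral_map hX.aemeasurable a0.1]
  have a1'' : Integrable (fun ω => X ω ^ n • ∫ v in Ioo 0 (X ω), f v) P :=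
    (integrable_map_measure a1'.1 hX.aemeasurable).1 a1'
  have a0'' : Integrable (fun ω => ∫ v in Ioo 0 (X ω), f v) P :=
    (integrable_map_measure a0.1 hX.aemeasurable).1 a0
  have e1 : ∫ ω, X ω ^ n * g (X ω) ∂P = (∫ ω, X ω ^ n ∂P) * g 0
      + ∫ ω, X ω ^ n • (∫ v in Ioo 0 (X ω), f v) ∂P := by
    rw [← integral_mul_const, ← integral_add (hm.mul_const _) a1'']
    congr 1; funext ω
    rw [hgX, smul_eq_mul]; ring
  have e0 : ∫ ω, g (X ω) ∂P = g 0 + ∫ ω, (∫ v in Ioo 0 (X ω), f v) ∂P := by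
    rw [integral_congr_ae (Filter.Eventually.of_forall hgX),
      integral_add (integrable_const _) a0'']
    simp
  rw [e1, e0]; ring

/-- the function `β` and its derivatives -/
lemma auxG_beta (μ : ℝ) (ν : Measure ℝ)
    (h : ∀ j : ℕ, 2 ≤ j → Integrable (fun u : ℝ => u ^ j) ν) (j : ℕ) (hj : 1 ≤ j) (t : ℝ) :
    iteratedDeriv j (fun z => auxPsi μ ν 0 (t + z) - auxPsi μ ν 0 t - auxPsi μ ν 0 z) 0
      = I ^ j * ∫ u : ℝ, (u:ℂ) ^ j * (Complex.exp (I * t * u) - 1) ∂ν := by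
  have hs := auxE_smooth μ ν h
  have hs' : ContDiff ℝ j (auxPsi μ ν 0) := contDiff_infty.1 hs j
  rw [← aux_psi_diff μ ν h j hj t]
  have h1 : ContDiff ℝ j (fun z => auxPsi μ ν 0 (t + z)) := hs'.comp (contDiff_const.add contDiff_id)
  rw [iteratedDeriv_fun_sub (h1.sub contDiff_const).contDiffAt hs'.contDiffAt,
    iteratedDeriv_fun_sub h1.contDiffAt contDiff_const.contDiffAt,
    iteratedDeriv_const, iteratedDeriv_comp_const_add]
  have : j ≠ 0 := by omega
  simp [this]

lemma auxG_step1 {Ω : Type*} [MeasurableSpace Ω] (P : Measure Ω) [IsProbabilityMeasure P]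
    (ψ : ℝ → ℂ) (hs : ContDiff ℝ ((⊤ : ℕ∞) : WithTop ℕ∞) ψ) (h0 : ψ 0 = 0)
    (n k : ℕ) (hk : k ≤ n)
    (Xs Ys : ℝ → Ω → ℝ)
    (hXsm : ∀ s ∈ Icc (0:ℝ) 1, Measurable (Xs s))
    (hYsm : ∀ s ∈ Icc (0:ℝ) 1, Measurable (Ys s))
    (hYs0 : ∀ s ∈ Icc (0:ℝ) 1, ∀ᵐ ω ∂P, 0 ≤ Ys s ω)
    (hYsi : ∀ s ∈ Icc (0:ℝ) 1, ∀ j ≤ n, Integrable (fun ω => Ys s ω ^ j) P)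
    (hjoint : ∀ s ∈ Icc (0:ℝ) 1, ∀ t z : ℝ,
      ∫ ω, Complex.exp (Complex.I * (t * Xs s ω + z * Ys s ω)) ∂P
        = Complex.exp ((1 - (s:ℂ)) * ψ t + (1 - (s:ℂ)) * ψ z + (s:ℂ) * ψ (t + z)))
    (Z : Ω → ℝ) (hZ : Measurable Z)
    (hind : ∀ s ∈ Icc (0:ℝ) 1, IndepFun (fun ω => (Xs s ω, Ys s ω)) Z P)
    (s : ℝ) (hsm : s ∈ Icc (0:ℝ) 1) (t : ℝ) :
    charFun (auxRho P (Xs s) (Ys s) Z k) t = ∑ i ∈ Finset.range (n+1), (auxLag n i s : ℂ) *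
      charFun (auxRho P (Xs (auxNode i)) (Ys (auxNode i)) Z k) t := by
  have hr : ∀ r ∈ Icc (0:ℝ) 1, I ^ k * charFun (auxRho P (Xs r) (Ys r) Z k) t =
      iteratedDeriv k (fun z : ℝ => Complex.exp ((ψ t + ψ z) +
          r * (ψ (t + z) - ψ t - ψ z))) 0 * charFun (Measure.map Z P) t := by
    intro r hr
    rw [(auxE_rho P (Xs r) (Ys r) Z (hXsm r hr) (hYsm r hr) hZ k (hYs0 r hr) (hYsi r hr k hk)
      (hind r hr)).2.1 t, ← mul_assoc,
      auxE_pair P (Xs r) (Ys r) (hXsm r hr) (hYsm r hr) n (hYsi r hr) ψ r (hjoint r hr) k hk t]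
  have hI : (I : ℂ) ^ k ≠ 0 := pow_ne_zero _ I_ne_zero
  apply mul_left_cancel₀ hI
  have hsc : ContDiff ℝ ((⊤ : ℕ∞) : WithTop ℕ∞) (fun z => ψ (t + z)) :=
    hs.comp (contDiff_const.add contDiff_id)
  rw [hr s hsm, auxB_lag (fun z => ψ t + ψ z) (fun z => ψ (t + z) - ψ t - ψ z)
    (contDiff_const.add hs) ((hsc.sub contDiff_const).sub hs) (by simp [h0]) n k hk s,
    Finset.sum_mul, Finset.mul_sum]
  refine Finset.sum_congr rfl fun i _ => ?_
  rw [mul_left_comm, hr _ (auxNode_mem i)]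
  ring

lemma auxG_step2 {Ω : Type*} [MeasurableSpace Ω] (P : Measure Ω) [IsProbabilityMeasure P]
    (X : Ω → ℝ) (hX : Measurable X) (hX0 : ∀ ω, 0 ≤ X ω)
    (μ : ℝ) (ν : Measure ℝ)
    (hν : ∀ j : ℕ, 2 ≤ j → Integrable (fun u : ℝ => u ^ j) ν)
    (ψ : ℝ → ℂ) (hψ : ψ = auxPsi μ ν 0) (h0 : ψ 0 = 0)
    (hcf : ∀ t : ℝ, ∫ ω, Complex.exp (Complex.I * t * X ω) ∂P = Complex.exp (ψ t))
    (n : ℕ) (hmom : Integrable (fun ω => (X ω) ^ n) P)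
    (C : ℕ → ℝ) (Y : ℕ → Ω → ℝ) (hYm : ∀ k : ℕ, 1 ≤ k → Measurable (Y k))
    (hYc : ∀ j : ℕ, 1 ≤ j → ∀ t : ℝ, t ≠ 0 →
      I * t * (C (j + 1) * charFun (Measure.map (Y j) P) t)
      = ∫ u : ℝ, (u:ℂ) ^ j * (Complex.exp (I * t * u) - 1) ∂ν)
    (Xs Ys : ℝ → Ω → ℝ)
    (hXsm : ∀ s ∈ Icc (0:ℝ) 1, Measurable (Xs s))
    (hYsm : ∀ s ∈ Icc (0:ℝ) 1, Measurable (Ys s))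
    (hYs0 : ∀ s ∈ Icc (0:ℝ) 1, ∀ᵐ ω ∂P, 0 ≤ Ys s ω)
    (hYsi : ∀ s ∈ Icc (0:ℝ) 1, ∀ j ≤ n, Integrable (fun ω => Ys s ω ^ j) P)
    (hjoint : ∀ s ∈ Icc (0:ℝ) 1, ∀ t z : ℝ,
      ∫ ω, Complex.exp (Complex.I * (t * Xs s ω + z * Ys s ω)) ∂P
        = Complex.exp ((1 - (s:ℂ)) * ψ t + (1 - (s:ℂ)) * ψ z + (s:ℂ) * ψ (t + z)))
    (hind : ∀ k : ℕ, 1 ≤ k → ∀ s ∈ Icc (0:ℝ) 1,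
      IndepFun (fun ω => (Xs s ω, Ys s ω)) (Y k) P)
    (l1 : Measure ℝ) [IsFiniteMeasure l1]
    (hl1 : l1 = (P.map X).withDensity (fun u => ENNReal.ofReal (u ^ n)))
    [IsFiniteMeasure (auxT l1)] [IsFiniteMeasure (auxT (P.map X))] (t : ℝ) (ht : t ≠ 0) :
    charFun (auxT l1) t = ((∫ ω, X ω ^ n ∂P : ℝ) : ℂ) * charFun (auxT (P.map X)) t +
      ∑ k ∈ Finset.range n, ∑ i ∈ Finset.range (n+1),
        (((n.choose k : ℝ) * C (n - k + 1) * (∫ s in (0:ℝ)..1, auxLag n i s) : ℝ) : ℂ) *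
        charFun (auxRho P (Xs (auxNode i)) (Ys (auxNode i)) (Y (n-k)) k) t := by
  have hs : ContDiff ℝ ((⊤ : ℕ∞) : WithTop ℕ∞) ψ := by rw [hψ]; exact auxE_smooth μ ν hν
  have hP2 : IsProbabilityMeasure (P.map X) := Measure.isProbabilityMeasure_map hX.aemeasurable
  have hX0' : ∀ᵐ u ∂(P.map X), 0 ≤ u := by
    rw [ae_map_iff hX.aemeasurable measurableSet_Ici]
    exact Filter.Eventually.of_forall hX0
  have hsc : ContDiff ℝ ((⊤ : ℕ∞) : WithTop ℕ∞) (fun z => ψ (t + z)) :=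
    hs.comp (contDiff_const.add contDiff_id)
  have hmain := auxB_main (fun z => ψ t + ψ z) (fun z => ψ (t + z) - ψ t - ψ z)
    (contDiff_const.add hs) ((hsc.sub contDiff_const).sub hs) (by simp [h0]) n
  have hmC : ∀ r : ℝ, Integrable (fun ω => (X ω : ℂ) ^ n * Complex.exp (I * r * X ω)) P := by
    intro r
    refine hmom.norm.mono' (by fun_prop) (Filter.Eventually.of_forall fun ω => ?_)
    rw [norm_mul, aux_norm_exp]; simp
  have hL1 : I * t * charFun (auxT l1) t
      = (∫ ω, (X ω : ℂ) ^ n * Complex.exp (I * t * X ω) ∂P) - ((∫ ω, X ω ^ n ∂P : ℝ) : ℂ) := by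
    have hnn : ∀ᵐ u ∂(P.map X), 0 ≤ u ^ n := by
      filter_upwards [hX0'] with u hu using pow_nonneg hu n
    have hl1' : ∀ᵐ u ∂l1, 0 ≤ u := by
      rw [hl1]
      exact (withDensity_absolutelyContinuous _ _).ae_le hX0'
    rw [auxT_charFun l1 hl1' t ht, hl1, (aux_wd (P.map X) (fun u => u ^ n) (by fun_prop) hnn _).2,
      integral_map hX.aemeasurable (by fun_prop), ← integral_complex_ofReal]
    have hm0 : Integrable (fun ω => ((X ω ^ n : ℝ) : ℂ)) P := hmom.ofReal
    rw [← integral_sub (hmC t) hm0]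
    congr 1; funext ω
    rw [Complex.real_smul]; push_cast; ring
  have hL0 : I * t * charFun (auxT (P.map X)) t = Complex.exp (ψ t) - 1 := by
    rw [auxT_charFun _ hX0' t ht, integral_map hX.aemeasurable (by fun_prop), ← hcf t,
      integral_sub _ (integrable_const _)]
    · simp
    · refine (integrable_const (1:ℝ)).mono' (by fun_prop) (Filter.Eventually.of_forall fun ω => ?_)
      rw [aux_norm_exp]
  have hA1 : iteratedDeriv n (fun z => Complex.exp ((ψ t + ψ z) + (ψ (t + z) - ψ t - ψ z))) 0
      = I ^ n * ∫ ω, (X ω : ℂ) ^ n * Complex.exp (I * t * X ω) ∂P := by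
    rw [auxE_Xn P X hX hX0 n hmom ψ hcf t]
    have e : (fun z => Complex.exp ((ψ t + ψ z) + (ψ (t + z) - ψ t - ψ z)))
        = fun z => (fun y => Complex.exp (ψ y)) (t + z) := by
      funext z; congr 1; ring
    have e3 := congrFun (iteratedDeriv_comp_const_add (n := n) (f := fun y => Complex.exp (ψ y))
      (s := t)) 0
    rw [e, e3]
    simp
  have hA0 : iteratedDeriv n (fun z => Complex.exp (ψ t + ψ z)) 0
      = I ^ n * (((∫ ω, X ω ^ n ∂P : ℝ) : ℂ) * Complex.exp (ψ t)) := by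
    have e : (fun z => Complex.exp (ψ t + ψ z))
        = fun z => Complex.exp (ψ t) * Complex.exp (ψ z) := by
      funext z; rw [Complex.exp_add]
    have h3 := auxE_Xn P X hX hX0 n hmom ψ hcf 0
    have hsm : ContDiff ℝ n (fun z => Complex.exp (ψ z)) := contDiff_infty.1 hs.cexp n
    rw [e, iteratedDeriv_const_mul_field, ← h3, ← integral_complex_ofReal]
    simp
    ring
  have hr : ∀ k < n, ∀ i, iteratedDeriv (n-k) (fun z => ψ (t + z) - ψ t - ψ z) 0 *
      iteratedDeriv k (fun z : ℝ => Complex.exp ((ψ t + ψ z) +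
          auxNode i * (ψ (t + z) - ψ t - ψ z))) 0 = I ^ n * (I * t * (C (n - k + 1) *
      charFun (auxRho P (Xs (auxNode i)) (Ys (auxNode i)) (Y (n-k)) k) t)) := by
    intro k hk i
    have hr := auxNode_mem i
    rw [(auxE_rho P _ _ _ (hXsm _ hr) (hYsm _ hr) (hYm (n-k) (by omega)) k (hYs0 _ hr)
      (hYsi _ hr k hk.le) (hind (n-k) (by omega) _ hr)).2.1 t,
      ← auxE_pair P _ _ (hXsm _ hr) (hYsm _ hr) n (hYsi _ hr) ψ _ (hjoint _ hr) k hk.le t]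
    have hb := auxG_beta μ ν hν (n-k) (by omega) t
    rw [← hψ, ← hYc (n-k) (by omega) t ht] at hb
    rw [hb, show I ^ n = I ^ (n-k) * I ^ k by rw [← pow_add]; congr 1; omega]
    ring
  have hIt : I ^ n * (I * (t:ℂ)) ≠ 0 := by
    refine mul_ne_zero (pow_ne_zero _ I_ne_zero) (mul_ne_zero I_ne_zero ?_)
    exact_mod_cast ht
  apply mul_left_cancel₀ hIt
  rw [hA1, hA0] at hmain
  have e1 : I ^ n * (I * (t:ℂ)) * charFun (auxT l1) t
      = I ^ n * ((∫ ω, (X ω : ℂ) ^ n * Complex.exp (I * t * X ω) ∂P)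
        - ((∫ ω, X ω ^ n ∂P : ℝ) : ℂ)) := by
    rw [← hL1]; ring
  have e0 : I ^ n * (I * (t:ℂ)) * (((∫ ω, X ω ^ n ∂P : ℝ) : ℂ) * charFun (auxT (P.map X)) t)
      = I ^ n * (((∫ ω, X ω ^ n ∂P : ℝ) : ℂ) * (Complex.exp (ψ t) - 1)) := by
    rw [← hL0]; ring
  have e2 : I ^ n * (I * (t:ℂ)) * (∑ k ∈ Finset.range n, ∑ i ∈ Finset.range (n+1),
        (((n.choose k : ℝ) * C (n - k + 1) * (∫ s in (0:ℝ)..1, auxLag n i s) : ℝ) : ℂ) *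
        charFun (auxRho P (Xs (auxNode i)) (Ys (auxNode i)) (Y (n-k)) k) t)
      = I ^ n * (∫ ω, (X ω : ℂ) ^ n * Complex.exp (I * t * X ω) ∂P)
        - I ^ n * (((∫ ω, X ω ^ n ∂P : ℝ) : ℂ) * Complex.exp (ψ t)) := by
    rw [hmain, Finset.mul_sum]
    refine Finset.sum_congr rfl fun k hk => ?_
    rw [Finset.mul_sum, Finset.mul_sum]
    refine Finset.sum_congr rfl fun i _ => ?_
    have := hr k (Finset.mem_range.1 hk) i
    calc _ = (n.choose k : ℂ) * ((∫ s in (0:ℝ)..1, auxLag n i s : ℝ) : ℂ) *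
        (I ^ n * (I * t * (C (n - k + 1) *
      charFun (auxRho P (Xs (auxNode i)) (Ys (auxNode i)) (Y (n-k)) k) t))) := by
          push_cast; ring
      _ = _ := by rw [← this]; ring
  rw [mul_add, e1, e0, e2]
  ring

lemma auxH_main {Ω : Type*} [MeasurableSpace Ω] (P : Measure Ω) [IsProbabilityMeasure P]
    (X : Ω → ℝ) (hX : Measurable X) (hX0 : ∀ ω, 0 ≤ X ω)
    (μ : ℝ) (ν : Measure ℝ)
    (hν : ∀ j : ℕ, 2 ≤ j → Integrable (fun u : ℝ => u ^ j) ν)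
    (ψ : ℝ → ℂ) (hψ : ψ = auxPsi μ ν 0) (h0 : ψ 0 = 0)
    (hcf : ∀ t : ℝ, ∫ ω, Complex.exp (Complex.I * t * X ω) ∂P = Complex.exp (ψ t))
    (n : ℕ) (hn : 1 ≤ n) (hmom : Integrable (fun ω => (X ω) ^ n) P)
    (C : ℕ → ℝ) (Y : ℕ → Ω → ℝ) (hYm : ∀ k : ℕ, 1 ≤ k → Measurable (Y k))
    (hYc : ∀ j : ℕ, 1 ≤ j → ∀ t : ℝ, t ≠ 0 →
      I * t * (C (j + 1) * charFun (Measure.map (Y j) P) t)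
      = ∫ u : ℝ, (u:ℂ) ^ j * (Complex.exp (I * t * u) - 1) ∂ν)
    (Xs Ys : ℝ → Ω → ℝ)
    (hXsm : ∀ s ∈ Icc (0:ℝ) 1, Measurable (Xs s))
    (hYsm : ∀ s ∈ Icc (0:ℝ) 1, Measurable (Ys s))
    (hjoint : ∀ s ∈ Icc (0:ℝ) 1, ∀ t z : ℝ,
      ∫ ω, Complex.exp (Complex.I * (t * Xs s ω + z * Ys s ω)) ∂P
        = Complex.exp ((1 - (s:ℂ)) * ψ t + (1 - (s:ℂ)) * ψ z + (s:ℂ) * ψ (t + z)))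
    (hind : ∀ k : ℕ, 1 ≤ k → ∀ s ∈ Icc (0:ℝ) 1,
      IndepFun (fun ω => (Xs s ω, Ys s ω)) (Y k) P)
    (g f : ℝ → ℝ) (hfm : StronglyMeasurable f)
    (hf : LocallyIntegrable f volume)
    (hg : ∀ x : ℝ, g x = g 0 + ∫ t in (0:ℝ)..x, f t)
    (hint : ∀ s ∈ Icc (0:ℝ) 1, ∀ k < n,
      Integrable (fun ω => (Ys s ω) ^ k * f (Xs s ω + Y (n - k) ω)) P) :
    (∫ ω, (X ω) ^ n * g (X ω) ∂P)
      - (∫ ω, (X ω) ^ n ∂P) * (∫ ω, g (X ω) ∂P)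
    = ∑ k ∈ Finset.range n, (n.choose k : ℝ) * C (n - k + 1) *
        ∫ s in (0:ℝ)..1, ∫ ω, (Ys s ω) ^ k * f (Xs s ω + Y (n - k) ω) ∂P := by
  have hs : ContDiff ℝ ((⊤ : ℕ∞) : WithTop ℕ∞) ψ := by rw [hψ]; exact auxE_smooth μ ν hν
  have hP2 : IsProbabilityMeasure (P.map X) := Measure.isProbabilityMeasure_map hX.aemeasurable
  have hsl := fun s hsm => auxE_samelaw P X (Xs s) (Ys s) hX (hYsm s hsm) hX0 n hmom ψ s h0 hcf
    (hjoint s hsm)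
  have hYs0 : ∀ s ∈ Icc (0:ℝ) 1, ∀ᵐ ω ∂P, 0 ≤ Ys s ω := fun s hsm => (hsl s hsm).1
  have hYsi : ∀ s ∈ Icc (0:ℝ) 1, ∀ j ≤ n, Integrable (fun ω => Ys s ω ^ j) P :=
    fun s hsm => (hsl s hsm).2
  have hmom2 := auxE_mom2 P X hX hX0 n hmom ψ hs hcf
  have hmj := auxE_mom P X hX (Filter.Eventually.of_forall hX0) (n+2) hmom2
  have hX0' : ∀ᵐ u ∂(P.map X), 0 ≤ u := by
    rw [ae_map_iff hX.aemeasurable measurableSet_Ici]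
    exact Filter.Eventually.of_forall hX0
  obtain ⟨l1, hl1⟩ : ∃ l1, l1 = (P.map X).withDensity (fun u => ENNReal.ofReal (u ^ n)) := ⟨_, rfl⟩
  have hfin1 : IsFiniteMeasure l1 := by
    rw [hl1]
    apply isFiniteMeasure_withDensity_ofReal
    have h5 : Integrable (fun u : ℝ => u ^ n) (P.map X) :=
      (integrable_map_measure (f := X) (g := fun u : ℝ => u ^ n)
        (by fun_prop) hX.aemeasurable).2 hmom
    exact h5.2
  have hT0 : IsFiniteMeasure (auxT (P.map X)) := by
    apply auxT_finite
    rw [lintegral_map (by fun_prop) hX]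
    have := (hmj 1 (by omega)).lintegral_lt_top
    simpa using this
  have hT1 : IsFiniteMeasure (auxT l1) := by
    apply auxT_finite
    rw [hl1, lintegral_withDensity_eq_lintegral_mul _ (by fun_prop) (by fun_prop),
      lintegral_map (by fun_prop) hX]
    have := (hmj (n+1) (by omega)).lintegral_lt_top
    refine lt_of_le_of_lt (lintegral_mono fun ω => ?_) this
    simp only [Pi.mul_apply]
    rw [← ENNReal.ofReal_mul (pow_nonneg (hX0 ω) n), ← pow_succ]
  have hcfm := auxG_step2 P X hX hX0 μ ν hν ψ hψ h0 hcf n hmom C Y hYm hYc Xs Ys hXsm hYsm hYs0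
    hYsi hjoint hind l1 hl1
  -- properties of the measures `ρ`
  have hR := fun s hsm k (hk : k < n) => auxE_rho P (Xs s) (Ys s) (Y (n-k)) (hXsm s hsm)
    (hYsm s hsm) (hYm (n-k) (by omega)) k (hYs0 s hsm) (hYsi s hsm k hk.le)
    (hind (n-k) (by omega) s hsm)
  have hRi : ∀ s ∈ Icc (0:ℝ) 1, ∀ k < n, Integrable f (auxRho P (Xs s) (Ys s) (Y (n-k)) k) :=
    fun s hsm k hk => ((hR s hsm k hk).2.2 f hfm).1.2 (hint s hsm k hk)
  -- index the representation
  let c : Option (Fin n × ℕ) → ℝ := fun o => o.elim (∫ ω, X ω ^ n ∂P)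
    (fun p => (n.choose p.1 : ℝ) * C (n - p.1 + 1) * (∫ s in (0:ℝ)..1, auxLag n p.2 s))
  let ρ : Option (Fin n × ℕ) → Measure ℝ := fun o => o.elim (auxT (P.map X))
    (fun p => auxRho P (Xs (auxNode p.2)) (Ys (auxNode p.2)) (Y (n-p.1)) p.1)
  let J0 : Finset (Fin n × ℕ) := Finset.univ ×ˢ Finset.range (n+1)
  have hρ : ∀ i, IsFiniteMeasure (ρ i) := by
    rintro (_ | p)
    · exact hT0
    · exact (hR _ (auxNode_mem p.2) p.1 p.1.2).1
  have hch : ∀ t : ℝ, t ≠ 0 → charFun (auxT l1) t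
      = ∑ i ∈ Finset.insertNone J0, (c i : ℂ) * charFun (ρ i) t := by
    intro t ht
    rw [hcfm t ht, Finset.sum_insertNone, Finset.sum_product, Finset.sum_range]
    rfl
  have hsum := aux_signed (Finset.insertNone J0) c ρ (auxT l1) hρ hch
  have hle : auxT l1 ≤ ENNReal.ofReal (∫ ω, X ω ^ n ∂P) • auxT (P.map X)
      + auxSum J0 (fun p => c (some p)) (fun p => ρ (some p)) := by
    have h1 : auxSum (Finset.insertNone J0) c ρ
        = ENNReal.ofReal (∫ ω, X ω ^ n ∂P) • auxT (P.map X)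
      + auxSum J0 (fun p => c (some p)) (fun p => ρ (some p)) := by
      unfold auxSum
      rw [Finset.sum_insertNone]
      rfl
    rw [← h1, ← hsum]
    exact Measure.le_add_right le_rfl
  have hfP : Integrable f (auxSum J0 (fun p => c (some p)) (fun p => ρ (some p))) :=
    auxSum_integrable _ _ _ _ fun p _ => hRi _ (auxNode_mem p.2) p.1 p.1.2
  obtain ⟨hf1, hf0⟩ := auxF_integ (P.map X) n hn l1 hl1 _ _ hle f hf hfP
  rw [auxF_cov P X hX hX0 n hmom l1 hl1 g f hg hf1 hf0]
  have hI := aux_signed_integral (Finset.insertNone J0) c ρ (auxT l1) hρ hch f (by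
    rintro (_ | p) _
    · exact hf0
    · exact hRi _ (auxNode_mem p.2) p.1 p.1.2) hf1
  rw [Finset.sum_insertNone, Finset.sum_product] at hI
  have hI' : ∫ x, f x ∂(auxT l1) = (∫ ω, X ω ^ n ∂P) * (∫ x, f x ∂(auxT (P.map X)))
      + ∑ k ∈ Finset.range n, ∑ i ∈ Finset.range (n+1),
        ((n.choose k : ℝ) * C (n - k + 1) * (∫ s in (0:ℝ)..1, auxLag n i s)) *
        ∫ x, f x ∂(auxRho P (Xs (auxNode i)) (Ys (auxNode i)) (Y (n-k)) k) := by
    rw [hI, Finset.sum_range]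
    rfl
  rw [hI', add_sub_cancel_left]
  refine Finset.sum_congr rfl fun k hk => ?_
  have hk' := Finset.mem_range.1 hk
  have hsi : ∫ s in (0:ℝ)..1, ∫ ω, (Ys s ω) ^ k * f (Xs s ω + Y (n - k) ω) ∂P
      = ∫ s in (0:ℝ)..1, ∑ i ∈ Finset.range (n+1), auxLag n i s *
        ∫ x, f x ∂(auxRho P (Xs (auxNode i)) (Ys (auxNode i)) (Y (n-k)) k) := by
    refine intervalIntegral.integral_congr fun s hsm => ?_
    rw [uIcc_of_le zero_le_one] at hsm
    change ∫ ω, (Ys s ω) ^ k * f (Xs s ω + Y (n - k) ω) ∂P = _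
    rw [← ((hR s hsm k hk').2.2 f hfm).2]
    have := (hR s hsm k hk').1
    refine aux_signed_integral (Finset.range (n+1)) (fun i => auxLag n i s)
      (fun i => auxRho P (Xs (auxNode i)) (Ys (auxNode i)) (Y (n-k)) k) _
      (fun i => (hR _ (auxNode_mem i) k hk').1) ?_ f
      (fun i _ => hRi _ (auxNode_mem i) k hk') (hRi s hsm k hk')
    intro t _
    exact auxG_step1 P ψ hs h0 n k hk'.le Xs Ys hXsm hYsm hYs0 hYsi hjoint (Y (n-k))
      (hYm _ (by omega)) (hind _ (by omega)) s hsm t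
  have hii : ∀ i ∈ Finset.range (n+1), IntervalIntegrable (fun s => auxLag n i s *
      ∫ x, f x ∂(auxRho P (Xs (auxNode i)) (Ys (auxNode i)) (Y (n-k)) k)) volume 0 1 :=
    fun i _ => ((auxLag_cont n i).mul continuous_const).intervalIntegrable _ _
  rw [hsi, intervalIntegral.integral_finsetSum hii, Finset.mul_sum]
  refine Finset.sum_congr rfl fun i _ => ?_
  rw [intervalIntegral.integral_mul_const]
  ring

lemma auxH_ac {Ω : Type*} [MeasurableSpace Ω] (P : Measure Ω) [IsProbabilityMeasure P]
    (A B Z : Ω → ℝ) (hA : Measurable A) (hZ : Measurable Z)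
    (hind : IndepFun (fun ω => (A ω, B ω)) Z P) (hac : P.map Z ≪ volume)
    (f f' : ℝ → ℝ) (hff : f =ᵐ[volume] f') :
    ∀ᵐ ω ∂P, f (A ω + Z ω) = f' (A ω + Z ω) := by
  have hi : IndepFun A Z P := hind.comp (φ := Prod.fst) (ψ := id) measurable_fst measurable_id
  have h1 : P.map (fun ω => A ω + Z ω) ≪ volume := by
    have h2 : P.map (A + Z) = (P.map A).conv (P.map Z) := by
      exact hi.map_add_eq_map_conv_map hA hZ
    have hP1 : IsProbabilityMeasure (P.map A) := Measure.isProbabilityMeasure_map hA.aemeasurable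
    have hP2 : IsProbabilityMeasure (P.map Z) := Measure.isProbabilityMeasure_map hZ.aemeasurable
    change P.map (A + Z) ≪ volume
    rw [h2]
    exact Measure.conv_absolutelyContinuous hac
  exact ae_of_ae_map (hA.add hZ).aemeasurable (h1.ae_le hff)

/-- **Covariance identity for nonnegative infinitely divisible random variables,
in terms of cumulants.** If `X ~ IDD(μ, 0, ν)` is nonnegative with `E[Xⁿ] < ∞`,
`C_k(X) = ∫_{(0,∞)} uᵏ ν(du)`, `Y_k` has density `η_k(y)/C_{k+1}(X)` on `(0,∞)` and is
independent of everything else, and `(X_s, Y_s)` has the prescribed joint characteristic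
function, then
`Cov(Xⁿ, g(X)) = Σ_{k<n} C(n,k) C_{n-k+1}(X) ∫₀¹ E[Y_sᵏ g'(X_s + Y_{n-k})] ds`. -/
theorem covariance_identity_nonneg_IDD_cumulants
    {Ω : Type*} [MeasureSpace Ω] [IsProbabilityMeasure (ℙ : Measure Ω)]
    (X : Ω → ℝ) (hX : Measurable X) (hXnonneg : ∀ ω, 0 ≤ X ω)
    (μ : ℝ) (ν : Measure ℝ)
    (hν0 : ν {0} = 0)
    (hνfin : ∫⁻ u : ℝ, ENNReal.ofReal (min 1 (u ^ 2)) ∂ν < ⊤)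
    -- ν is supported on (0, ∞)
    (hνsupp : ν (Iic 0) = 0)
    -- the characteristic exponent ψ of X
    (ψ : ℝ → ℂ)
    (hψ : ∀ t : ℝ, ψ t = Complex.I * t * μ
      + ∫ u : ℝ, (Complex.exp (Complex.I * t * u) - 1 - Complex.I * t * u) ∂ν)
    -- X ~ IDD(μ, 0, ν)
    (hcf : ∀ t : ℝ, ∫ ω, Complex.exp (Complex.I * t * X ω) ∂ℙ = Complex.exp (ψ t))
    (n : ℕ) (hn : 1 ≤ n)
    -- E[Xⁿ] < ∞
    (hmom : Integrable (fun ω => (X ω) ^ n) ℙ)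
    -- the cumulants C_k(X) = ∫_{(0,∞)} uᵏ ν(du)
    (C : ℕ → ℝ)
    (hC : ∀ k : ℕ, 2 ≤ k → C k = ∫ u in Ioi (0:ℝ), u ^ k ∂ν)
    -- the functions η_k
    (η : ℕ → ℝ → ℝ)
    (hη : ∀ k : ℕ, ∀ v : ℝ, 0 < v → η k v = ∫ y in Ioi v, y ^ k ∂ν)
    -- the random variables Y_k with density η_k(y)/C_{k+1}(X) on (0,∞)
    (Y : ℕ → Ω → ℝ)
    (hYm : ∀ k : ℕ, 1 ≤ k → Measurable (Y k))
    (hYlaw : ∀ k : ℕ, 1 ≤ k → Measure.map (Y k) ℙ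
      = volume.withDensity
          (fun y => ENNReal.ofReal (if 0 < y then η k y / C (k + 1) else 0)))
    -- the family (X_s, Y_s) with the prescribed joint characteristic function
    (Xs Ys : ℝ → Ω → ℝ)
    (hXsm : ∀ s ∈ Icc (0:ℝ) 1, Measurable (Xs s))
    (hYsm : ∀ s ∈ Icc (0:ℝ) 1, Measurable (Ys s))
    (hjoint : ∀ s ∈ Icc (0:ℝ) 1, ∀ t z : ℝ,
      ∫ ω, Complex.exp (Complex.I * (t * Xs s ω + z * Ys s ω)) ∂ℙ
        = Complex.exp ((1 - (s:ℂ)) * ψ t + (1 - (s:ℂ)) * ψ z + (s:ℂ) * ψ (t + z)))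
    -- each Y_k is independent of the pair (X_s, Y_s)
    (hindep : ∀ k : ℕ, 1 ≤ k → ∀ s ∈ Icc (0:ℝ) 1,
      IndepFun (fun ω => (Xs s ω, Ys s ω)) (Y k) ℙ)
    -- g is absolutely continuous with derivative g'
    (g g' : ℝ → ℝ)
    (hg'loc : LocallyIntegrable g' volume)
    (hg : ∀ x : ℝ, g x = g 0 + ∫ t in (0:ℝ)..x, g' t)
    -- integrability assumptions
    (hint : ∀ s ∈ Icc (0:ℝ) 1, ∀ k < n,
      Integrable (fun ω => (Ys s ω) ^ k * g' (Xs s ω + Y (n - k) ω)) ℙ) :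
    (∫ ω, (X ω) ^ n * g (X ω) ∂ℙ)
      - (∫ ω, (X ω) ^ n ∂ℙ) * (∫ ω, g (X ω) ∂ℙ)
    = ∑ k ∈ Finset.range n, (n.choose k : ℝ) * C (n - k + 1) *
        ∫ s in (0:ℝ)..1, ∫ ω, (Ys s ω) ^ k * g' (Xs s ω + Y (n - k) ω) ∂ℙ := by
  have hνae : ∀ᵐ u ∂ν, 0 < u := by
    rw [ae_iff]
    convert hνsupp using 2
    ext x; simp
  have hsf := auxD_sfinite ν hν0 hνfin
  have hCk : ∀ k : ℕ, 1 ≤ k → 0 < C (k+1) ∧ Integrable (fun u : ℝ => u ^ (k+1)) ν :=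
    fun k hk => auxE_C ℙ ν hνsupp (Y k) (hYm k hk) k (C (k+1)) (hC (k+1) (by omega)) (η k)
      (hYlaw k hk)
  have hνj : ∀ j : ℕ, 2 ≤ j → Integrable (fun u : ℝ => u ^ j) ν := by
    intro j hj
    have := (hCk (j-1) (by omega)).2
    rwa [show j - 1 + 1 = j by omega] at this
  have hψ' : ψ = auxPsi μ ν 0 := by
    funext t; rw [hψ t]; rfl
  have hψ0 : ψ 0 = 0 := by
    rw [hψ 0]; simp
  have hYc : ∀ j : ℕ, 1 ≤ j → ∀ t : ℝ, t ≠ 0 →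
      I * t * (C (j + 1) * charFun (Measure.map (Y j) ℙ) t)
      = ∫ u : ℝ, (u:ℂ) ^ j * (Complex.exp (I * t * u) - 1) ∂ν :=
    fun j hj t ht => auxE_law ℙ ν hνae (Y j) j (hCk j hj).2 (C (j+1)) (hCk j hj).1 (η j) (hη j)
      (hYlaw j hj) t ht
  have haem : AEStronglyMeasurable g' volume := hg'loc.aestronglyMeasurable
  have hff : g' =ᵐ[volume] haem.mk g' := haem.ae_eq_mk
  have hae : ∀ s ∈ Icc (0:ℝ) 1, ∀ k < n,
      ∀ᵐ ω ∂(ℙ : Measure Ω), g' (Xs s ω + Y (n-k) ω) = haem.mk g' (Xs s ω + Y (n-k) ω) := by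
    intro s hs k hk
    refine auxH_ac ℙ (Xs s) (Ys s) (Y (n-k)) (hXsm s hs) (hYm _ (by omega))
      (hindep _ (by omega) s hs) ?_ g' _ hff
    rw [hYlaw (n-k) (by omega)]
    exact withDensity_absolutelyContinuous _ _
  have hmain := auxH_main ℙ X hX hXnonneg μ ν hνj ψ hψ' hψ0 hcf n hn hmom C Y hYm hYc Xs Ys hXsm
    hYsm hjoint hindep g (haem.mk g') haem.stronglyMeasurable_mk
    (hg'loc.congr hff) (by
      intro x
      rw [hg x]
      congr 1
      refine intervalIntegral.integral_congr_ae ?_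
      filter_upwards [hff] with y hy _ using hy)
    (by
      intro s hs k hk
      refine (hint s hs k hk).congr ?_
      filter_upwards [hae s hs k hk] with ω h
      rw [h])
  rw [hmain]
  refine Finset.sum_congr rfl fun k hk => ?_
  congr 1
  refine intervalIntegral.integral_congr fun s hs => ?_
  rw [uIcc_of_le zero_le_one] at hs
  refine integral_congr_ae ?_
  filter_upwards [hae s hs k (Finset.mem_range.1 hk)] with ω h
  rw [h]
end

section
/- Let X ~ IDD(μ, 0, ν) with ∫_ℝ u² ν(du) < ∞, so that Var(X) = ∫_ℝ u² ν(du), and let Y₁ be a random variable, independent of X, with probability density f₁(y) = η₁(y) / ∫_ℝ u² ν(du) on ℝ. Then for every absolutely continuous function g : ℝ → ℝ with E[(g′(X+Y₁))²] < ∞ and E[g(X)²] < ∞, one has the two-sided bound Var(X) · (E[g′(X+Y₁)])² ≤ Var(g(X)) ≤ Var(X) · E[(g′(X+Y₁))²]. -/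
open MeasureTheory ProbabilityTheory Complex Set

/-- kernel -/
noncomputable def zbF (u z : ℝ) : ENNReal := (uIoo 0 u).indicator (fun _ => ENNReal.ofReal |u|) z

/-- The (unnormalised) zero-bias measure of `m`. -/
noncomputable def zbM (m : Measure ℝ) : Measure ℝ :=
  volume.withDensity (fun z => ∫⁻ u, zbF u z ∂m)

lemma zbF_meas : Measurable (Function.uncurry zbF) := by
  have hs : MeasurableSet {p : ℝ × ℝ | p.2 ∈ uIoo 0 p.1} := by
    have : {p : ℝ × ℝ | p.2 ∈ uIoo 0 p.1} = {p | min 0 p.1 < p.2} ∩ {p | p.2 < max 0 p.1} := by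
      ext p; simp [uIoo, Set.mem_Ioo]
    rw [this]
    exact (measurableSet_lt (by fun_prop) (by fun_prop)).inter
      (measurableSet_lt (by fun_prop) (by fun_prop))
  have h2 : Measurable (fun p : ℝ × ℝ => ENNReal.ofReal |p.1|) := by fun_prop
  have := h2.indicator hs
  convert this using 1
  ext p
  simp only [Function.uncurry, zbF, Set.indicator]
  rfl

lemma zbF_meas' : Measurable (fun p : ℝ × ℝ => zbF p.1 p.2) := zbF_meas

lemma zbdens_meas (m : Measure ℝ) [SFinite m] : Measurable (fun z => ∫⁻ u, zbF u z ∂m) :=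
  Measurable.lintegral_prod_left zbF_meas

lemma zb_lintegral (m : Measure ℝ) [SFinite m] (h : ℝ → ENNReal) (hh : Measurable h) :
    ∫⁻ z, h z ∂(zbM m) = ∫⁻ u, ENNReal.ofReal |u| * (∫⁻ z in uIoo 0 u, h z) ∂m := by
  unfold zbM
  rw [lintegral_withDensity_eq_lintegral_mul _ (zbdens_meas m) hh]
  simp only [Pi.mul_apply]
  have hF := zbF_meas'
  have e1 : ∀ z, (∫⁻ u, zbF u z ∂m) * h z = ∫⁻ u, zbF u z * h z ∂m := fun z => by
    rw [lintegral_mul_const]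
    exact hF.comp (measurable_id.prodMk measurable_const)
  simp_rw [e1]
  rw [lintegral_lintegral_swap]
  · refine lintegral_congr fun u => ?_
    have : ∀ z, zbF u z * h z = (uIoo 0 u).indicator (fun z => ENNReal.ofReal |u| * h z) z :=
      fun z => by
        unfold zbF
        by_cases h : z ∈ uIoo 0 u <;> simp [h]
    simp_rw [this]
    rw [lintegral_indicator (by unfold uIoo; exact measurableSet_Ioo), lintegral_const_mul _ hh]
  · apply Measurable.aemeasurable
    exact (hF.comp measurable_swap).mul (hh.comp measurable_fst)

lemma vol_uIoo (u : ℝ) : volume (uIoo 0 u) = ENNReal.ofReal |u| := by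
  rcases le_total 0 u with h | h
  · rw [uIoo_of_le h, abs_of_nonneg h]; simp
  · rw [uIoo_of_ge h, abs_of_nonpos h]; simp

lemma zb_univ (m : Measure ℝ) [SFinite m] : zbM m univ = ∫⁻ u, ENNReal.ofReal (u ^ 2) ∂m := by
  have := zb_lintegral m (fun _ => 1) measurable_const
  simp only [lintegral_const, one_mul, Measure.restrict_apply_univ, vol_uIoo] at this
  rw [this]
  refine lintegral_congr fun u => ?_
  rw [← ENNReal.ofReal_mul (abs_nonneg _), abs_mul_abs_self, sq]

lemma zb_finite (m : Measure ℝ) [SFinite m] (hm : Integrable (fun u : ℝ => u ^ 2) m) :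
    IsFiniteMeasure (zbM m) := by
  constructor
  rw [zb_univ, ← ofReal_integral_eq_lintegral_ofReal hm (ae_of_all _ fun _ => sq_nonneg _)]
  exact ENNReal.ofReal_lt_top

lemma zbF_lt_top (u z : ℝ) : zbF u z < ⊤ := by
  unfold zbF
  by_cases h : z ∈ uIoo 0 u <;> simp [h]

lemma setInt_uIoo {E : Type*} [NormedAddCommGroup E] [NormedSpace ℝ E] (h : ℝ → E) (u : ℝ) :
    |u| • ∫ z in uIoo 0 u, h z = u • ∫ z in (0:ℝ)..u, h z := by
  rcases le_total 0 u with h0 | h0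
  · rw [uIoo_of_le h0, abs_of_nonneg h0, intervalIntegral.integral_of_le h0,
      integral_Ioc_eq_integral_Ioo]
  · rw [uIoo_of_ge h0, abs_of_nonpos h0, intervalIntegral.integral_of_ge h0,
      integral_Ioc_eq_integral_Ioo]; simp

lemma zb_integral {E : Type*} [NormedAddCommGroup E] [NormedSpace ℝ E] [CompleteSpace E]
    (m : Measure ℝ) [SFinite m] (hm : Integrable (fun u : ℝ => u ^ 2) m)
    (h : ℝ → E) (hh : StronglyMeasurable h) (hi : Integrable h (zbM m)) :
    ∫ z, h z ∂(zbM m) = ∫ u, u • (∫ z in (0:ℝ)..u, h z) ∂m := by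
  have hfin := zb_finite m hm
  have hF := zbF_meas'
  have hlt : ∀ᵐ z : ℝ, ∫⁻ u, zbF u z ∂m < ⊤ := by
    apply ae_lt_top (zbdens_meas m)
    have := measure_ne_top (zbM m) univ
    unfold zbM at this
    rwa [withDensity_apply _ MeasurableSet.univ, Measure.restrict_univ] at this
  have e0 : ∫ z, h z ∂(zbM m) = ∫ z, (∫⁻ u, zbF u z ∂m).toReal • h z := by
    unfold zbM
    rw [integral_withDensity_eq_integral_toReal_smul (zbdens_meas m) hlt]
  rw [e0]
  have e1 : ∀ᵐ z : ℝ, (∫⁻ u, zbF u z ∂m).toReal • h z = ∫ u, (zbF u z).toReal • h z ∂m := by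
    filter_upwards [hlt] with z hz
    rw [integral_smul_const, integral_toReal]
    · exact (hF.comp (measurable_id.prodMk measurable_const)).aemeasurable
    · exact ae_of_all _ fun u => zbF_lt_top u z
  rw [integral_congr_ae e1, integral_integral_swap]
  · refine integral_congr_ae (ae_of_all _ fun u => ?_)
    have : ∀ z, (zbF u z).toReal • h z = (uIoo 0 u).indicator (fun z => |u| • h z) z :=
      fun z => by
        unfold zbF
        by_cases h : z ∈ uIoo 0 u <;> simp [h]
    simp_rw [this]
    rw [integral_indicator (by unfold uIoo; exact measurableSet_Ioo), integral_smul, setInt_uIoo]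
  · constructor
    · exact (((hF.comp measurable_swap).ennreal_toReal).stronglyMeasurable.smul
        (hh.comp_measurable measurable_fst)).aestronglyMeasurable
    · have h2 := hi.2
      rw [hasFiniteIntegral_iff_enorm] at h2 ⊢
      have hen : Measurable (fun z => ‖h z‖ₑ) := hh.enorm
      unfold zbM at h2
      rw [lintegral_withDensity_eq_lintegral_mul _ (zbdens_meas m) hen] at h2
      refine lt_of_eq_of_lt ?_ h2
      rw [lintegral_prod _ ?_]
      · refine lintegral_congr fun z => ?_
        simp only [Pi.mul_apply]
        rw [← lintegral_mul_const]
        · refine lintegral_congr fun u => ?_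
          simp only [Function.uncurry, enorm_smul]
          congr 1
          rw [Real.enorm_of_nonneg ENNReal.toReal_nonneg, ENNReal.ofReal_toReal (zbF_lt_top u z).ne]
        · exact hF.comp (measurable_id.prodMk measurable_const)
      · exact (((hF.comp measurable_swap).ennreal_toReal).stronglyMeasurable.smul
          (hh.comp_measurable measurable_fst)).enorm.aemeasurable

lemma zb_charFun (m : Measure ℝ) [SFinite m] (hm : Integrable (fun u : ℝ => u ^ 2) m)
    (t : ℝ) (ht : t ≠ 0) :
    charFun (zbM m) t * (I * t) = ∫ u : ℝ, u * (exp (I * t * u) - 1) ∂m := by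
  have hfin := zb_finite m hm
  have hc : (I * t : ℂ) ≠ 0 := by simp [ht]
  have := zb_integral m hm (fun z : ℝ => exp (I * t * z)) (by
    apply Continuous.stronglyMeasurable; fun_prop) (by
    apply Integrable.of_bound (C := 1) (by
      apply Continuous.aestronglyMeasurable; fun_prop)
    refine ae_of_all _ fun z => ?_
    rw [show I * (t:ℂ) * z = ((t * z : ℝ) : ℂ) * I by push_cast; ring, norm_exp_ofReal_mul_I])
  rw [charFun_apply_real]
  have e : ∀ x : ℝ, exp (t * x * I) = exp (I * t * x) := fun x => by congr 1; ring
  simp_rw [e]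
  rw [this, ← integral_mul_const]
  refine integral_congr_ae (ae_of_all _ fun u => ?_)
  simp only
  rw [integral_exp_mul_complex hc]
  simp only [ofReal_zero, mul_zero, exp_zero, real_smul]
  rw [mul_assoc, div_mul_cancel₀ _ hc]

lemma norm_exp_I_sub_le (x : ℝ) : ‖exp (I * x) - 1 - I * x‖ ≤ 3 * x ^ 2 := by
  have hn : ‖I * (x:ℂ)‖ = |x| := by simp
  rcases le_total |x| 1 with h | h
  · have := norm_exp_sub_one_sub_id_le (x := I * x) (by rw [hn]; exact h)
    rw [hn, sq_abs] at this
    nlinarith [sq_nonneg x]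
  · have h1 : ‖exp (I * (x:ℂ))‖ = 1 := norm_exp_I_mul_ofReal x
    have h2 : ‖exp (I * (x:ℂ)) - 1 - I * x‖ ≤ ‖exp (I * (x:ℂ))‖ + ‖(1:ℂ)‖ + ‖I * (x:ℂ)‖ :=
      (norm_sub_le _ _).trans (by gcongr; exact norm_sub_le _ _)
    rw [h1, hn, norm_one] at h2
    nlinarith [sq_abs x, abs_nonneg x]

/-- cumulant -/
noncomputable def psiF (ν : Measure ℝ) (t : ℝ) : ℂ :=
  ∫ u : ℝ, (exp (I * t * u) - 1 - I * t * u) ∂ν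

lemma psi_integrand_le (t u : ℝ) : ‖exp (I * t * u) - 1 - I * t * u‖ ≤ 3 * t ^ 2 * u ^ 2 := by
  have := norm_exp_I_sub_le (t * u)
  push_cast at this
  rw [mul_assoc I (t:ℂ) u]
  linarith [mul_pow t u 2]

lemma psi_bound (ν : Measure ℝ) (hν : Integrable (fun u : ℝ => u ^ 2) ν) (t : ℝ) :
    ‖psiF ν t‖ ≤ 3 * t ^ 2 * ∫ u : ℝ, u ^ 2 ∂ν := by
  unfold psiF
  rw [← integral_const_mul]
  exact norm_integral_le_of_norm_le (hν.const_mul _) (ae_of_all _ fun u => psi_integrand_le t u)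

lemma psi_deriv (ν : Measure ℝ) (hν : Integrable (fun u : ℝ => u ^ 2) ν) (t : ℝ) :
    HasDerivAt (psiF ν) (I * ∫ u : ℝ, u * (exp (I * t * u) - 1) ∂ν) t := by
  have := (hasDerivAt_integral_of_dominated_loc_of_deriv_le (μ := ν) (𝕜 := ℝ)
    (F := fun (t : ℝ) (u : ℝ) => exp (I * t * u) - 1 - I * t * u)
    (F' := fun (t : ℝ) (u : ℝ) => I * (u * (exp (I * t * u) - 1)))
    (s := Metric.ball t 1) (x₀ := t)
    (bound := fun u => (|t| + 1) * u ^ 2) (Metric.ball_mem_nhds t one_pos)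
    (Filter.Eventually.of_forall fun s => by
      apply Continuous.aestronglyMeasurable; fun_prop)
    ((hν.const_mul (3 * t ^ 2)).mono' (by apply Continuous.aestronglyMeasurable; fun_prop)
      (ae_of_all _ fun u => psi_integrand_le t u))
    (by apply Continuous.aestronglyMeasurable; fun_prop)
    (ae_of_all _ fun u s hs => by
      have h1 : ‖exp (I * s * u) - 1‖ ≤ |s * u| := by
        have := Real.norm_exp_I_mul_ofReal_sub_one_le (x := s * u)
        push_cast at this
        rw [mul_assoc]; exact this
      have h2 : |s| ≤ |t| + 1 := by
        have : |s - t| < 1 := by simpa [Real.dist_eq] using hs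
        have := abs_sub_abs_le_abs_sub s t
        linarith
      rw [norm_mul, norm_mul, norm_I, one_mul, norm_real, Real.norm_eq_abs]
      calc |u| * ‖exp (I * s * u) - 1‖ ≤ |u| * |s * u| := by gcongr
        _ = |s| * u ^ 2 := by rw [abs_mul, ← sq_abs u]; ring
        _ ≤ _ := by gcongr)
    (hν.const_mul _)
    (ae_of_all _ fun u s _ => by
      have h0 : HasDerivAt (fun s : ℝ => I * (s:ℂ) * u) (I * u) s := by
        have := ((ofRealCLM.hasDerivAt (x := s)).const_mul I).mul_const (u:ℂ)
        simpa using this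
      have := (h0.cexp.sub_const 1).sub h0
      refine this.congr_deriv ?_
      ring)).2
  rw [integral_const_mul] at this
  exact this

lemma exp_deriv (m : Measure ℝ) [IsProbabilityMeasure m] (hm : Integrable (fun u : ℝ => u) m)
    (t : ℝ) :
    HasDerivAt (fun t : ℝ => ∫ u : ℝ, exp (I * t * u) ∂m) (I * ∫ u : ℝ, u * exp (I * t * u) ∂m) t := by
  have hn : ∀ s u : ℝ, ‖exp (I * s * u)‖ = 1 := fun s u => by
    have := norm_exp_I_mul_ofReal (s * u)
    push_cast at this
    rw [mul_assoc]; exact this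
  have := (hasDerivAt_integral_of_dominated_loc_of_deriv_le (μ := m) (𝕜 := ℝ)
    (F := fun (t : ℝ) (u : ℝ) => exp (I * t * u))
    (F' := fun (t : ℝ) (u : ℝ) => I * (u * (exp (I * t * u))))
    (s := Metric.ball t 1) (x₀ := t)
    (bound := fun u => |u|) (Metric.ball_mem_nhds t one_pos)
    (Filter.Eventually.of_forall fun s => by
      apply Continuous.aestronglyMeasurable; fun_prop)
    (Integrable.of_bound (C := 1) (by apply Continuous.aestronglyMeasurable; fun_prop)
      (ae_of_all _ fun u => (hn t u).le))
    (by apply Continuous.aestronglyMeasurable; fun_prop)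
    (ae_of_all _ fun u s hs => by
      rw [norm_mul, norm_mul, norm_I, one_mul, norm_real, Real.norm_eq_abs, hn, mul_one])
    hm.abs
    (ae_of_all _ fun u s _ => by
      have h0 : HasDerivAt (fun s : ℝ => I * (s:ℂ) * u) (I * u) s := by
        have := ((ofRealCLM.hasDerivAt (x := s)).const_mul I).mul_const (u:ℂ)
        simpa using this
      have := h0.cexp
      refine this.congr_deriv ?_
      ring)).2
  rw [integral_const_mul] at this
  exact this

lemma second_moment (m ν : Measure ℝ) [IsProbabilityMeasure m]
    (hν : Integrable (fun u : ℝ => u ^ 2) ν)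
    (hcf : ∀ t : ℝ, ∫ u : ℝ, exp (I * t * u) ∂m = exp (psiF ν t)) :
    Integrable (fun u : ℝ => u ^ 2) m := by
  set s := ∫ u : ℝ, u ^ 2 ∂ν with hs
  have hs0 : 0 ≤ s := integral_nonneg fun u => sq_nonneg u
  have hn : ∀ s u : ℝ, ‖exp (I * s * u)‖ = 1 := fun s u => by
    have := norm_exp_I_mul_ofReal (s * u)
    push_cast at this
    rw [mul_assoc]; exact this
  -- bound on the integral of `1 - cos`
  have key : ∀ t : ℝ, 3 * t ^ 2 * s ≤ 1 →
      ∫ u : ℝ, (1 - Real.cos (t * u)) ∂m ≤ 6 * t ^ 2 * s := by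
    intro t ht
    have hb := psi_bound ν hν t
    have h1 : ‖exp (psiF ν t) - 1‖ ≤ 2 * ‖psiF ν t‖ := norm_exp_sub_one_le (hb.trans ht)
    have hexpint : Integrable (fun u : ℝ => exp (I * t * u)) m :=
      Integrable.of_bound (C := 1) (by apply Continuous.aestronglyMeasurable; fun_prop)
        (ae_of_all _ fun u => (hn t u).le)
    have h2 : ∫ u : ℝ, (1 - Real.cos (t * u)) ∂m = (1 - ∫ u : ℝ, exp (I * t * u) ∂m).re := by
      have : (1 - ∫ u : ℝ, exp (I * t * u) ∂m) = ∫ u : ℝ, (1 - exp (I * t * u)) ∂m := by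
        rw [integral_sub (integrable_const _) hexpint]; simp
      rw [this, ← reCLM_apply, ← ContinuousLinearMap.integral_comp_comm reCLM
        (φ := fun u : ℝ => 1 - exp (I * t * u)) ((integrable_const _).sub hexpint)]
      refine integral_congr_ae (ae_of_all _ fun u => ?_)
      simp only [reCLM_apply, sub_re, one_re]
      rw [show I * (t:ℂ) * u = ((t * u : ℝ) : ℂ) * I by push_cast; ring, exp_ofReal_mul_I_re]
    rw [h2, hcf]
    have h3 := (re_le_norm (1 - exp (psiF ν t)))
    rw [norm_sub_rev] at h3
    linarith
  refine (aecover_Icc (μ := m) (l := Filter.atTop) (a := fun n : ℕ => -(n:ℝ))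
    (b := fun n : ℕ => (n : ℝ)) (Filter.tendsto_neg_atTop_atBot.comp tendsto_natCast_atTop_atTop)
    tendsto_natCast_atTop_atTop).integrable_of_integral_norm_bounded (48 * s) ?_ ?_
  · intro n
    exact (Continuous.continuousOn (by fun_prop)).integrableOn_compact isCompact_Icc
  · obtain ⟨N, hN⟩ := exists_nat_gt (3 * s)
    filter_upwards [Filter.eventually_ge_atTop (N + 1)] with n hn1
    have hn' : (N:ℝ) + 1 ≤ n := by exact_mod_cast hn1
    have hN0 : (0:ℝ) ≤ N := Nat.cast_nonneg N
    have hnpos : (0:ℝ) < n := by linarith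
    have hk := key (1 / n) (by
      rw [div_pow, one_pow]
      rw [show 3 * (1 / (n:ℝ) ^ 2) * s = (3 * s) / (n:ℝ) ^ 2 by ring, div_le_one (by positivity)]
      nlinarith)
    have hci : Integrable (fun u : ℝ => (n:ℝ) ^ 2 * 8 * (1 - Real.cos (1 / n * u))) m :=
      Integrable.of_bound (C := (n:ℝ) ^ 2 * 8 * 2) (by apply Continuous.aestronglyMeasurable; fun_prop)
        (ae_of_all _ fun u => by
          have h1 := Real.cos_le_one (1 / n * u)
          have h2 := Real.neg_one_le_cos (1 / n * u)
          rw [Real.norm_of_nonneg (mul_nonneg (by positivity) (by linarith))]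
          gcongr
          linarith)
    calc ∫ x in Icc (-(n:ℝ)) n, ‖x ^ 2‖ ∂m
        ≤ ∫ x in Icc (-(n:ℝ)) n, (n:ℝ) ^ 2 * 8 * (1 - Real.cos (1 / n * x)) ∂m := by
          refine setIntegral_mono_on ?_ hci.integrableOn measurableSet_Icc ?_
          · exact (Continuous.continuousOn (by fun_prop)).integrableOn_compact isCompact_Icc
          · intro x hx
            rw [Real.norm_of_nonneg (sq_nonneg x)]
            have hx1 : |1 / n * x| ≤ 1 := by
              rw [abs_mul, abs_of_pos (by positivity : (0:ℝ) < 1 / n), one_div_mul_eq_div,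
                div_le_one hnpos, abs_le]
              exact hx
            have hc := Real.cos_le_one_sub_mul_cos_sq (x := 1 / n * x)
              (hx1.trans (by linarith [Real.pi_gt_three]))
            have hp : (1:ℝ) / 8 ≤ 2 / Real.pi ^ 2 := by
              rw [div_le_div_iff₀ (by norm_num) (by positivity)]
              nlinarith [Real.pi_pos, Real.pi_le_four]
            have h5 : (1:ℝ) / 8 * (1 / n * x) ^ 2 ≤ 1 - Real.cos (1 / n * x) := by
              nlinarith [mul_le_mul_of_nonneg_right hp (sq_nonneg (1 / n * x))]
            have h6 : x ^ 2 = (n:ℝ) ^ 2 * 8 * ((1:ℝ) / 8 * (1 / n * x) ^ 2) := by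
              field_simp
            rw [h6]
            exact mul_le_mul_of_nonneg_left h5 (by positivity)
      _ ≤ ∫ x, (n:ℝ) ^ 2 * 8 * (1 - Real.cos (1 / n * x)) ∂m := by
          refine setIntegral_le_integral hci (ae_of_all _ fun x => ?_)
          exact mul_nonneg (by positivity) (by linarith [Real.cos_le_one (1 / n * x)])
      _ ≤ 48 * s := by
          rw [integral_const_mul]
          refine (mul_le_mul_of_nonneg_left hk (by positivity)).trans (le_of_eq ?_)
          field_simp
          ring

lemma stein_cf (m ν : Measure ℝ) [IsProbabilityMeasure m] [SFinite ν]
    (hν : Integrable (fun u : ℝ => u ^ 2) ν)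
    (hcf : ∀ t : ℝ, ∫ u : ℝ, exp (I * t * u) ∂m = exp (psiF ν t)) :
    Integrable (fun u : ℝ => u) m ∧ (∫ u : ℝ, u ∂m = 0) ∧
      ∀ t : ℝ, t ≠ 0 → charFun m t * charFun (zbM ν) t = charFun (zbM m) t := by
  have h2 := second_moment m ν hν hcf
  have h1 : Integrable (fun u : ℝ => u) m := by
    refine (h2.add (integrable_const 1)).mono' (by fun_prop) (ae_of_all _ fun u => ?_)
    simp only [Pi.add_apply, Real.norm_eq_abs]
    nlinarith [sq_abs u, abs_nonneg u, sq_nonneg (|u| - 1)]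
  have hd : ∀ t : ℝ, ∫ u : ℝ, u * exp (I * t * u) ∂m
      = exp (psiF ν t) * ∫ u : ℝ, u * (exp (I * t * u) - 1) ∂ν := by
    intro t
    have a := exp_deriv m h1 t
    have b := (psi_deriv ν hν t).cexp
    rw [funext hcf] at a
    have := a.unique b
    have hI : (I : ℂ) ≠ 0 := I_ne_zero
    apply mul_left_cancel₀ hI
    rw [this]; ring
  have h0 : ∫ u : ℝ, u ∂m = 0 := by
    have := hd 0
    simp only [ofReal_zero, mul_zero, zero_mul, exp_zero, mul_one, sub_self, integral_zero] at this
    rw [integral_complex_ofReal] at this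
    exact_mod_cast this
  refine ⟨h1, h0, fun t ht => ?_⟩
  have hc : (I * t : ℂ) ≠ 0 := by simp [ht]
  apply mul_right_cancel₀ hc
  rw [mul_assoc, zb_charFun ν hν t ht, zb_charFun m h2 t ht]
  have e : charFun m t = exp (psiF ν t) := by
    rw [← hcf, charFun_apply_real]
    refine integral_congr_ae (ae_of_all _ fun u => ?_)
    simp only; congr 1; ring
  rw [e, ← hd]
  simp_rw [mul_sub, mul_one]
  rw [integral_sub]
  · rw [integral_complex_ofReal, h0]; simp
  · refine h1.norm.mono' (by apply Continuous.aestronglyMeasurable; fun_prop) (ae_of_all _ fun u => ?_)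
    rw [norm_mul, show I * (t:ℂ) * u = ((t * u : ℝ) : ℂ) * I by push_cast; ring,
      norm_exp_ofReal_mul_I, mul_one, norm_real]
  · exact h1.ofReal

lemma cs_interval (h : ℝ → ℝ) (hh : Measurable h) (u : ℝ) :
    ENNReal.ofReal ((∫ z in (0:ℝ)..u, h z) ^ 2)
      ≤ ENNReal.ofReal |u| * ∫⁻ z in uIoo 0 u, ENNReal.ofReal (h z ^ 2) := by
  have e1 : ∀ x : ℝ, ENNReal.ofReal (x ^ 2) = ‖x‖ₑ ^ 2 := fun x => by
    rw [← Real.enorm_of_nonneg (sq_nonneg x), enorm_pow]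
  have h1 : ‖∫ z in (0:ℝ)..u, h z‖ₑ ≤ ∫⁻ z in uIoo 0 u, ‖h z‖ₑ := by
    rcases le_total 0 u with h0 | h0
    · rw [uIoo_of_le h0, intervalIntegral.integral_of_le h0,
        integral_Ioc_eq_integral_Ioo]
      exact enorm_integral_le_lintegral_enorm _
    · rw [uIoo_of_ge h0, intervalIntegral.integral_of_ge h0,
        integral_Ioc_eq_integral_Ioo, enorm_neg]
      exact enorm_integral_le_lintegral_enorm _
  have hp : (2:ℝ).HolderConjugate 2 := Real.HolderConjugate.two_two
  have h2 := ENNReal.lintegral_mul_le_Lp_mul_Lq (volume.restrict (uIoo 0 u)) hp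
    (f := fun z => ‖h z‖ₑ) (g := fun _ => 1) hh.enorm.aemeasurable aemeasurable_const
  simp only [Pi.mul_apply, mul_one, lintegral_const,
    Measure.restrict_apply_univ, vol_uIoo, ENNReal.rpow_ofNat, one_pow, one_mul] at h2
  rw [e1]
  simp_rw [e1]
  calc _ ≤ ((∫⁻ z in uIoo 0 u, ‖h z‖ₑ ^ 2) ^ (1 / 2 : ℝ) * ENNReal.ofReal |u| ^ (1 / 2 : ℝ)) ^ 2 := by
        gcongr
        exact h1.trans h2
    _ = _ := by
        rw [mul_pow, ← ENNReal.rpow_natCast, ← ENNReal.rpow_natCast, ← ENNReal.rpow_mul,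
          ← ENNReal.rpow_mul]
        norm_num
        rw [mul_comm]

lemma var_bounds (m P : Measure ℝ) [IsProbabilityMeasure m] [IsProbabilityMeasure P]
    (s : ℝ) (hs : 0 < s) (hW : zbM m = ENNReal.ofReal s • P)
    (h1 : Integrable (fun u : ℝ => u) m) (h0 : ∫ u : ℝ, u ∂m = 0)
    (h2 : Integrable (fun u : ℝ => u ^ 2) m)
    (h : ℝ → ℝ) (hh : Measurable h) (hP : Integrable (fun z => h z ^ 2) P)
    (G : ℝ → ℝ) (hGc : Continuous G) (hG : ∀ u, G u = ∫ z in (0:ℝ)..u, h z)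
    (hG2 : Integrable (fun u => G u ^ 2) m) :
    s * (∫ z, h z ∂P) ^ 2 ≤ (∫ u, G u ^ 2 ∂m) - (∫ u, G u ∂m) ^ 2 ∧
    (∫ u, G u ^ 2 ∂m) - (∫ u, G u ∂m) ^ 2 ≤ s * ∫ z, h z ^ 2 ∂P := by
  have hvar : ∫ u : ℝ, u ^ 2 ∂m = s := by
    have := zb_univ m
    rw [hW, ← ofReal_integral_eq_lintegral_ofReal h2 (ae_of_all _ fun _ => sq_nonneg _)] at this
    simp only [Measure.smul_apply, measure_univ, smul_eq_mul, mul_one] at this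
    rw [ENNReal.ofReal_eq_ofReal_iff hs.le (integral_nonneg fun u => sq_nonneg u)] at this
    exact this.symm
  have hG1 : Integrable G m := by
    refine (hG2.add (integrable_const 1)).mono' hGc.aestronglyMeasurable (ae_of_all _ fun u => ?_)
    simp only [Pi.add_apply, Real.norm_eq_abs]
    nlinarith [sq_abs (G u), abs_nonneg (G u), sq_nonneg (|G u| - 1)]
  have hh1 : Integrable h P := by
    refine (hP.add (integrable_const 1)).mono' hh.aestronglyMeasurable (ae_of_all _ fun u => ?_)
    simp only [Pi.add_apply, Real.norm_eq_abs]
    nlinarith [sq_abs (h u), abs_nonneg (h u), sq_nonneg (|h u| - 1)]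
  have huG : Integrable (fun u => u * G u) m := by
    refine (hG2.add h2).mono' (by fun_prop) (ae_of_all _ fun u => ?_)
    simp only [Pi.add_apply, Real.norm_eq_abs, abs_mul]
    nlinarith [sq_abs (G u), sq_abs u, sq_nonneg (|G u| - |u|), mul_nonneg (abs_nonneg u) (abs_nonneg (G u))]
  constructor
  · have hst : s * ∫ z, h z ∂P = ∫ u, u * G u ∂m := by
      have := zb_integral m h2 h hh.stronglyMeasurable (by
        rw [hW]; exact hh1.smul_measure ENNReal.ofReal_ne_top)
      rw [hW, integral_smul_measure, ENNReal.toReal_ofReal hs.le] at this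
      simp_rw [← hG] at this
      simpa only [smul_eq_mul] using this
    set a := ∫ z, h z ∂P
    set c := ∫ u, G u ∂m with hc
    have hnn : 0 ≤ ∫ u, (G u - c - a * u) ^ 2 ∂m := integral_nonneg fun u => sq_nonneg _
    have hexp : ∫ u, (G u - c - a * u) ^ 2 ∂m
        = (∫ u, G u ^ 2 ∂m) + c ^ 2 + a ^ 2 * s - 2 * c * c - 2 * a * (s * a) + 2 * a * c * 0 := by
      have i1 : Integrable (fun _ : ℝ => c ^ 2) m := integrable_const _
      have i2 : Integrable (fun u : ℝ => a ^ 2 * u ^ 2) m := h2.const_mul _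
      have i3 : Integrable (fun u : ℝ => 2 * c * G u) m := hG1.const_mul _
      have i4 : Integrable (fun u : ℝ => 2 * a * (u * G u)) m := huG.const_mul _
      have i5 : Integrable (fun u : ℝ => 2 * a * c * u) m := h1.const_mul _
      have : ∀ u, (G u - c - a * u) ^ 2
        = G u ^ 2 + c ^ 2 + a ^ 2 * u ^ 2 - 2 * c * G u - 2 * a * (u * G u) + 2 * a * c * u :=
        fun u => by ring
      simp_rw [this]
      rw [integral_add, integral_sub, integral_sub, integral_add, integral_add,
        integral_const_mul, integral_const_mul, integral_const_mul, integral_const_mul, hvar, h0,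
        ← hst, ← hc]
      · simp
      · exact hG2
      · exact i1
      · exact hG2.add i1
      · exact i2
      · exact (hG2.add i1).add i2
      · exact i3
      · exact ((hG2.add i1).add i2).sub i3
      · exact i4
      · exact (((hG2.add i1).add i2).sub i3).sub i4
      · exact i5
    nlinarith
  · have : ∫ u, G u ^ 2 ∂m ≤ s * ∫ z, h z ^ 2 ∂P := by
      rw [← ENNReal.ofReal_le_ofReal_iff
        (mul_nonneg hs.le (integral_nonneg fun u => sq_nonneg _)),
        ofReal_integral_eq_lintegral_ofReal hG2 (ae_of_all _ fun _ => sq_nonneg _),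
        ENNReal.ofReal_mul hs.le,
        ofReal_integral_eq_lintegral_ofReal hP (ae_of_all _ fun _ => sq_nonneg _)]
      have hz := zb_lintegral m (fun z => ENNReal.ofReal (h z ^ 2)) (by fun_prop)
      rw [hW, lintegral_smul_measure, smul_eq_mul] at hz
      rw [hz]
      refine lintegral_mono fun u => ?_
      simp only
      rw [hG]
      exact cs_interval h hh u
    linarith [sq_nonneg (∫ u, G u ∂m)]

lemma levy_sfinite (ν : Measure ℝ) (hν0 : ν {0} = 0) (hν : Integrable (fun u : ℝ => u ^ 2) ν) :
    SFinite ν := by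
  have hf : IsFiniteMeasure (ν.withDensity fun u => ENNReal.ofReal (u ^ 2)) :=
    isFiniteMeasure_withDensity_ofReal hν.2
  have hne : ∀ᵐ u ∂ν, u ≠ 0 := by
    rw [ae_iff]; simpa using hν0
  have := withDensity_inv_same (μ := ν) (f := fun u => ENNReal.ofReal (u ^ 2)) (by fun_prop)
    (by
      filter_upwards [hne] with u hu
      have : 0 < u ^ 2 := by positivity
      simpa using hu) (ae_of_all _ fun u => ENNReal.ofReal_ne_top)
  rw [← this]
  infer_instance

lemma zb_levy (ν : Measure ℝ) [SFinite ν] (hν : Integrable (fun u : ℝ => u ^ 2) ν)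
    (η₁ : ℝ → ℝ)
    (hη₁ : ∀ v : ℝ,
      (0 < v → η₁ v = ∫ y in Ioi v, y ∂ν) ∧
      (v < 0 → η₁ v = - ∫ y in Iio v, y ∂ν)) (s : ℝ) (hs : 0 < s) :
    zbM ν = ENNReal.ofReal s • volume.withDensity (fun y => ENNReal.ofReal (η₁ y / s)) := by
  rw [← withDensity_smul' _ _ ENNReal.ofReal_ne_top]
  unfold zbM
  apply withDensity_congr_ae
  have hne : ∀ᵐ y : ℝ, y ≠ 0 := by
    rw [ae_iff]; simp
  filter_upwards [hne] with y hy
  simp only [Pi.smul_apply, smul_eq_mul]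
  rw [← ENNReal.ofReal_mul hs.le, mul_div_cancel₀ _ hs.ne']
  rcases lt_or_gt_of_ne hy with h | h
  · rw [(hη₁ y).2 h, ← integral_neg, ofReal_integral_eq_lintegral_ofReal,
      ← lintegral_indicator measurableSet_Iio]
    · refine lintegral_congr fun u => ?_
      unfold zbF
      by_cases hu : u < y
      · have : y ∈ uIoo 0 u := by
          rw [uIoo_of_ge (by linarith)]; exact ⟨hu, h⟩
        rw [indicator_of_mem this, indicator_of_mem (by exact hu), abs_of_neg (by linarith)]
      · have : y ∉ uIoo 0 u := by
          rintro ⟨h3, h4⟩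
          rcases min_lt_iff.1 h3 with h5 | h5
          · linarith
          · exact hu h5
        rw [indicator_of_notMem this, indicator_of_notMem (by exact hu)]
    · refine (hν.const_mul (1 / |y|)).integrableOn.mono' (by fun_prop) ?_
      filter_upwards [ae_restrict_mem measurableSet_Iio] with u hu
      have hu : u < y := hu
      rw [norm_neg, Real.norm_eq_abs, abs_of_neg (by linarith), abs_of_neg h, one_div_mul_eq_div,
        le_div_iff₀ (by linarith)]
      nlinarith
    · filter_upwards [ae_restrict_mem measurableSet_Iio] with u hu
      have hu : u < y := hu
      simp only [Pi.zero_apply]; linarith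
  · rw [(hη₁ y).1 h, ofReal_integral_eq_lintegral_ofReal,
      ← lintegral_indicator measurableSet_Ioi]
    · refine lintegral_congr fun u => ?_
      unfold zbF
      by_cases hu : y < u
      · have : y ∈ uIoo 0 u := by
          rw [uIoo_of_le (by linarith)]; exact ⟨h, hu⟩
        rw [indicator_of_mem this, indicator_of_mem (by exact hu), abs_of_pos (by linarith)]
      · have : y ∉ uIoo 0 u := by
          rintro ⟨h3, h4⟩
          rcases lt_max_iff.1 h4 with h5 | h5
          · linarith
          · exact hu h5
        rw [indicator_of_notMem this, indicator_of_notMem (by exact hu)]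
    · refine (hν.const_mul (1 / |y|)).integrableOn.mono' (by fun_prop) ?_
      filter_upwards [ae_restrict_mem measurableSet_Ioi] with u hu
      have hu : y < u := hu
      rw [Real.norm_eq_abs, abs_of_pos (by linarith), abs_of_pos h, one_div_mul_eq_div,
        le_div_iff₀ (by linarith)]
      nlinarith
    · filter_upwards [ae_restrict_mem measurableSet_Ioi] with u hu
      have hu : y < u := hu
      simp only [Pi.zero_apply]; linarith

lemma charFun_smul_real (P : Measure ℝ) (s : ℝ) (hs : 0 ≤ s) (t : ℝ) :
    charFun (ENNReal.ofReal s • P) t = s * charFun P t := by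
  rw [charFun_apply_real, charFun_apply_real, integral_smul_measure, ENNReal.toReal_ofReal hs,
    real_smul]

/-- **Cacoullos-type variance bounds for infinitely divisible random variables.**
If `X ~ IDD(μ, 0, ν)` has finite second moment and `Y₁`, independent of `X`, has density
`f₁(y) = η₁(y) / ∫ u² ν(du)`, then
`Var(X) (E[g'(X+Y₁)])² ≤ Var(g(X)) ≤ Var(X) E[(g'(X+Y₁))²]`,
where `Var(X) = ∫ u² ν(du)`. -/
theorem cacoullos_variance_bounds_IDD
    {Ω : Type*} [MeasureSpace Ω] [IsProbabilityMeasure (ℙ : Measure Ω)]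
    (X Y₁ : Ω → ℝ) (hX : Measurable X) (hY₁ : Measurable Y₁)
    (μ : ℝ) (ν : Measure ℝ)
    (hν0 : ν {0} = 0)
    (hνfin : ∫⁻ u : ℝ, ENNReal.ofReal (min 1 (u ^ 2)) ∂ν < ⊤)
    -- X ~ IDD(μ, 0, ν)
    (hcf : ∀ t : ℝ,
      ∫ ω, Complex.exp (Complex.I * t * X ω) ∂ℙ
        = Complex.exp (Complex.I * t * μ
            + ∫ u : ℝ, (Complex.exp (Complex.I * t * u) - 1 - Complex.I * t * u) ∂ν))
    -- finite second moment of ν : ∫ u² ν(du) < ∞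
    (hν2 : Integrable (fun u : ℝ => u ^ 2) ν)
    -- the function η₁
    (η₁ : ℝ → ℝ)
    (hη₁ : ∀ v : ℝ,
      (0 < v → η₁ v = ∫ y in Ioi v, y ∂ν) ∧
      (v < 0 → η₁ v = - ∫ y in Iio v, y ∂ν))
    -- Y₁ is independent of X and has density f₁(y) = η₁(y) / ∫ u² ν(du)
    (hindep : IndepFun X Y₁ ℙ)
    (hY₁law : Measure.map Y₁ ℙ
      = volume.withDensity (fun y => ENNReal.ofReal (η₁ y / ∫ u : ℝ, u ^ 2 ∂ν)))
    -- g is absolutely continuous with derivative g'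
    (g g' : ℝ → ℝ)
    (hg'loc : LocallyIntegrable g' volume)
    (hg : ∀ x : ℝ, g x = g 0 + ∫ t in (0:ℝ)..x, g' t)
    -- integrability assumptions : E[(g'(X+Y₁))²] < ∞ and E[g(X)²] < ∞
    (hint1 : Integrable (fun ω => (g' (X ω + Y₁ ω)) ^ 2) ℙ)
    (hint2 : Integrable (fun ω => (g (X ω)) ^ 2) ℙ) :
    (∫ u : ℝ, u ^ 2 ∂ν) * (∫ ω, g' (X ω + Y₁ ω) ∂ℙ) ^ 2
        ≤ (∫ ω, (g (X ω)) ^ 2 ∂ℙ) - (∫ ω, g (X ω) ∂ℙ) ^ 2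
      ∧ (∫ ω, (g (X ω)) ^ 2 ∂ℙ) - (∫ ω, g (X ω) ∂ℙ) ^ 2
        ≤ (∫ u : ℝ, u ^ 2 ∂ν) * ∫ ω, (g' (X ω + Y₁ ω)) ^ 2 ∂ℙ := by
  have hsf := levy_sfinite ν hν0 hν2
  set s := ∫ u : ℝ, u ^ 2 ∂ν with hsdef
  have hYp : IsProbabilityMeasure (Measure.map Y₁ ℙ) :=
    Measure.isProbabilityMeasure_map hY₁.aemeasurable
  have hs0 : 0 ≤ s := integral_nonneg fun u => sq_nonneg u
  have hs : 0 < s := by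
    rcases hs0.lt_or_eq with h | h
    · exact h
    · exfalso
      rw [← h] at hY₁law
      simp only [div_zero, ENNReal.ofReal_zero] at hY₁law
      have h1 : (Measure.map Y₁ ℙ) univ = 1 := measure_univ
      rw [hY₁law] at h1
      simp at h1
  have hXm : Measurable (fun ω => X ω - μ) := hX.sub_const μ
  set m := Measure.map (fun ω => X ω - μ) ℙ with hm
  have hmp : IsProbabilityMeasure m := Measure.isProbabilityMeasure_map hXm.aemeasurable
  have hSm : Measurable (fun ω => X ω - μ + Y₁ ω) := hXm.add hY₁
  set P := Measure.map (fun ω => X ω - μ + Y₁ ω) ℙ with hPdef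
  have hPp : IsProbabilityMeasure P := Measure.isProbabilityMeasure_map hSm.aemeasurable
  have hcfm : ∀ t : ℝ, ∫ u : ℝ, exp (I * t * u) ∂m = exp (psiF ν t) := by
    intro t
    rw [hm, integral_map hXm.aemeasurable (by apply Continuous.aestronglyMeasurable; fun_prop)]
    have : ∀ ω, exp (I * t * ((X ω - μ : ℝ) : ℂ)) = exp (I * t * X ω) * exp (-(I * t * μ)) :=
      fun ω => by rw [← exp_add]; congr 1; push_cast; ring
    simp_rw [this]
    rw [integral_mul_const, hcf t, ← exp_add]
    congr 1
    unfold psiF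
    ring
  have h2 := second_moment m ν hν2 hcfm
  obtain ⟨h1, h0, hst⟩ := stein_cf m ν hν2 hcfm
  have hzν := zb_levy ν hν2 η₁ hη₁ s hs
  rw [← hY₁law] at hzν
  have hind : IndepFun (fun ω => X ω - μ) Y₁ ℙ :=
    hindep.comp (φ := fun x => x - μ) (ψ := id) (by fun_prop) measurable_id
  have hcfP : ∀ t, charFun P t = charFun m t * charFun (Measure.map Y₁ ℙ) t := fun t => by
    rw [hPdef, hind.charFun_map_fun_add_eq_mul hXm.aemeasurable hY₁.aemeasurable]
    rfl
  have hfin := zb_finite m h2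
  have hfin2 : IsFiniteMeasure (ENNReal.ofReal s • P) :=
    Measure.smul_finite _ ENNReal.ofReal_ne_top
  have hW : zbM m = ENNReal.ofReal s • P := by
    apply Measure.ext_of_charFun
    refine Continuous.ext_on (dense_compl_singleton (0:ℝ)) continuous_charFun continuous_charFun ?_
    intro t ht
    rw [← hst t ht, hzν, charFun_smul_real _ _ hs0, charFun_smul_real _ _ hs0, hcfP]
    ring
  have hPac : P ≪ volume := by
    have h3 : zbM m ≪ volume := withDensity_absolutelyContinuous _ _
    rw [hW] at h3
    intro A hA
    have := h3 hA
    simpa [hs, hs.not_ge] using this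
  -- measurable version of the derivative
  have hgm := hg'loc.aestronglyMeasurable
  set k := hgm.mk g' with hk
  have hkm : Measurable k := hgm.stronglyMeasurable_mk.measurable
  have hkae : g' =ᵐ[volume] k := hgm.ae_eq_mk
  have hkae2 : ∀ᵐ z : ℝ, g' (z + μ) = k (z + μ) :=
    (measurePreserving_add_right volume μ).quasiMeasurePreserving.ae hkae
  have hkae3 : ∀ᵐ ω, g' (X ω + Y₁ ω) = k ((X ω - μ + Y₁ ω) + μ) := by
    have := ae_of_ae_map hSm.aemeasurable (hPac.ae_le hkae2)
    filter_upwards [this] with ω hω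
    rw [← hω]; congr 1; ring
  have hhm : Measurable (fun z => k (z + μ)) := by fun_prop
  have hI1 : ∫ ω, g' (X ω + Y₁ ω) ∂ℙ = ∫ z, k (z + μ) ∂P := by
    rw [hPdef, integral_map hSm.aemeasurable hhm.aestronglyMeasurable]
    exact integral_congr_ae hkae3
  have hsq3 : (fun ω => g' (X ω + Y₁ ω) ^ 2) =ᵐ[ℙ] fun ω => k ((X ω - μ + Y₁ ω) + μ) ^ 2 := by
    filter_upwards [hkae3] with ω hω
    rw [hω]
  have hI2 : ∫ ω, g' (X ω + Y₁ ω) ^ 2 ∂ℙ = ∫ z, k (z + μ) ^ 2 ∂P := by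
    rw [hPdef, integral_map hSm.aemeasurable (hhm.pow_const 2).aestronglyMeasurable]
    exact integral_congr_ae hsq3
  have hI3 : Integrable (fun z => k (z + μ) ^ 2) P := by
    rw [hPdef, integrable_map_measure (hhm.pow_const 2).aestronglyMeasurable hSm.aemeasurable]
    exact hint1.congr hsq3
  have hii : ∀ a b, IntervalIntegrable g' volume a b := fun a b =>
    (hg'loc.integrableOn_isCompact isCompact_uIcc).intervalIntegrable
  have hgc : Continuous g := by
    rw [funext hg]
    exact continuous_const.add (intervalIntegral.continuous_primitive hii 0)
  have hG : ∀ u, g (u + μ) - g μ = ∫ z in (0:ℝ)..u, k (z + μ) := by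
    intro u
    rw [intervalIntegral.integral_comp_add_right (fun z => k z) μ, hg (u + μ), hg μ, zero_add,
      add_sub_add_left_eq_sub, intervalIntegral.integral_interval_sub_left (hii _ _) (hii _ _)]
    exact intervalIntegral.integral_congr_ae (hkae.mono fun z hz _ => hz)
  have hgX1 : Integrable (fun ω => g (X ω)) ℙ := by
    refine (hint2.add (integrable_const 1)).mono'
      (hgc.measurable.comp hX).aestronglyMeasurable (ae_of_all _ fun u => ?_)
    simp only [Pi.add_apply, Real.norm_eq_abs]
    nlinarith [sq_abs (g (X u)), abs_nonneg (g (X u)), sq_nonneg (|g (X u)| - 1)]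
  have hGc : Continuous (fun u => g (u + μ) - g μ) := by fun_prop
  have hGc2 : Continuous (fun u => (g (u + μ) - g μ) ^ 2) := by fun_prop
  have hGX : ∀ ω, g (X ω - μ + μ) - g μ = g (X ω) - g μ := fun ω => by rw [sub_add_cancel]
  have hexp : ∀ ω, (g (X ω) - g μ) ^ 2 = g (X ω) ^ 2 - 2 * g μ * g (X ω) + g μ ^ 2 :=
    fun ω => by ring
  have hG2 : Integrable (fun u => (g (u + μ) - g μ) ^ 2) m := by
    rw [hm, integrable_map_measure hGc2.aestronglyMeasurable hXm.aemeasurable]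
    simp only [Function.comp_def, hGX, hexp]
    exact (hint2.sub (hgX1.const_mul _)).add (integrable_const _)
  have hJ1 : ∫ u, (g (u + μ) - g μ) ∂m = (∫ ω, g (X ω) ∂ℙ) - g μ := by
    rw [hm, integral_map hXm.aemeasurable hGc.aestronglyMeasurable]
    simp only [hGX]
    rw [integral_sub hgX1 (integrable_const _)]
    simp
  have hJ2 : ∫ u, (g (u + μ) - g μ) ^ 2 ∂m
      = (∫ ω, g (X ω) ^ 2 ∂ℙ) - 2 * g μ * (∫ ω, g (X ω) ∂ℙ) + g μ ^ 2 := by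
    rw [hm, integral_map hXm.aemeasurable hGc2.aestronglyMeasurable]
    simp only [hGX, hexp]
    have i1 : Integrable (fun ω => g (X ω) ^ 2 - 2 * g μ * g (X ω)) ℙ :=
      hint2.sub (hgX1.const_mul _)
    rw [integral_add i1 (integrable_const _),
      integral_sub hint2 (hgX1.const_mul _), integral_const_mul]
    simp
  have hfinal := var_bounds m P s hs hW h1 h0 h2 (fun z => k (z + μ)) hhm hI3
    (fun u => g (u + μ) - g μ) hGc hG hG2
  simp only [hJ1, hJ2] at hfinal
  rw [hI1, hI2]
  constructor
  · refine hfinal.1.trans (le_of_eq ?_)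
    ring
  · refine le_trans (le_of_eq ?_) hfinal.2
    ring
end

section
/- Let X have the gamma distribution Ga(a, b) and let Z have the gamma distribution Ga(a+1, b). Then for every absolutely continuous function g : ℝ → ℝ with E[(g′(Z))²] < ∞ and E[g(X)²] < ∞, one has (a/b²) · (E[g′(Z)])² ≤ Var(g(X)) ≤ (a/b²) · E[(g′(Z))²]. -/
open MeasureTheory ProbabilityTheory Set

lemma pdf_succ {a b : ℝ} (ha : 0 < a) (hb : 0 < b) (x : ℝ) :
    x * gammaPDFReal a b x = (a / b) * gammaPDFReal (a + 1) b x := by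
  unfold gammaPDFReal
  rcases lt_trichotomy x 0 with h | h | h
  · simp [not_le.2 h]
  · subst h
    simp [ha.ne']
  · have hG := (Real.Gamma_pos_of_pos ha).ne'
    simp only [h.le, if_true, Real.Gamma_add_one ha.ne', Real.rpow_add hb, Real.rpow_one]
    have : x ^ (a + 1 - 1) = x ^ (a - 1) * x := by
      rw [← Real.rpow_add_one h.ne']; ring_nf
    rw [this]
    field_simp

lemma gm_eq (a b : ℝ) : gammaMeasure a b = volume.withDensity
    (fun x => ENNReal.ofReal (gammaPDFReal a b x)) := rfl

lemma integral_gm {a b : ℝ} (ha : 0 < a) (hb : 0 < b) (f : ℝ → ℝ) :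
    ∫ x, f x ∂(gammaMeasure a b) = ∫ x, gammaPDFReal a b x * f x := by
  rw [gm_eq, integral_withDensity_eq_integral_toReal_smul₀]
  · simp [ENNReal.toReal_ofReal (gammaPDFReal_nonneg ha hb _)]
  · exact (measurable_gammaPDFReal a b).ennreal_ofReal.aemeasurable
  · simp

lemma integrable_gm {a b : ℝ} (ha : 0 < a) (hb : 0 < b) (f : ℝ → ℝ) :
    Integrable f (gammaMeasure a b) ↔ Integrable (fun x => gammaPDFReal a b x * f x) := by
  rw [gm_eq, integrable_withDensity_iff_integrable_smul₀']
  · simp [ENNReal.toReal_ofReal (gammaPDFReal_nonneg ha hb _)]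
  · exact (measurable_gammaPDFReal a b).ennreal_ofReal.aemeasurable
  · simp

lemma integral_mul_gm {a b : ℝ} (ha : 0 < a) (hb : 0 < b) (f : ℝ → ℝ) :
    ∫ x, x * f x ∂(gammaMeasure a b) = (a / b) * ∫ x, f x ∂(gammaMeasure (a + 1) b) := by
  rw [integral_gm ha hb, integral_gm (by linarith) hb, ← integral_const_mul]
  congr 1; ext x
  linear_combination f x * pdf_succ ha hb x

lemma integrable_mul_gm {a b : ℝ} (ha : 0 < a) (hb : 0 < b) (f : ℝ → ℝ)
    (hf : Integrable f (gammaMeasure (a + 1) b)) :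
    Integrable (fun x => x * f x) (gammaMeasure a b) := by
  rw [integrable_gm (by linarith) hb] at hf
  rw [integrable_gm ha hb]
  refine (hf.const_mul (a / b)).congr (Filter.Eventually.of_forall fun x => ?_)
  show _ = _
  linear_combination -f x * pdf_succ ha hb x

lemma int_id {a b : ℝ} (ha : 0 < a) (hb : 0 < b) :
    Integrable (fun x => x) (gammaMeasure a b) := by
  have := isProbabilityMeasure_gammaMeasure (a := a + 1) (by linarith) hb
  simpa using integrable_mul_gm ha hb (fun _ => 1) (integrable_const _)

lemma integral_id_gm {a b : ℝ} (ha : 0 < a) (hb : 0 < b) :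
    ∫ x, x ∂(gammaMeasure a b) = a / b := by
  have := isProbabilityMeasure_gammaMeasure (a := a + 1) (by linarith) hb
  simpa using integral_mul_gm ha hb (fun _ => 1)

lemma int_sq {a b : ℝ} (ha : 0 < a) (hb : 0 < b) :
    Integrable (fun x => x ^ 2) (gammaMeasure a b) := by
  simpa [sq] using integrable_mul_gm ha hb (fun x => x) (int_id (by linarith) hb)

lemma integral_sq_gm {a b : ℝ} (ha : 0 < a) (hb : 0 < b) :
    ∫ x, x ^ 2 ∂(gammaMeasure a b) = a * (a + 1) / b ^ 2 := by
  have := integral_mul_gm ha hb (fun x => x)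
  rw [integral_id_gm (by linarith) hb] at this
  simp only [sq]
  rw [this]
  field_simp

lemma hasDeriv_pdf {a b : ℝ} (ha : 0 < a) (hb : 0 < b) {x : ℝ} (hx : 0 < x) :
    HasDerivAt (fun x => b ^ a / Real.Gamma a * (x ^ a * Real.exp (-(b * x))) / b)
      (gammaPDFReal a b x * (a / b - x)) x := by
  have h1 := (Real.hasDerivAt_rpow_const (x := x) (p := a) (Or.inl hx.ne'))
  have h2 : HasDerivAt (fun x => Real.exp (-(b * x))) (Real.exp (-(b * x)) * (-(b * 1))) x :=
    (((hasDerivAt_id x).const_mul b).neg).exp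
  refine (((h1.mul h2).const_mul (b ^ a / Real.Gamma a)).div_const b).congr_deriv ?_
  unfold gammaPDFReal
  simp only [hx.le, if_true]
  have : x ^ a = x ^ (a - 1) * x := by rw [← Real.rpow_add_one hx.ne']; ring_nf
  rw [this]
  have hG := (Real.Gamma_pos_of_pos ha).ne'
  field_simp
  ring

lemma tail {a b : ℝ} (ha : 0 < a) (hb : 0 < b) {t : ℝ} (ht : 0 < t) :
    ∫ x in Ici t, (x - a / b) ∂(gammaMeasure a b) = a / b ^ 2 * gammaPDFReal (a + 1) b t := by
  have := isProbabilityMeasure_gammaMeasure ha hb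
  have hi : Integrable (fun x => x - a / b) (gammaMeasure a b) :=
    (int_id ha hb).sub (integrable_const _)
  have hi' : Integrable (fun x => gammaPDFReal a b x * (a / b - x)) := by
    rw [integrable_gm ha hb] at hi
    refine hi.neg.congr (Filter.Eventually.of_forall fun x => ?_)
    simp only [Pi.neg_apply]; ring
  have key := integral_Ioi_of_hasDerivAt_of_tendsto' (a := t) (m := 0)
    (f := fun x => b ^ a / Real.Gamma a * (x ^ a * Real.exp (-(b * x))) / b)
    (f' := fun x => gammaPDFReal a b x * (a / b - x))
    (fun x hx => hasDeriv_pdf ha hb (lt_of_lt_of_le ht hx)) hi'.integrableOn (by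
      have := (tendsto_rpow_mul_exp_neg_mul_atTop_nhds_zero a b hb)
      simpa using (this.const_mul (b ^ a / Real.Gamma a)).div_const b)
  rw [← integral_indicator measurableSet_Ici, integral_gm ha hb]
  have e : (fun x => gammaPDFReal a b x * (Ici t).indicator (fun x => x - a / b) x)
      = (Ici t).indicator (fun x => -(gammaPDFReal a b x * (a / b - x))) := by
    ext x
    by_cases hx : x ∈ Ici t
    · simp only [indicator_of_mem hx]; ring
    · simp [indicator_of_notMem hx]
  rw [e, integral_indicator measurableSet_Ici, integral_Ici_eq_integral_Ioi, integral_neg, key]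
  have := pdf_succ ha hb t
  have h2 : a / b ^ 2 * gammaPDFReal (a + 1) b t = (t * gammaPDFReal a b t) / b := by
    rw [this]; field_simp
  rw [h2]
  unfold gammaPDFReal
  simp only [ht.le, if_true]
  have : t ^ a = t ^ (a - 1) * t := by rw [← Real.rpow_add_one ht.ne']; ring_nf
  rw [this]
  ring

lemma kernel_le {a b : ℝ} (ha : 0 < a) (hb : 0 < b) (t : ℝ) :
    ∫⁻ x, {x | t ∈ uIoc (a / b) x}.indicator (fun x => ENNReal.ofReal |x - a / b|) x
      ∂(gammaMeasure a b) ≤ ENNReal.ofReal (a / b ^ 2) * ENNReal.ofReal (gammaPDFReal (a + 1) b t) := by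
  have := isProbabilityMeasure_gammaMeasure ha hb
  have hi : Integrable (fun x => x - a / b) (gammaMeasure a b) :=
    (int_id ha hb).sub (integrable_const _)
  have hm : 0 < a / b := by positivity
  rcases le_or_gt t 0 with h0 | h0
  · refine le_trans (le_of_eq ?_) zero_le
    have hn : gammaMeasure a b (Iio 0) = 0 := by
      have h := lintegral_gammaPDF_of_nonpos (a := a) (r := b) (x := 0) le_rfl
      rw [gammaMeasure, withDensity_apply _ measurableSet_Iio]
      exact h
    rw [lintegral_eq_zero_iff']
    · have : ∀ᵐ x ∂(gammaMeasure a b), x ∉ Iio (0:ℝ) := measure_eq_zero_iff_ae_notMem.1 hn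
      filter_upwards [this] with x hx
      apply indicator_of_notMem
      intro h
      simp only [mem_ofPred_eq, mem_uIoc, mem_Iio] at h hx
      grind
    · apply Measurable.aemeasurable
      apply Measurable.indicator (by fun_prop)
      simp only [mem_uIoc]
      measurability
  rw [← ENNReal.ofReal_mul (by positivity), ← tail ha hb h0]
  rcases lt_or_ge (a / b) t with h | h
  · rw [ofReal_integral_eq_lintegral_ofReal hi.integrableOn, ← lintegral_indicator measurableSet_Ici]
    · apply lintegral_mono
      intro x
      simp only [indicator, mem_ofPred_eq, mem_uIoc, mem_Ici]
      split_ifs with h1 h2 h2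
      · rw [abs_of_nonneg (by linarith)]
      · grind
      · simp
      · simp
    · refine (ae_restrict_iff' measurableSet_Ici).2 (Filter.Eventually.of_forall fun x hx => ?_)
      simp only [mem_Ici, Pi.zero_apply] at *; linarith
  · have hsum : ∫ x in Ici t, (x - a / b) ∂(gammaMeasure a b)
        = ∫ x in Iio t, (a / b - x) ∂(gammaMeasure a b) := by
      have h1 := integral_add_compl (measurableSet_Ici (a := t)) hi
      rw [integral_sub (int_id ha hb) (integrable_const _), integral_id_gm ha hb] at h1
      simp only [integral_const, probReal_univ, smul_eq_mul, one_mul, sub_self, compl_Ici] at h1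
      have h2 : ∫ x in Iio t, (a / b - x) ∂(gammaMeasure a b)
        = - ∫ x in Iio t, (x - a / b) ∂(gammaMeasure a b) := by
        rw [← integral_neg]; simp
      rw [h2]; linarith
    have hi2 : Integrable (fun x => a / b - x) (gammaMeasure a b) :=
      (integrable_const _).sub (int_id ha hb)
    rw [hsum, ofReal_integral_eq_lintegral_ofReal hi2.integrableOn, ← lintegral_indicator measurableSet_Iio]
    · apply lintegral_mono
      intro x
      simp only [indicator, mem_ofPred_eq, mem_uIoc, mem_Iio]
      split_ifs with h1 h2 h2
      · rw [abs_of_nonpos (by linarith)]; simp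
      · grind
      · simp
      · simp
    · refine (ae_restrict_iff' measurableSet_Iio).2 (Filter.Eventually.of_forall fun x hx => ?_)
      simp only [mem_Iio, Pi.zero_apply] at *; linarith

lemma core {a b : ℝ} (ha : 0 < a) (hb : 0 < b) (h : ℝ → ENNReal) (hh : Measurable h) :
    ∫⁻ x, ENNReal.ofReal |x - a / b| * (∫⁻ t in uIoc (a / b) x, h t) ∂(gammaMeasure a b)
      ≤ ENNReal.ofReal (a / b ^ 2) * ∫⁻ t, h t ∂(gammaMeasure (a + 1) b) := by
  have := isProbabilityMeasure_gammaMeasure ha hb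
  have hS : MeasurableSet {p : ℝ × ℝ | p.2 ∈ uIoc (a / b) p.1} := by
    simp only [mem_uIoc]
    measurability
  let F : ℝ × ℝ → ENNReal := {p : ℝ × ℝ | p.2 ∈ uIoc (a / b) p.1}.indicator
    (fun p => ENNReal.ofReal |p.1 - a / b| * h p.2)
  have hF : Measurable F := Measurable.indicator (by fun_prop) hS
  have e1 : ∀ x, ENNReal.ofReal |x - a / b| * (∫⁻ t in uIoc (a / b) x, h t) = ∫⁻ t, F (x, t) := by
    intro x
    rw [← lintegral_const_mul _ hh, ← lintegral_indicator measurableSet_uIoc]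
    rfl
  simp_rw [e1]
  rw [lintegral_lintegral_swap (f := fun x t => F (x, t)) hF.aemeasurable, gm_eq (a + 1),
    lintegral_withDensity_eq_lintegral_mul _ (measurable_gammaPDFReal _ _).ennreal_ofReal hh,
    ← lintegral_const_mul _ (by
      exact (measurable_gammaPDFReal _ _).ennreal_ofReal.mul hh)]
  apply lintegral_mono
  intro t
  have e2 : ∫⁻ x, F (x, t) ∂(gammaMeasure a b) =
      (∫⁻ x, {x | t ∈ uIoc (a / b) x}.indicator (fun x => ENNReal.ofReal |x - a / b|) x
      ∂(gammaMeasure a b)) * h t := by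
    rw [← lintegral_mul_const]
    · congr 1; ext x
      by_cases hx : t ∈ uIoc (a / b) x
      · simp [F, indicator, hx]
      · simp [F, indicator, hx]
    · apply Measurable.indicator (by fun_prop)
      simp only [mem_uIoc]
      measurability
  show ∫⁻ x, F (x, t) ∂(gammaMeasure a b) ≤ _
  rw [e2]
  show _ ≤ ENNReal.ofReal (a / b ^ 2) * (ENNReal.ofReal (gammaPDFReal (a + 1) b t) * h t)
  rw [← mul_assoc]
  gcongr
  exact kernel_le ha hb t

lemma lin3 {μ : Measure ℝ} {f g h : ℝ → ℝ} (hf : Integrable f μ) (hg : Integrable g μ)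
    (hh : Integrable h μ) (c d : ℝ) :
    ∫ x, (f x + c * g x + d * h x) ∂μ = ∫ x, f x ∂μ + c * ∫ x, g x ∂μ + d * ∫ x, h x ∂μ := by
  have h1 : Integrable (fun x => f x + c * g x) μ := hf.add (hg.const_mul c)
  rw [integral_add h1 (hh.const_mul d), integral_add hf (hg.const_mul c), integral_const_mul,
    integral_const_mul]

lemma cs (f : ℝ → ℝ) (hf : Measurable f) (m x : ℝ) :
    ENNReal.ofReal ((∫ t in m..x, f t) ^ 2)
      ≤ ENNReal.ofReal |x - m| * ∫⁻ t in uIoc m x, ENNReal.ofReal (f t ^ 2) := by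
  have h1 : ENNReal.ofReal |∫ t in m..x, f t| ≤ ∫⁻ t in uIoc m x, ‖f t‖ₑ := by
    rw [intervalIntegral.abs_intervalIntegral_eq, ← Real.enorm_eq_ofReal_abs]
    exact enorm_integral_le_lintegral_enorm _
  have h2 := ENNReal.lintegral_mul_le_Lp_mul_Lq (volume.restrict (uIoc m x))
    Real.HolderConjugate.two_two (f := fun t => ‖f t‖ₑ) (g := fun _ => 1)
    hf.enorm.aemeasurable aemeasurable_const
  have h3 : ∀ y : ENNReal, (y ^ (1 / (2:ℝ))) ^ 2 = y := by
    intro y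
    rw [← ENNReal.rpow_natCast, ← ENNReal.rpow_mul]; norm_num
  have h4 : ∀ t, ENNReal.ofReal (f t ^ 2) = ‖f t‖ₑ ^ (2:ℝ) := by
    intro t
    rw [← sq_abs, ENNReal.ofReal_pow (abs_nonneg _), ← Real.enorm_eq_ofReal_abs]
    norm_cast
  rw [← sq_abs, ENNReal.ofReal_pow (abs_nonneg _)]
  simp only [Pi.mul_apply, mul_one] at h2
  refine (pow_le_pow_left' (h1.trans h2) 2).trans (le_of_eq ?_)
  rw [mul_pow, h3, h3, mul_comm]
  simp_rw [h4]
  congr 1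
  simp [uIoc, abs_sub_comm, max_sub_min_eq_abs]

lemma upper {a b : ℝ} (ha : 0 < a) (hb : 0 < b) (g g' : ℝ → ℝ) (hg' : Measurable g')
    (hg : ∀ x, g x - g (a / b) = ∫ t in (a / b)..x, g' t)
    (h1 : MemLp g 2 (gammaMeasure a b)) (h2 : MemLp g' 2 (gammaMeasure (a + 1) b)) :
    ∫ x, g x ^ 2 ∂(gammaMeasure a b) - (∫ x, g x ∂(gammaMeasure a b)) ^ 2
      ≤ a / b ^ 2 * ∫ x, g' x ^ 2 ∂(gammaMeasure (a + 1) b) := by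
  have := isProbabilityMeasure_gammaMeasure ha hb
  have i1 := h1.integrable_sq
  have i2 := h1.integrable one_le_two
  have i3 : Integrable (fun x => (g x - g (a / b)) ^ 2) (gammaMeasure a b) :=
    (h1.sub (memLp_const (g (a / b)))).integrable_sq
  have i4 := h2.integrable_sq
  have A : ∫ x, (g x - g (a / b)) ^ 2 ∂(gammaMeasure a b)
      ≤ a / b ^ 2 * ∫ x, g' x ^ 2 ∂(gammaMeasure (a + 1) b) := by
    have hc : 0 ≤ a / b ^ 2 := by positivity
    rw [← ENNReal.ofReal_le_ofReal_iff (mul_nonneg hc (integral_nonneg fun _ => sq_nonneg _)),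
      ENNReal.ofReal_mul hc,
      ofReal_integral_eq_lintegral_ofReal i4 (Filter.Eventually.of_forall fun _ => sq_nonneg _),
      ofReal_integral_eq_lintegral_ofReal i3 (Filter.Eventually.of_forall fun _ => sq_nonneg _)]
    refine le_trans (lintegral_mono fun x => ?_) (core ha hb _ (by fun_prop))
    rw [hg]
    exact cs g' hg' _ _
  refine le_trans ?_ A
  have e : ∫ x, (g x - g (a / b)) ^ 2 ∂(gammaMeasure a b)
    = ∫ x, g x ^ 2 ∂(gammaMeasure a b) - 2 * g (a / b) * ∫ x, g x ∂(gammaMeasure a b)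
      + g (a / b) ^ 2 := by
    have := lin3 i1 i2 (integrable_const (1:ℝ)) (-(2 * g (a / b))) (g (a / b) ^ 2)
    simp only [integral_const, probReal_univ, smul_eq_mul, mul_one] at this
    rw [sub_eq_add_neg, ← neg_mul, ← this]
    congr 1; ext x; ring
  rw [e]
  nlinarith [sq_nonneg (g (a / b) - ∫ x, g x ∂(gammaMeasure a b))]

lemma lower {a b : ℝ} (ha : 0 < a) (hb : 0 < b) (g g' : ℝ → ℝ) (hg' : Measurable g')
    (hgi : ∀ x y, IntervalIntegrable g' volume x y)
    (hg : ∀ x, g x - g (a / b) = ∫ t in (a / b)..x, g' t)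
    (h1 : MemLp g 2 (gammaMeasure a b)) (h2 : MemLp g' 2 (gammaMeasure (a + 1) b)) :
    a / b ^ 2 * (∫ x, g' x ∂(gammaMeasure (a + 1) b)) ^ 2 ≤
    ∫ x, g x ^ 2 ∂(gammaMeasure a b) - (∫ x, g x ∂(gammaMeasure a b)) ^ 2 := by
  have := isProbabilityMeasure_gammaMeasure ha hb
  have := isProbabilityMeasure_gammaMeasure (a := a + 1) (by linarith) hb
  have m3 : MemLp (fun x : ℝ => x) 2 (gammaMeasure a b) :=
    (memLp_two_iff_integrable_sq (by fun_prop)).2 (int_sq ha hb)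
  have i1 := h1.integrable_sq
  have i2 := h1.integrable one_le_two
  have i3 := int_id ha hb
  have i4 := int_sq ha hb
  have i5 : Integrable (fun x => g x * x) (gammaMeasure a b) := h1.integrable_mul m3
  have i6 := h2.integrable_sq
  have i7 := h2.integrable one_le_two
  have E1 : ∀ l : ℝ, ∫ x, (g x + l * x) ^ 2 ∂(gammaMeasure a b)
      = ∫ x, g x ^ 2 ∂(gammaMeasure a b) + 2 * l * ∫ x, g x * x ∂(gammaMeasure a b)
        + l ^ 2 * (a * (a + 1) / b ^ 2) := by
    intro l
    rw [← integral_sq_gm ha hb, ← lin3 i1 i5 i4]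
    congr 1; ext x; ring
  have E2 : ∀ l : ℝ, ∫ x, (g x + l * x) ∂(gammaMeasure a b)
      = ∫ x, g x ∂(gammaMeasure a b) + l * (a / b) := by
    intro l
    rw [integral_add i2 (i3.const_mul _), integral_const_mul, integral_id_gm ha hb]
  have E3 : ∀ l : ℝ, ∫ x, (g' x + l) ^ 2 ∂(gammaMeasure (a + 1) b)
      = ∫ x, g' x ^ 2 ∂(gammaMeasure (a + 1) b) + 2 * l * ∫ x, g' x ∂(gammaMeasure (a + 1) b)
        + l ^ 2 := by
    intro l
    have := lin3 i6 i7 (integrable_const (1:ℝ)) (2 * l) (l ^ 2)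
    simp only [integral_const, probReal_univ, smul_eq_mul, mul_one] at this
    rw [← this]
    congr 1; ext x; ring
  have U : ∀ l : ℝ, _ := fun l => upper ha hb (fun x => g x + l * x) (fun x => g' x + l)
    (by fun_prop) (fun x => by
      rw [intervalIntegral.integral_add (hgi _ _) (by simp), ← hg]
      simp; ring) (h1.add (m3.const_mul l)) (h2.add (memLp_const l))
  have V : ∀ l : ℝ, 0 ≤ ∫ x, (g x + l * x) ^ 2 ∂(gammaMeasure a b)
      - (∫ x, (g x + l * x) ∂(gammaMeasure a b)) ^ 2 := by
    intro l
    have hM : MemLp (fun x => g x + l * x) 2 (gammaMeasure a b) := h1.add (m3.const_mul l)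
    have := variance_eq_sub hM
    have h0 := variance_nonneg (fun x => g x + l * x) (gammaMeasure a b)
    rw [this] at h0
    exact h0
  simp only [E1, E2, E3] at U V
  generalize ∫ x, g x ^ 2 ∂(gammaMeasure a b) = A at *
  generalize ∫ x, g x ∂(gammaMeasure a b) = B at *
  generalize ∫ x, g x * x ∂(gammaMeasure a b) = C at *
  generalize ∫ x, g' x ∂(gammaMeasure (a + 1) b) = D at *
  generalize ∫ x, g' x ^ 2 ∂(gammaMeasure (a + 1) b) = G at *
  have hk : a * (a + 1) / b ^ 2 = a / b ^ 2 + (a / b) ^ 2 := by field_simp; ring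
  rw [hk] at U V
  generalize a / b ^ 2 = k at *
  generalize a / b = m at *
  have U' : ∀ l : ℝ, 2 * l * (C - B * m - k * D) ≤ k * G - (A - B ^ 2) := by
    intro l
    have := U l
    nlinarith
  have hz : C - B * m - k * D = 0 := by
    by_contra hne
    have := U' ((k * G - (A - B ^ 2) + 1) / (2 * (C - B * m - k * D)))
    field_simp at this
    linarith
  have := V (-D)
  have hC : C = B * m + k * D := by linarith
  subst hC
  nlinarith

theorem cacoullos_variance_bounds_gamma
    {Ω : Type*} [MeasureSpace Ω] [IsProbabilityMeasure (ℙ : Measure Ω)]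
    (a b : ℝ) (ha : 0 < a) (hb : 0 < b)
    (X Z : Ω → ℝ) (hX : Measurable X) (hZ : Measurable Z)
    (hXlaw : Measure.map X ℙ = gammaMeasure a b)
    (hZlaw : Measure.map Z ℙ = gammaMeasure (a + 1) b)
    (g g' : ℝ → ℝ)
    (hg'loc : LocallyIntegrable g' volume)
    (hg : ∀ x : ℝ, g x = g 0 + ∫ t in (0:ℝ)..x, g' t)
    (hint1 : Integrable (fun ω => (g' (Z ω)) ^ 2) ℙ)
    (hint2 : Integrable (fun ω => (g (X ω)) ^ 2) ℙ) :
    (a / b ^ 2) * (∫ ω, g' (Z ω) ∂ℙ) ^ 2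
        ≤ (∫ ω, (g (X ω)) ^ 2 ∂ℙ) - (∫ ω, g (X ω) ∂ℙ) ^ 2
      ∧ (∫ ω, (g (X ω)) ^ 2 ∂ℙ) - (∫ ω, g (X ω) ∂ℙ) ^ 2
        ≤ (a / b ^ 2) * ∫ ω, (g' (Z ω)) ^ 2 ∂ℙ := by
  have hgi0 : ∀ x y, IntervalIntegrable g' volume x y :=
    fun x y => (hg'loc.integrableOn_isCompact isCompact_uIcc).intervalIntegrable
  have hgc : Continuous g := by
    have : g = fun x => g 0 + ∫ t in (0:ℝ)..x, g' t := funext hg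
    rw [this]
    exact continuous_const.add (intervalIntegral.continuous_primitive hgi0 0)
  have hsm := hg'loc.aestronglyMeasurable
  obtain ⟨f, hf, hae⟩ := hsm.aemeasurable
  have hfi : ∀ x y, IntervalIntegrable f volume x y := fun x y =>
    (hgi0 x y).congr_ae (ae_restrict_of_ae hae)
  have hgf : ∀ x, g x - g (a / b) = ∫ t in (a / b)..x, f t := by
    intro x
    rw [← intervalIntegral.integral_congr_ae (f := g') (hae.mono fun _ h _ => h),
      hg x, hg (a / b), add_sub_add_left_eq_sub,
      intervalIntegral.integral_interval_sub_left (hgi0 0 _) (hgi0 0 _)]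
  have haeZ : g' =ᵐ[Measure.map Z ℙ] f := by
    rw [hZlaw]
    exact (withDensity_absolutelyContinuous _ _).ae_eq hae
  have haeZ' : ∀ᵐ ω, g' (Z ω) = f (Z ω) := ae_of_ae_map hZ.aemeasurable haeZ
  have q1 : ∫ ω, g' (Z ω) ∂ℙ = ∫ x, f x ∂(gammaMeasure (a + 1) b) := by
    rw [← hZlaw, integral_map hZ.aemeasurable hf.aestronglyMeasurable]
    exact integral_congr_ae haeZ'
  have q2 : ∫ ω, g' (Z ω) ^ 2 ∂ℙ = ∫ x, f x ^ 2 ∂(gammaMeasure (a + 1) b) := by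
    rw [← hZlaw, integral_map hZ.aemeasurable (by fun_prop)]
    exact integral_congr_ae (haeZ'.mono fun ω h => by simp only [h])
  have q3 : ∫ ω, g (X ω) ∂ℙ = ∫ x, g x ∂(gammaMeasure a b) := by
    rw [← hXlaw, integral_map hX.aemeasurable hgc.aestronglyMeasurable]
  have q4 : ∫ ω, g (X ω) ^ 2 ∂ℙ = ∫ x, g x ^ 2 ∂(gammaMeasure a b) := by
    rw [← hXlaw, integral_map hX.aemeasurable (by fun_prop)]
  have h1 : MemLp g 2 (gammaMeasure a b) := by
    rw [memLp_two_iff_integrable_sq hgc.aestronglyMeasurable, ← hXlaw,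
      integrable_map_measure (by fun_prop) hX.aemeasurable]
    exact hint2
  have h2 : MemLp f 2 (gammaMeasure (a + 1) b) := by
    rw [memLp_two_iff_integrable_sq hf.aestronglyMeasurable, ← hZlaw,
      integrable_map_measure (by fun_prop) hZ.aemeasurable]
    exact hint1.congr (haeZ'.mono fun ω h => by simp only [h, Function.comp])
  rw [q1, q2, q3, q4]
  exact ⟨lower ha hb g f hf hfi hgf h1 h2, upper ha hb g f hf hgf h1 h2⟩
end
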